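/- Let Σ be a complete connected translating graph in a direction v_θ = sin θ·e₃ + cos θ·e₂ (θ ∈ [0,π)), contained in the slab {(x,y,z) : |x| ≤ w}, w > 0. Then there exists t₁ > 0 such that for every t > t₁, the number of connected components of the slice Σ ∩ {y = t} equals the number of connected components of Σ ∩ {y ≥ t}, and the number of connected components of Σ ∩ {y = −t} equals the number of connected components of Σ ∩ {y ≤ −t}. -/

import Mathlib

open MeasureTheory Metric Real EuclideanSpace
open scoped RealInnerProductSpace ENNReal NNReal

noncomputable section

abbrev E3 : Type := EuclideanSpace ℝ (Fin 3)

def e1 : E3 := EuclideanSpace.single 0 1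
def e2 : E3 := EuclideanSpace.single 1 1
def e3 : E3 := EuclideanSpace.single 2 1

/-- First partial derivative of `u` in the first variable. -/
def pds (u : ℝ × ℝ → ℝ) (p : ℝ × ℝ) : ℝ := fderiv ℝ u p (1, 0)

/-- First partial derivative of `u` in the second variable. -/
def pdt (u : ℝ × ℝ → ℝ) (p : ℝ × ℝ) : ℝ := fderiv ℝ u p (0, 1)

/-- `S` is a translating graph in the direction of the unit vector `v`, with respect to the
orthonormal basis `(a, b, v)` of `ℝ³`, over the open connected domain `Ω ⊆ ℝ²`, given by the
smooth function `u : Ω → ℝ` solving the translator equation. -/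
structure IsTranslatingGraph (a b v : E3) (Ω : Set (ℝ × ℝ)) (u : ℝ × ℝ → ℝ)
    (S : Set E3) : Prop where
  norm_a : ‖a‖ = 1
  norm_b : ‖b‖ = 1
  norm_v : ‖v‖ = 1
  inner_ab : ⟪a, b⟫ = 0
  inner_av : ⟪a, v⟫ = 0
  inner_bv : ⟪b, v⟫ = 0
  isOpen_dom : IsOpen Ω
  isConnected_dom : IsConnected Ω
  smooth : ContDiffOn ℝ (⊤ : ℕ∞) u Ω
  pde : ∀ p ∈ Ω,
    (1 + (pdt u p) ^ 2) * pds (fun q => pds u q) p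
      - 2 * pds u p * pdt u p * pdt (fun q => pds u q) p
      + (1 + (pds u p) ^ 2) * pdt (fun q => pdt u q) p
    = (1 + (pds u p) ^ 2 + (pdt u p) ^ 2) *
        (⟪e3, v⟫ - pds u p * ⟪e3, a⟫ - pdt u p * ⟪e3, b⟫)
  graph_eq : S = {q : E3 | ∃ p ∈ Ω, q = p.1 • a + p.2 • b + u p • v}

/-- Entropy of a surface. -/
def entropy (S : Set E3) : ℝ≥0∞ :=
  ⨆ (x₀ : E3) (s₀ : ℝ) (_ : 0 < s₀),
    (ENNReal.ofReal (4 * π * s₀))⁻¹ *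
      ∫⁻ q in S, ENNReal.ofReal (Real.exp (-‖q - x₀‖ ^ 2 / (4 * s₀))) ∂(μH[2])

/-- Number of connected components (as a cardinal). -/
def numComponents (A : Set E3) : Cardinal := Cardinal.mk (ConnectedComponents A)

def vθ (θ : ℝ) : E3 := Real.sin θ • e3 + Real.cos θ • e2
def bθ (θ : ℝ) : E3 := Real.cos θ • e3 - Real.sin θ • e2


/-- The point of the translating graph over parameter `p`, for the basis `(e₁, b_θ, v_θ)`. -/
def graphPtθ (θ : ℝ) (u : ℝ × ℝ → ℝ) (p : ℝ × ℝ) : E3 :=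
  p.1 • e1 + p.2 • bθ θ + u p • vθ θ

/-- The Gauss map of a translating graph in the direction `v_θ`, as a function of the
parameter `p ∈ Ω`: `N = (v_θ − u_s e₁ − u_t b_θ)/√(1+u_s²+u_t²)`. -/
def gaussMapθ (θ : ℝ) (u : ℝ × ℝ → ℝ) (p : ℝ × ℝ) : E3 :=
  (Real.sqrt (1 + (pds u p) ^ 2 + (pdt u p) ^ 2))⁻¹ •
    (vθ θ - pds u p • e1 - pdt u p • bθ θ)

/-- Every continuous map to the circle has a continuous logarithm. -/
def HasCircleLifts (X : Type*) [TopologicalSpace X] : Prop :=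
  ∀ g : X → Circle, Continuous g → ∃ h : X → ℝ, Continuous h ∧ ∀ x, Circle.exp (h x) = g x

lemma eq_of_circle_exp_eq_one {X : Type*} [TopologicalSpace X] {s : Set X}
    (hs : IsPreconnected s) {h : X → ℝ} (hc : ContinuousOn h s)
    (h1 : ∀ x ∈ s, Circle.exp (h x) = 1) {x y : X} (hx : x ∈ s) (hy : y ∈ s) : h x = h y := by
  have himg : IsPreconnected (h '' s) := hs.image h hc
  have hord := himg.ordConnected
  have key : ∀ a ∈ h '' s, ∀ b ∈ h '' s, ¬ a < b := by
    intro a ha b hb hab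
    have hm : min b (a + 1) ∈ h '' s :=
      hord.out ha hb ⟨le_min hab.le (by linarith), min_le_left _ _⟩
    obtain ⟨z, hz, hze⟩ := hm
    obtain ⟨z', hz', hze'⟩ := ha
    have e1 := h1 z hz
    have e2 := h1 z' hz'
    rw [hze] at e1
    rw [hze'] at e2
    obtain ⟨m, hm⟩ := Circle.exp_eq_exp.1 (e1.trans e2.symm)
    have hpos : 0 < min b (a + 1) - a := by
      rcases min_choice b (a + 1) with h' | h' <;> rw [h'] <;> linarith
    have hle : min b (a + 1) - a ≤ 1 := by linarith [min_le_right b (a + 1)]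
    have hmm : (m : ℝ) * (2 * π) = min b (a + 1) - a := by linarith
    have hp := Real.pi_gt_three
    have hm0 : (0 : ℝ) < m := by
      by_contra hcon
      have : (m : ℝ) * (2 * π) ≤ 0 := mul_nonpos_of_nonpos_of_nonneg (by linarith) (by linarith)
      linarith
    have hm1 : (1 : ℝ) ≤ m := by exact_mod_cast Int.cast_pos.1 hm0
    nlinarith
  exact le_antisymm (not_lt.1 (key _ ⟨y, hy, rfl⟩ _ ⟨x, hx, rfl⟩))
    (not_lt.1 (key _ ⟨x, hx, rfl⟩ _ ⟨y, hy, rfl⟩))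

lemma sub_eq_of_circle_exp_eq {X : Type*} [TopologicalSpace X] {s : Set X}
    (hs : IsPreconnected s) {h k : X → ℝ} (hh : ContinuousOn h s) (hk : ContinuousOn k s)
    (h1 : ∀ x ∈ s, Circle.exp (h x) = Circle.exp (k x)) {x y : X} (hx : x ∈ s) (hy : y ∈ s) :
    h x - k x = h y - k y := by
  refine eq_of_circle_exp_eq_one (h := fun x => h x - k x) hs (hh.sub hk) ?_ hx hy
  intro z hz
  rw [Circle.exp_sub, h1 z hz, div_self']

lemma circle_exp_pi_eq_neg_pi : Circle.exp π = Circle.exp (-π) := by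
  rw [Circle.exp_eq_exp]
  exact ⟨1, by push_cast; ring⟩

/-- A connected normal space with circle lifts is unicoherent. -/
theorem HasCircleLifts.isPreconnected_inter {X : Type*} [TopologicalSpace X] [NormalSpace X]
    (hX : HasCircleLifts X) {A B : Set X} (hA : IsClosed A) (hB : IsClosed B)
    (hA' : IsPreconnected A) (hB' : IsPreconnected B) (hAB : A ∪ B = Set.univ) :
    IsPreconnected (A ∩ B) := by
  rw [isPreconnected_closed_iff]
  intro P Q hP hQ hPQ hPn hQn
  by_contra hne
  rw [Set.not_nonempty_iff_eq_empty] at hne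
  have hdisj : Disjoint (A ∩ B ∩ P) (A ∩ B ∩ Q) := by
    rw [Set.disjoint_iff]
    rintro x ⟨⟨hx, hxP⟩, _, hxQ⟩
    have : x ∈ A ∩ B ∩ (P ∩ Q) := ⟨hx, hxP, hxQ⟩
    rwa [hne] at this
  obtain ⟨h, h0, h1, -⟩ := exists_continuous_zero_one_of_isClosed
    ((hA.inter hB).inter hP) ((hA.inter hB).inter hQ) hdisj
  classical
  let g : X → Circle := fun x => if x ∈ A then Circle.exp (π * h x) else Circle.exp (-(π * h x))
  have hgA : ∀ x ∈ A, g x = Circle.exp (π * h x) := fun x hx => if_pos hx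
  have hgB : ∀ x ∈ B, g x = Circle.exp (-(π * h x)) := by
    intro x hx
    by_cases hxA : x ∈ A
    · rw [hgA x hxA]
      rcases hPQ ⟨hxA, hx⟩ with hp | hq
      · rw [h0 ⟨⟨hxA, hx⟩, hp⟩]; simp
      · rw [h1 ⟨⟨hxA, hx⟩, hq⟩]; simpa using circle_exp_pi_eq_neg_pi
    · exact if_neg hxA
  have hgc : Continuous g := by
    rw [← continuousOn_univ, ← hAB]
    refine ContinuousOn.union_of_isClosed ?_ ?_ hA hB
    · exact ContinuousOn.congr (Continuous.continuousOn (by fun_prop)) hgA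
    · exact ContinuousOn.congr (Continuous.continuousOn (by fun_prop)) hgB
  obtain ⟨φ, hφ, hφg⟩ := hX g hgc
  obtain ⟨p, hp, hpP⟩ := hPn
  obtain ⟨q, hq, hqQ⟩ := hQn
  have e1 := sub_eq_of_circle_exp_eq (k := fun x => π * h x) hA' hφ.continuousOn
    (Continuous.continuousOn (by fun_prop)) (fun x hx => by rw [hφg, hgA x hx]) hp.1 hq.1
  have e2 := sub_eq_of_circle_exp_eq (k := fun x => -(π * h x)) hB' hφ.continuousOn
    (Continuous.continuousOn (by fun_prop)) (fun x hx => by rw [hφg, hgB x hx]) hp.2 hq.2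
  have hp0 : h p = 0 := h0 ⟨hp, hpP⟩
  have hq0 : h q = 1 := h1 ⟨hq, hqQ⟩
  rw [hp0, hq0] at e1 e2
  have := Real.pi_pos
  linarith

/-- In a connected, locally connected space, a component of a proper closed set meets the closure
of the complement. -/
lemma component_inter_closure_compl {X : Type*} [TopologicalSpace X] [ConnectedSpace X]
    [LocallyConnectedSpace X] {K : Set X} (hK : IsClosed K) (hne : Kᶜ.Nonempty) {p : X}
    (hp : p ∈ K) : (connectedComponentIn K p ∩ closure Kᶜ).Nonempty := by
  by_contra hcon
  rw [Set.not_nonempty_iff_eq_empty] at hcon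
  have hopen : IsOpen (connectedComponentIn K p) := by
    rw [isOpen_iff_mem_nhds]
    intro x hx
    have hxi : x ∈ interior K := by
      rw [interior_eq_compl_closure_compl]
      intro h
      have : x ∈ connectedComponentIn K p ∩ closure Kᶜ := ⟨hx, h⟩
      rwa [hcon] at this
    rw [connectedComponentIn_eq hx]
    exact connectedComponentIn_mem_nhds (mem_interior_iff_mem_nhds.1 hxi)
  have hclosed : IsClosed (connectedComponentIn K p) := by
    have h1 : closure (connectedComponentIn K p) ⊆ K :=
      closure_minimal (connectedComponentIn_subset K p) hK
    have h2 : closure (connectedComponentIn K p) ⊆ connectedComponentIn K p :=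
      isPreconnected_connectedComponentIn.closure.subset_connectedComponentIn
        (subset_closure (mem_connectedComponentIn hp)) h1
    exact isClosed_of_closure_subset h2
  have huniv := IsClopen.eq_univ ⟨hclosed, hopen⟩ ⟨p, mem_connectedComponentIn hp⟩
  obtain ⟨y, hy⟩ := hne
  exact hy (connectedComponentIn_subset K p (huniv ▸ Set.mem_univ y))

lemma IsClosed.connectedComponentIn' {X : Type*} [TopologicalSpace X] {K : Set X}
    (hK : IsClosed K) {p : X} (hp : p ∈ K) : IsClosed (connectedComponentIn K p) :=
  isClosed_of_closure_subset
    (isPreconnected_connectedComponentIn.closure.subset_connectedComponentIn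
      (subset_closure (mem_connectedComponentIn hp))
      (closure_minimal (connectedComponentIn_subset K p) hK))

/-- The complement of a component of `{t ≤ f}` is connected, when `{f < t}` is. -/
lemma isPreconnected_compl_component {X : Type*} [TopologicalSpace X] [ConnectedSpace X]
    [LocallyConnectedSpace X] {K : Set X} (hK : IsClosed K) (hL : IsConnected Kᶜ) {p : X} :
    IsPreconnected (connectedComponentIn K p)ᶜ := by
  obtain ⟨x0, hx0⟩ := hL.nonempty
  refine isPreconnected_of_forall x0 ?_
  have hLU : Kᶜ ⊆ (connectedComponentIn K p)ᶜ :=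
    Set.compl_subset_compl.2 (connectedComponentIn_subset K p)
  intro y hy
  by_cases hyK : y ∈ K
  · obtain ⟨z, hz, hzL⟩ := component_inter_closure_compl hK hL.nonempty hyK
    refine ⟨insert z Kᶜ ∪ connectedComponentIn K y, ?_, Or.inl (Or.inr hx0),
      Or.inr (mem_connectedComponentIn hyK), ?_⟩
    · have hsub : connectedComponentIn K y ⊆ (connectedComponentIn K p)ᶜ := by
        intro a ha ha'
        apply hy
        rw [connectedComponentIn_eq ha', ← connectedComponentIn_eq ha]
        exact mem_connectedComponentIn hyK
      exact Set.union_subset (Set.insert_subset (hsub hz) hLU) hsub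
    · exact IsPreconnected.union z (Set.mem_insert _ _) hz
        (hL.isPreconnected.subset_closure (Set.subset_insert _ _)
          (Set.insert_subset hzL subset_closure)) isPreconnected_connectedComponentIn
  · exact ⟨Kᶜ, hLU, hx0, hyK, hL.isPreconnected⟩

/-- If `{f < t}` is connected and local minima of `f` are locally constant, each component of
`{t ≤ f}` contains exactly one component of `{f = t}`. -/
theorem isConnected_component_inter_level {X : Type*} [TopologicalSpace X] [ConnectedSpace X]
    [LocallyConnectedSpace X] [NormalSpace X] (hX : HasCircleLifts X) {f : X → ℝ}
    (hf : Continuous f) (hmin : ∀ p, IsLocalMin f p → ∀ᶠ q in nhds p, f q = f p) {t : ℝ}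
    (hL : IsConnected {x | f x < t}) {p : X} (hp : t ≤ f p) :
    IsConnected (connectedComponentIn {x | t ≤ f x} p ∩ {x | f x = t}) := by
  have hK : IsClosed {x | t ≤ f x} := isClosed_le continuous_const hf
  have hKc : {x | t ≤ f x}ᶜ = {x | f x < t} := by ext; simp
  rw [← hKc] at hL
  set A := connectedComponentIn {x | t ≤ f x} p with hAdef
  have hAK : A ⊆ {x | t ≤ f x} := connectedComponentIn_subset _ _
  have hA : IsClosed A := hK.connectedComponentIn' hp
  have hU : IsPreconnected Aᶜ := isPreconnected_compl_component hK hL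
  have hD0 : IsPreconnected (A ∩ closure Aᶜ) :=
    hX.isPreconnected_inter hA isClosed_closure isPreconnected_connectedComponentIn hU.closure
      (Set.eq_univ_of_forall fun x => by
        by_cases h : x ∈ A
        · exact Or.inl h
        · exact Or.inr (subset_closure h))
  have hD0ne : (A ∩ closure Aᶜ).Nonempty :=
    (component_inter_closure_compl hK hL.nonempty hp).mono
      (Set.inter_subset_inter_right _ (closure_mono (Set.compl_subset_compl.2 hAK)))
  have hD0t : A ∩ closure Aᶜ ⊆ A ∩ {x | f x = t} := by
    rintro x ⟨hxA, hxU⟩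
    refine ⟨hxA, le_antisymm ?_ (hAK hxA)⟩
    by_contra hcon
    push Not at hcon
    have hn : {x | t ≤ f x} ∈ nhds x := by
      filter_upwards [hf.continuousAt.eventually (lt_mem_nhds hcon)] with y hy using le_of_lt hy
    have hn2 := connectedComponentIn_mem_nhds hn
    rw [← connectedComponentIn_eq hxA] at hn2
    obtain ⟨y, hy, hy'⟩ := mem_closure_iff_nhds.1 hxU _ hn2
    exact hy' hy
  obtain ⟨x0, hx0⟩ := hD0ne
  refine ⟨⟨x0, hD0t hx0⟩, ?_⟩
  refine isPreconnected_of_forall x0 ?_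
  intro y hy
  by_cases hyU : y ∈ closure Aᶜ
  · exact ⟨_, hD0t, hx0, ⟨hy.1, hyU⟩, hD0⟩
  set M := interior A ∩ {x | f x = t} with hM
  have hMopen : IsOpen M := by
    rw [isOpen_iff_mem_nhds]
    rintro z ⟨hz, hzt⟩
    have hzt' : f z = t := hzt
    have hi := isOpen_interior.mem_nhds hz
    have hloc : IsLocalMin f z := by
      filter_upwards [hi] with q hq
      rw [hzt']
      exact hAK (interior_subset hq)
    filter_upwards [hi, hmin z hloc] with q hq hq'
    exact ⟨hq, by rw [Set.mem_ofPred_eq, hq', hzt']⟩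
  have hyM : y ∈ M := ⟨by rwa [interior_eq_compl_closure_compl], hy.2⟩
  have hC : IsOpen (connectedComponentIn M y) := hMopen.connectedComponentIn
  have hclD : closure (connectedComponentIn M y) ⊆ A ∩ {x | f x = t} := by
    refine closure_minimal ?_ (hA.inter (isClosed_eq hf continuous_const))
    exact (connectedComponentIn_subset M y).trans
      (Set.inter_subset_inter_left _ interior_subset)
  obtain ⟨z, hz, hzM⟩ : ∃ z ∈ closure (connectedComponentIn M y), z ∉ M := by
    by_contra hcon
    push Not at hcon
    have h2 : closure (connectedComponentIn M y) ⊆ connectedComponentIn M y :=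
      isPreconnected_connectedComponentIn.closure.subset_connectedComponentIn
        (subset_closure (mem_connectedComponentIn hyM)) hcon
    have huniv := IsClopen.eq_univ ⟨isClosed_of_closure_subset h2, hC⟩
      ⟨y, mem_connectedComponentIn hyM⟩
    obtain ⟨q, hq⟩ := hL.nonempty
    exact hq (hAK (interior_subset (connectedComponentIn_subset M y
      (huniv ▸ Set.mem_univ q)).1))
  have hzD := hclD hz
  have hzU : z ∈ closure Aᶜ := by
    by_contra hcon
    exact hzM ⟨by rwa [interior_eq_compl_closure_compl], hzD.2⟩
  exact ⟨(A ∩ closure Aᶜ) ∪ closure (connectedComponentIn M y), Set.union_subset hD0t hclD,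
    Or.inl hx0, Or.inr (subset_closure (mem_connectedComponentIn hyM)),
    IsPreconnected.union z ⟨hzD.1, hzU⟩ hz hD0 isPreconnected_connectedComponentIn.closure⟩

/-- A subset meeting each component of `F` in a connected set has as many components as `F`. -/
theorem mk_connectedComponents_eq {X : Type*} [TopologicalSpace X] {D F : Set X} (hDF : D ⊆ F)
    (h : ∀ p ∈ F, IsConnected (connectedComponentIn F p ∩ D)) :
    Cardinal.mk (ConnectedComponents D) = Cardinal.mk (ConnectedComponents F) := by
  have hc : Continuous (Set.inclusion hDF) := continuous_inclusion hDF
  refine Cardinal.mk_congr (Equiv.ofBijective hc.connectedComponentsMap ⟨?_, ?_⟩)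
  · intro a b
    obtain ⟨a, rfl⟩ := ConnectedComponents.surjective_coe a
    obtain ⟨b, rfl⟩ := ConnectedComponents.surjective_coe b
    intro hab
    have hab' : (Set.inclusion hDF a : ConnectedComponents F) = Set.inclusion hDF b := hab
    rw [ConnectedComponents.coe_eq_coe'] at hab' ⊢
    have hb : (b : X) ∈ F := hDF b.2
    have hain : (a : X) ∈ connectedComponentIn F b := by
      rw [connectedComponentIn_eq_image hb]
      exact ⟨_, hab', rfl⟩
    have hsub := (h b hb).isPreconnected.subset_connectedComponentIn
      ⟨mem_connectedComponentIn hb, b.2⟩ Set.inter_subset_right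
    have := hsub ⟨hain, a.2⟩
    rw [connectedComponentIn_eq_image b.2] at this
    obtain ⟨a', ha', hae⟩ := this
    rwa [← Subtype.ext hae]
  · intro p
    obtain ⟨p, rfl⟩ := ConnectedComponents.surjective_coe p
    obtain ⟨q, hq, hqD⟩ := (h p p.2).nonempty
    refine ⟨((⟨q, hqD⟩ : D) : ConnectedComponents D), ?_⟩
    show ((Set.inclusion hDF ⟨q, hqD⟩ : F) : ConnectedComponents F) = p
    rw [ConnectedComponents.coe_eq_coe']
    rw [connectedComponentIn_eq_image p.2] at hq
    obtain ⟨q', hq', hqe⟩ := hq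
    have : q' = Set.inclusion hDF ⟨q, hqD⟩ := Subtype.ext hqe
    rwa [← this]

lemma hasCircleLifts_plane : HasCircleLifts (ℝ × ℝ) := by
  intro g hg
  obtain ⟨e, he⟩ := Circle.exp_surjective (g 0)
  obtain ⟨F, ⟨-, hF⟩, -⟩ := Circle.isCoveringMap_exp.existsUnique_continuousMap_lifts
    ⟨g, hg⟩ 0 e he
  exact ⟨F, F.continuous, fun x => congrFun hF x⟩

/-- Circle-valued maps on a closed rectangle have logarithms. -/
lemma exists_lift_rect {a b c d : ℝ} (hab : a ≤ b) (hcd : c ≤ d) {g : ℝ × ℝ → Circle}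
    (hg : ContinuousOn g (Set.Icc a b ×ˢ Set.Icc c d)) :
    ∃ h : ℝ × ℝ → ℝ, Continuous h ∧ ∀ x ∈ Set.Icc a b ×ˢ Set.Icc c d, Circle.exp (h x) = g x := by
  let r : ℝ × ℝ → ℝ × ℝ := fun x => (Set.projIcc a b hab x.1, Set.projIcc c d hcd x.2)
  have hr : Continuous r := by
    have h1 := (continuous_projIcc (h := hab)).comp (continuous_fst (X := ℝ) (Y := ℝ))
    have h2 := (continuous_projIcc (h := hcd)).comp (continuous_snd (X := ℝ) (Y := ℝ))
    exact (continuous_subtype_val.comp h1).prodMk (continuous_subtype_val.comp h2)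
  have hmem : ∀ x, r x ∈ Set.Icc a b ×ˢ Set.Icc c d := fun x => ⟨Subtype.prop _, Subtype.prop _⟩
  obtain ⟨h, hh, hhe⟩ := hasCircleLifts_plane (g ∘ r) (hg.comp_continuous hr hmem)
  refine ⟨h, hh, fun x hx => ?_⟩
  rw [hhe]
  have : r x = x := by
    simp only [r]
    rw [Set.projIcc_of_mem hab hx.1, Set.projIcc_of_mem hcd hx.2]
  simp [this]

/-- Continuous polar angle of a nonvanishing planar map. -/
lemma exists_polar {A : Type*} [TopologicalSpace A] (hA : HasCircleLifts A) {F : A → ℂ}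
    (hF : Continuous F) (h0 : ∀ a, F a ≠ 0) :
    ∃ θ : A → ℝ, Continuous θ ∧ ∀ a, (F a).re = ‖F a‖ * Real.cos (θ a) ∧
      (F a).im = ‖F a‖ * Real.sin (θ a) := by
  have hn : ∀ a, (‖F a‖ : ℂ) ≠ 0 := fun a => by simpa using h0 a
  let g : A → Circle := fun a => ⟨F a / ‖F a‖, by
    rw [← SetLike.mem_coe, Submonoid.coe_unitSphere, mem_sphere_zero_iff_norm, norm_div, Complex.norm_real, norm_norm,
      div_self (norm_ne_zero_iff.2 (h0 a))]⟩
  have hg : Continuous g :=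
    Continuous.subtype_mk (hF.div (Complex.continuous_ofReal.comp hF.norm) hn) _
  obtain ⟨θ, hθ, hθg⟩ := hA g hg
  refine ⟨θ, hθ, fun a => ?_⟩
  have h1 : (Circle.exp (θ a) : ℂ) = F a / ‖F a‖ := congrArg Subtype.val (hθg a)
  rw [Circle.coe_exp, eq_div_iff (hn a)] at h1
  rw [Complex.exp_mul_I, ← Complex.ofReal_cos, ← Complex.ofReal_sin] at h1
  have hre := congrArg Complex.re h1
  have him := congrArg Complex.im h1
  simp [-Complex.ofReal_cos, -Complex.ofReal_sin] at hre him
  constructor <;> linarith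

/-- An angle starting in `[0, π]` along which the sine stays nonnegative stays in `[0, π]`. -/
lemma angle_mem_Icc {f : ℝ → ℝ} (hf : Continuous f) (hs : ∀ v, 0 ≤ Real.sin (f v))
    (h0 : f 0 ∈ Set.Icc 0 π) (v : ℝ) : f v ∈ Set.Icc 0 π := by
  have hpi := Real.pi_pos
  have hord : Set.OrdConnected (f '' Set.univ) :=
    (isPreconnected_univ.image f hf.continuousOn).ordConnected
  have m0 : f 0 ∈ f '' Set.univ := ⟨0, trivial, rfl⟩
  have mv : f v ∈ f '' Set.univ := ⟨v, trivial, rfl⟩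
  constructor
  · by_contra hcon
    push Not at hcon
    have : max (f v) (-(π / 2)) ∈ f '' Set.univ := hord.out mv m0
      ⟨le_max_left _ _, max_le (hcon.le.trans h0.1) (by linarith [h0.1])⟩
    obtain ⟨z, -, hz⟩ := this
    have h1 := hs z
    rw [hz] at h1
    have h2 : Real.sin (max (f v) (-(π / 2))) < 0 := by
      apply Real.sin_neg_of_neg_of_neg_pi_lt
      · exact max_lt hcon (by linarith)
      · exact lt_of_lt_of_le (by linarith) (le_max_right _ _)
    linarith
  · by_contra hcon
    push Not at hcon
    have : min (f v) (π + π / 2) ∈ f '' Set.univ := hord.out m0 mv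
      ⟨le_min (h0.2.trans hcon.le) (by linarith [h0.2]), min_le_left _ _⟩
    obtain ⟨z, -, hz⟩ := this
    have h1 := hs z
    rw [hz] at h1
    have h2 : Real.sin (min (f v) (π + π / 2) - π) > 0 := by
      apply Real.sin_pos_of_pos_of_lt_pi
      · rw [sub_pos]; exact lt_min hcon (by linarith)
      · linarith [min_le_right (f v) (π + π / 2)]
    rw [Real.sin_sub_pi] at h2
    linarith

lemma angle_add_pi {f : ℝ → ℝ} (hf : Continuous f) (hs : ∀ v, 0 ≤ Real.sin (f v))
    (h0 : Real.cos (f 0) = 1) (h1 : Real.cos (f 1) = -1) : f 1 = f 0 + π := by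
  have hpi := Real.pi_pos
  obtain ⟨k, hk⟩ := (Real.cos_eq_one_iff _).1 h0
  have := angle_mem_Icc (f := fun v => f v - f 0) (by fun_prop)
    (fun v => by rw [← hk, Real.sin_sub_int_mul_two_pi]; exact hs v) (by simp [hpi.le]) 1
  have hc : Real.cos (f 1 - f 0) = -1 := by rw [← hk, Real.cos_sub_int_mul_two_pi, h1]
  have h2 : f 1 - f 0 = π := Real.injOn_cos this ⟨hpi.le, le_rfl⟩ (by rw [hc, Real.cos_pi])
  linarith

lemma angle_eq {f : ℝ → ℝ} (hf : Continuous f) (hs : ∀ v, 0 ≤ Real.sin (f v))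
    (h0 : Real.cos (f 0) = -1) (h1 : Real.cos (f 1) = -1) : f 1 = f 0 := by
  have hpi := Real.pi_pos
  have h0' : Real.cos (f 0 - π) = 1 := by rw [Real.cos_sub_pi, h0]; norm_num
  obtain ⟨k, hk⟩ := (Real.cos_eq_one_iff _).1 h0'
  have := angle_mem_Icc (f := fun v => f v - (f 0 - π)) (by fun_prop)
    (fun v => by rw [← hk, Real.sin_sub_int_mul_two_pi]; exact hs v) (by simp [hpi.le]) 1
  have hc : Real.cos (f 1 - (f 0 - π)) = -1 := by rw [← hk, Real.cos_sub_int_mul_two_pi, h1]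
  have h2 : f 1 - (f 0 - π) = π := Real.injOn_cos this ⟨hpi.le, le_rfl⟩ (by rw [hc, Real.cos_pi])
  linarith

/-- Two paths in a closed half plane with interlaced endpoints on the boundary line meet. -/
theorem exists_crossing {p q : ℝ → ℝ × ℝ} (hp : Continuous p) (hq : Continuous q) {H : ℝ}
    (hpH : ∀ u, (p u).2 ≤ H) (hqH : ∀ v, (q v).2 ≤ H) (p0 : (p 0).2 = H) (p1 : (p 1).2 = H)
    (q0 : (q 0).2 = H) (q1 : (q 1).2 = H) (h02 : (p 0).1 < (q 0).1) (h23 : (q 0).1 < (p 1).1)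
    (h34 : (p 1).1 < (q 1).1) : ∃ u v, p u = q v := by
  by_contra hcon
  push Not at hcon
  let F : ℝ × ℝ → ℂ := fun x => ⟨(p x.1).1 - (q x.2).1, (p x.1).2 - (q x.2).2⟩
  have hFe : F = fun x => (((p x.1).1 - (q x.2).1 : ℝ) : ℂ) +
      (((p x.1).2 - (q x.2).2 : ℝ) : ℂ) * Complex.I := by
    funext x; exact Complex.mk_eq_add_mul_I _ _
  have hFc : Continuous F := by rw [hFe]; fun_prop
  have hF0 : ∀ x, F x ≠ 0 := by
    intro x hx
    have h1 := congrArg Complex.re hx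
    have h2 := congrArg Complex.im hx
    simp only [F, Complex.zero_re, Complex.zero_im] at h1 h2
    exact hcon x.1 x.2 (Prod.ext (by linarith) (by linarith))
  obtain ⟨θ, hθ, hθF⟩ := exists_polar hasCircleLifts_plane hFc hF0
  have hpos : ∀ x, 0 < ‖F x‖ := fun x => norm_pos_iff.2 (hF0 x)
  have hsin : ∀ x, 0 ≤ (F x).im → 0 ≤ Real.sin (θ x) := fun x h => by
    rw [(hθF x).2] at h; exact nonneg_of_mul_nonneg_right h (hpos x)
  have hsin' : ∀ x, (F x).im ≤ 0 → Real.sin (θ x) ≤ 0 := fun x h => by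
    rw [(hθF x).2] at h
    by_contra h'
    push Not at h'
    linarith [mul_pos (hpos x) h']
  have hcos : ∀ x, (F x).im = 0 → 0 < (F x).re → Real.cos (θ x) = 1 := by
    intro x h h'
    have hs : Real.sin (θ x) = 0 := by
      have := (hθF x).2; rw [h] at this
      exact (mul_eq_zero.1 this.symm).resolve_left (hpos x).ne'
    rw [(hθF x).1] at h'
    have hc : 0 < Real.cos (θ x) := pos_of_mul_pos_right h' (hpos x).le
    nlinarith [Real.sin_sq_add_cos_sq (θ x)]
  have hcos' : ∀ x, (F x).im = 0 → (F x).re < 0 → Real.cos (θ x) = -1 := by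
    intro x h h'
    have hs : Real.sin (θ x) = 0 := by
      have := (hθF x).2; rw [h] at this
      exact (mul_eq_zero.1 this.symm).resolve_left (hpos x).ne'
    rw [(hθF x).1] at h'
    have hc : Real.cos (θ x) < 0 := by
      by_contra h2
      push Not at h2
      linarith [mul_nonneg (hpos x).le h2]
    nlinarith [Real.sin_sq_add_cos_sq (θ x)]
  -- bottom edge, traversed with the opposite orientation of the angle
  have b := angle_add_pi (f := fun u => -θ (1 - u, 0)) (by fun_prop)
    (fun u => by
      rw [Real.sin_neg]
      have := hsin' (1 - u, 0) (by simp only [F, q0]; linarith [hpH (1 - u)])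
      linarith)
    (by rw [Real.cos_neg]; exact hcos _ (by simp [F, p1, q0]) (by simpa [F] using h23))
    (by rw [Real.cos_neg]; exact hcos' _ (by simp [F, p0, q0]) (by simpa [F] using h02))
  have r := angle_add_pi (f := fun v => θ (1, v)) (by fun_prop)
    (fun v => hsin _ (by simp only [F, p1]; linarith [hqH v]))
    (hcos _ (by simp [F, p1, q0]) (by simpa [F] using h23))
    (hcos' _ (by simp [F, p1, q1]) (by simpa [F] using h34))
  have t := angle_eq (f := fun u => -θ (u, 1)) (by fun_prop)
    (fun u => by
      rw [Real.sin_neg]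
      have := hsin' (u, 1) (by simp only [F, q1]; linarith [hpH u])
      linarith)
    (by rw [Real.cos_neg]
        exact hcos' _ (by simp [F, p0, q1]) (by simp only [F]; linarith))
    (by rw [Real.cos_neg]; exact hcos' _ (by simp [F, p1, q1]) (by simpa [F] using h34))
  have l := angle_eq (f := fun v => θ (0, v)) (by fun_prop)
    (fun v => hsin _ (by simp only [F, p0]; linarith [hqH v]))
    (hcos' _ (by simp [F, p0, q0]) (by simpa [F] using h02))
    (hcos' _ (by simp [F, p0, q1]) (by simp only [F]; linarith))
  have := Real.pi_pos
  norm_num at b r t l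
  linarith

/-- Indicator of `i < x` as a real number. -/
def stepInd (i x : ℤ) : ℝ := if i < x then 1 else 0

lemma stepInd_of_lt {i x : ℤ} (h : i < x) : stepInd i x = 1 := if_pos h
lemma stepInd_of_le {i x : ℤ} (h : x ≤ i) : stepInd i x = 0 := if_neg (not_lt.2 h)

lemma sum_Ico_int_succ (F : ℤ → ℝ) {a b : ℤ} (h : a ≤ b) :
    ∑ l ∈ Finset.Ico a (b + 1), F l = ∑ l ∈ Finset.Ico a b, F l + F b := by
  have : Finset.Ico a (b + 1) = insert b (Finset.Ico a b) := by
    ext x; simp only [Finset.mem_Ico, Finset.mem_insert]; omega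
  rw [this, Finset.sum_insert (by simp), add_comm]

lemma sub_eq_sum_stepInd (F : ℤ → ℝ) {N b : ℤ} (h1 : -N ≤ b) (h2 : b ≤ N) :
    F b = F (-N) + ∑ j ∈ Finset.Ico (-N) N, (F (j + 1) - F j) * stepInd j b := by
  have hsplit : ∑ j ∈ Finset.Ico (-N) N, (F (j + 1) - F j) * stepInd j b =
      ∑ j ∈ Finset.Ico (-N) b, (F (j + 1) - F j) := by
    rw [← Finset.sum_subset (Finset.Ico_subset_Ico_right h2)]
    · refine Finset.sum_congr rfl fun j hj => ?_
      rw [stepInd_of_lt (Finset.mem_Ico.1 hj).2, mul_one]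
    · intro j hj hj'
      rw [Finset.mem_Ico] at hj hj'
      rw [stepInd_of_le (by omega), mul_zero]
  rw [hsplit]
  clear hsplit h2
  induction b, h1 using Int.leInduction with
  | base => simp
  | succ b hb ih => rw [sum_Ico_int_succ _ hb]; linarith

/-- Winding number of the lattice walk `v 0, …, v n` around the unit square with corner `(i, j)`. -/
def latticeWinding (v : ℕ → ℤ × ℤ) (n : ℕ) (i j : ℤ) : ℝ :=
  ∑ k ∈ Finset.range n, stepInd i (v (k + 1)).1 * (stepInd j (v (k + 1)).2 - stepInd j (v k).2)

lemma latticeWinding_eq_horizontal {v : ℕ → ℤ × ℤ} {n : ℕ} (hv : v n = v 0) (i j : ℤ) :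
    latticeWinding v n i j =
      -∑ k ∈ Finset.range n, (stepInd i (v (k + 1)).1 - stepInd i (v k).1) * stepInd j (v k).2 := by
  have h := Finset.sum_range_sub (fun k => stepInd i (v k).1 * stepInd j (v k).2) n
  rw [hv, sub_self] at h
  rw [latticeWinding, eq_neg_iff_add_eq_zero, ← Finset.sum_add_distrib, ← h]
  exact Finset.sum_congr rfl fun k _ => by ring

lemma exists_vertical_step {v : ℕ → ℤ × ℤ} {n : ℕ} {i j : ℤ}
    (h : latticeWinding v n i j ≠ latticeWinding v n (i + 1) j) :
    ∃ k < n, (v (k + 1)).1 = i + 1 ∧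
      (((v k).2 ≤ j ∧ j < (v (k + 1)).2) ∨ ((v (k + 1)).2 ≤ j ∧ j < (v k).2)) := by
  by_contra hcon
  push Not at hcon
  apply h
  refine Finset.sum_congr rfl fun k hk => ?_
  by_cases hx : (v (k + 1)).1 = i + 1
  · obtain ⟨h1, h2⟩ := hcon k (Finset.mem_range.1 hk) hx
    rcases le_or_gt (v k).2 j with h3 | h3
    · rw [stepInd_of_le h3, stepInd_of_le (h1 h3)]; ring
    · have h4 : j < (v (k + 1)).2 := by
        by_contra h5
        exact absurd (h2 (not_lt.1 h5)) (not_le.2 h3)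
      rw [stepInd_of_lt h3, stepInd_of_lt h4]; ring
  · congr 1
    rcases lt_or_gt_of_ne hx with h1 | h1
    · rw [stepInd_of_le (by omega), stepInd_of_le (by omega)]
    · rw [stepInd_of_lt (by omega), stepInd_of_lt (by omega)]

lemma exists_horizontal_step {v : ℕ → ℤ × ℤ} {n : ℕ} (hv : v n = v 0) {i j : ℤ}
    (h : latticeWinding v n i j ≠ latticeWinding v n i (j + 1)) :
    ∃ k < n, (v k).2 = j + 1 ∧
      (((v k).1 ≤ i ∧ i < (v (k + 1)).1) ∨ ((v (k + 1)).1 ≤ i ∧ i < (v k).1)) := by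
  by_contra hcon
  push Not at hcon
  apply h
  rw [latticeWinding_eq_horizontal hv, latticeWinding_eq_horizontal hv]
  congr 1
  refine Finset.sum_congr rfl fun k hk => ?_
  by_cases hx : (v k).2 = j + 1
  · obtain ⟨h1, h2⟩ := hcon k (Finset.mem_range.1 hk) hx
    rcases le_or_gt (v k).1 i with h3 | h3
    · rw [stepInd_of_le h3, stepInd_of_le (h1 h3)]; ring
    · have h4 : i < (v (k + 1)).1 := by
        by_contra h5
        exact absurd (h2 (not_lt.1 h5)) (not_le.2 h3)
      rw [stepInd_of_lt h3, stepInd_of_lt h4]; ring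
  · congr 1
    rcases lt_or_gt_of_ne hx with h1 | h1
    · rw [stepInd_of_le (by omega), stepInd_of_le (by omega)]
    · rw [stepInd_of_lt (by omega), stepInd_of_lt (by omega)]

lemma sum_stepInd_closed {v : ℕ → ℤ × ℤ} {n : ℕ} (hv : v n = v 0) (j : ℤ) :
    ∑ k ∈ Finset.range n, (stepInd j (v (k + 1)).2 - stepInd j (v k).2) = 0 := by
  rw [Finset.sum_range_sub (fun k => stepInd j (v k).2) n, hv, sub_self]

lemma latticeWinding_bounds {v : ℕ → ℤ × ℤ} {n : ℕ} (hv : v n = v 0) {N : ℤ}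
    (hN : ∀ k, (-N ≤ (v k).1 ∧ (v k).1 ≤ N) ∧ (-N ≤ (v k).2 ∧ (v k).2 ≤ N)) {i j : ℤ}
    (h : latticeWinding v n i j ≠ 0) : (-N ≤ i ∧ i < N) ∧ (-N ≤ j ∧ j < N) := by
  refine ⟨⟨?_, ?_⟩, ?_, ?_⟩ <;> by_contra hcon <;> apply h
  · rw [← sum_stepInd_closed hv j]
    refine Finset.sum_congr rfl fun k _ => ?_
    rw [stepInd_of_lt (by have := hN (k + 1); omega), one_mul]
  · refine Finset.sum_eq_zero fun k _ => ?_
    rw [stepInd_of_le (by have := hN (k + 1); omega), zero_mul]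
  · refine Finset.sum_eq_zero fun k _ => ?_
    rw [stepInd_of_lt (i := j) (x := (v (k + 1)).2) (by have := hN (k + 1); omega),
      stepInd_of_lt (i := j) (x := (v k).2) (by have := hN k; omega), sub_self, mul_zero]
  · refine Finset.sum_eq_zero fun k _ => ?_
    rw [stepInd_of_le (i := j) (x := (v (k + 1)).2) (by have := hN (k + 1); omega),
      stepInd_of_le (i := j) (x := (v k).2) (by have := hN k; omega), sub_self, mul_zero]

/-- Discrete Green formula: if the mixed difference of `D` vanishes on all squares with nonzero
winding number, the vertical differences of `D` along the closed walk sum to zero. -/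
lemma sum_vertical_eq_zero {v : ℕ → ℤ × ℤ} {n : ℕ} (hv : v n = v 0) {N : ℤ}
    (hN : ∀ k, (-N ≤ (v k).1 ∧ (v k).1 ≤ N) ∧ (-N ≤ (v k).2 ∧ (v k).2 ≤ N)) (D : ℤ → ℤ → ℝ)
    (hD : ∀ i j, latticeWinding v n i j ≠ 0 →
      D (i + 1) (j + 1) - D (i + 1) j - (D i (j + 1) - D i j) = 0) :
    ∑ k ∈ Finset.range n, (D (v (k + 1)).1 (v (k + 1)).2 - D (v (k + 1)).1 (v k).2) = 0 := by
  let J := Finset.Ico (-N) N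
  let r : ℤ → ℤ → ℝ := fun i j => D i (j + 1) - D i j
  have step : ∀ k, D (v (k + 1)).1 (v (k + 1)).2 - D (v (k + 1)).1 (v k).2 =
      ∑ j ∈ J, (r (-N) j * (stepInd j (v (k + 1)).2 - stepInd j (v k).2) +
        ∑ i ∈ J, (r (i + 1) j - r i j) * (stepInd i (v (k + 1)).1 *
          (stepInd j (v (k + 1)).2 - stepInd j (v k).2))) := by
    intro k
    have h1 := hN k
    have h2 := hN (k + 1)
    rw [sub_eq_sum_stepInd (D (v (k + 1)).1) h2.2.1 h2.2.2,
      sub_eq_sum_stepInd (D (v (k + 1)).1) h1.2.1 h1.2.2, add_sub_add_left_eq_sub,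
      ← Finset.sum_sub_distrib]
    refine Finset.sum_congr rfl fun j _ => ?_
    have h3 := sub_eq_sum_stepInd (fun i => r i j) h2.1.1 h2.1.2
    rw [← mul_sub]
    have h4 : D (v (k + 1)).1 (j + 1) - D (v (k + 1)).1 j = r (v (k + 1)).1 j := rfl
    rw [h4, h3, add_mul, Finset.sum_mul]
    congr 1
    exact Finset.sum_congr rfl fun i _ => by ring
  rw [Finset.sum_congr rfl fun k _ => step k, Finset.sum_comm]
  refine Finset.sum_eq_zero fun j _ => ?_
  rw [Finset.sum_add_distrib, ← Finset.mul_sum, sum_stepInd_closed hv, mul_zero, zero_add,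
    Finset.sum_comm]
  refine Finset.sum_eq_zero fun i _ => ?_
  rw [← Finset.mul_sum]
  by_cases hw : latticeWinding v n i j = 0
  · rw [latticeWinding] at hw
    rw [hw, mul_zero]
  · have : r (i + 1) j - r i j = 0 := hD i j hw
    rw [this, zero_mul]

/-- The complement of `X` has no nonempty compact relatively open subset. -/
def NoIslands (X : Set (ℝ × ℝ)) : Prop :=
  ∀ O : Set (ℝ × ℝ), IsOpen O → IsCompact (Xᶜ ∩ O) → Xᶜ ∩ O = ∅

section LatticeWalk

variable {v : ℕ → ℤ × ℤ} {n : ℕ} {E : Set (ℝ × ℝ)}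

lemma latticeWinding_floor (hv : v n = v 0)
    (hstep : ∀ k < n, |(v (k + 1)).1 - (v k).1| ≤ 1 ∧ |(v (k + 1)).2 - (v k).2| ≤ 1)
    (hE : ∀ k < n, ∀ e ∈ E, |e.1 - (v k).1| ≤ 1 → ¬ |e.2 - (v k).2| ≤ 1)
    {e : ℝ × ℝ} (he : e ∈ E) {i j : ℤ} (hi : (i : ℝ) ≤ e.1) (hi' : e.1 ≤ i + 1)
    (hj : (j : ℝ) ≤ e.2) (hj' : e.2 ≤ j + 1) :
    latticeWinding v n i j = latticeWinding v n ⌊e.1⌋ ⌊e.2⌋ := by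
  have hV : ∀ i j : ℤ, e.1 = i + 1 → (j : ℝ) ≤ e.2 → e.2 ≤ j + 1 →
      latticeWinding v n i j = latticeWinding v n (i + 1) j := by
    intro i j h1 h2 h3
    by_contra hne
    obtain ⟨k, hk, hx, hy⟩ := exists_vertical_step hne
    have hs := hstep k hk
    rw [abs_le, abs_le] at hs
    have a1 : (v k).1 ≤ i + 2 := by omega
    have a2 : i ≤ (v k).1 := by omega
    have a3 : (v k).2 ≤ j + 1 := by omega
    have a4 : j ≤ (v k).2 := by omega
    have a1' : ((v k).1 : ℝ) ≤ i + 2 := by exact_mod_cast a1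
    have a2' : (i : ℝ) ≤ (v k).1 := by exact_mod_cast a2
    have a3' : ((v k).2 : ℝ) ≤ j + 1 := by exact_mod_cast a3
    have a4' : (j : ℝ) ≤ (v k).2 := by exact_mod_cast a4
    refine hE k hk e he ?_ ?_ <;> rw [abs_le] <;> constructor <;> linarith
  have hH : ∀ i j : ℤ, e.2 = j + 1 → (i : ℝ) ≤ e.1 → e.1 ≤ i + 1 →
      latticeWinding v n i j = latticeWinding v n i (j + 1) := by
    intro i j h1 h2 h3
    by_contra hne
    obtain ⟨k, hk, hx, hy⟩ := exists_horizontal_step hv hne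
    have hs := hstep k hk
    rw [abs_le, abs_le] at hs
    have a1 : (v k).1 ≤ i + 1 := by omega
    have a2 : i ≤ (v k).1 := by omega
    have a1' : ((v k).1 : ℝ) ≤ i + 1 := by exact_mod_cast a1
    have a2' : (i : ℝ) ≤ (v k).1 := by exact_mod_cast a2
    have a3' : ((v k).2 : ℝ) = j + 1 := by exact_mod_cast hx
    refine hE k hk e he ?_ ?_ <;> rw [abs_le] <;> constructor <;> linarith
  have h1 : latticeWinding v n i j = latticeWinding v n ⌊e.1⌋ j := by
    rcases hi'.lt_or_eq with h | h
    · rw [Int.floor_eq_iff.2 ⟨hi, h⟩]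
    · have : ⌊e.1⌋ = i + 1 := by rw [h]; exact_mod_cast Int.floor_intCast (R := ℝ) (i + 1)
      rw [this]; exact hV i j h hj hj'
  rw [h1]
  rcases hj'.lt_or_eq with h | h
  · rw [Int.floor_eq_iff.2 ⟨hj, h⟩]
  · have : ⌊e.2⌋ = j + 1 := by rw [h]; exact_mod_cast Int.floor_intCast (R := ℝ) (j + 1)
    rw [this]; exact hH _ j h (Int.floor_le _) (Int.lt_floor_add_one _).le

lemma eventually_floor_near (a : ℝ) : ∀ᶠ x in nhds a, (⌊x⌋ : ℝ) ≤ a ∧ a ≤ ⌊x⌋ + 1 := by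
  have h1 : ∀ᶠ x : ℝ in nhds a, x < (⌊a⌋ : ℝ) + 1 := gt_mem_nhds (Int.lt_floor_add_one a)
  have h2 : ∀ᶠ x in nhds a, (⌈a⌉ : ℝ) - 1 < x :=
    lt_mem_nhds (by linarith [Int.ceil_lt_add_one a])
  filter_upwards [h1, h2] with x hx hx'
  constructor
  · have : ⌊x⌋ < ⌊a⌋ + 1 := Int.floor_lt.2 (by exact_mod_cast hx)
    have h3 : ⌊x⌋ ≤ ⌊a⌋ := by omega
    exact (Int.cast_le.2 h3).trans (Int.floor_le a)
  · have : ⌈a⌉ - 1 ≤ ⌊x⌋ := Int.le_floor.2 (by exact_mod_cast hx'.le)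
    have h3 : ⌈a⌉ ≤ ⌊x⌋ + 1 := by omega
    exact (Int.le_ceil a).trans (by exact_mod_cast h3)

/-- If the complement of `X` has no islands, the squares around which a lattice walk in `X` has
nonzero winding number are contained in `X`. -/
lemma square_subset_of_latticeWinding_ne_zero {X : Set (ℝ × ℝ)} (hXo : IsOpen X)
    (hX : NoIslands X) (hv : v n = v 0)
    (hstep : ∀ k < n, |(v (k + 1)).1 - (v k).1| ≤ 1 ∧ |(v (k + 1)).2 - (v k).2| ≤ 1)
    (hE : ∀ k < n, ∀ e ∈ Xᶜ, |e.1 - (v k).1| ≤ 1 → ¬ |e.2 - (v k).2| ≤ 1)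
    {N : ℤ} (hN : ∀ k, (-N ≤ (v k).1 ∧ (v k).1 ≤ N) ∧ (-N ≤ (v k).2 ∧ (v k).2 ≤ N))
    {i j : ℤ} (hij : latticeWinding v n i j ≠ 0) :
    Set.Icc (i : ℝ) (i + 1) ×ˢ Set.Icc (j : ℝ) (j + 1) ⊆ X := by
  let ν : ℝ × ℝ → ℝ := fun e => latticeWinding v n ⌊e.1⌋ ⌊e.2⌋
  have hloc : ∀ e ∈ Xᶜ, ∀ᶠ x in nhds e, x ∈ Xᶜ → ν x = ν e := by
    rintro ⟨a, b⟩ he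
    have := (eventually_floor_near a).prod_nhds (eventually_floor_near b)
    filter_upwards [this] with x hx _
    exact latticeWinding_floor hv hstep hE he hx.1.1 hx.1.2 hx.2.1 hx.2.2
  have key : ∀ P : ℝ → Prop, Xᶜ ∩ interior {x | x ∈ Xᶜ → P (ν x)} = {x | x ∈ Xᶜ ∧ P (ν x)} := by
    intro P
    ext x
    constructor
    · rintro ⟨h1, h2⟩
      exact ⟨h1, interior_subset h2 h1⟩
    · rintro ⟨h1, h2⟩
      refine ⟨h1, mem_interior_iff_mem_nhds.2 ?_⟩
      filter_upwards [hloc x h1] with y hy hy'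
      rw [hy hy']; exact h2
  have hcl : IsClosed {x | x ∈ Xᶜ ∧ ν x ≠ 0} := by
    have : {x | x ∈ Xᶜ ∧ ν x ≠ 0} = Xᶜ ∩ (interior {x | x ∈ Xᶜ → ν x = 0})ᶜ := by
      have h := key (fun r => r = 0)
      ext x
      have hx : x ∈ Xᶜ ∩ interior {x | x ∈ Xᶜ → ν x = 0} ↔ x ∈ Xᶜ ∧ ν x = 0 := by
        rw [h]; rfl
      simp only [Set.mem_inter_iff, Set.mem_compl_iff] at hx ⊢
      change (_ ∧ _) ↔ _
      tauto
    rw [this]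
    exact hXo.isClosed_compl.inter isOpen_interior.isClosed_compl
  have hcpt : IsCompact {x | x ∈ Xᶜ ∧ ν x ≠ 0} := by
    refine (isCompact_Icc.prod isCompact_Icc : IsCompact (Set.Icc (-(N : ℝ)) (N + 1) ×ˢ
      Set.Icc (-(N : ℝ)) (N + 1))).of_isClosed_subset hcl ?_
    rintro x ⟨-, hx⟩
    obtain ⟨⟨h1, h2⟩, h3, h4⟩ := latticeWinding_bounds hv hN hx
    have h1' : (-(N : ℝ)) ≤ ⌊x.1⌋ := by exact_mod_cast h1
    have h2' : (⌊x.1⌋ : ℝ) < N := by exact_mod_cast h2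
    have h3' : (-(N : ℝ)) ≤ ⌊x.2⌋ := by exact_mod_cast h3
    have h4' : (⌊x.2⌋ : ℝ) < N := by exact_mod_cast h4
    refine ⟨⟨?_, ?_⟩, ?_, ?_⟩
    · linarith [Int.floor_le x.1]
    · linarith [Int.lt_floor_add_one x.1]
    · linarith [Int.floor_le x.2]
    · linarith [Int.lt_floor_add_one x.2]
  have hempty : Xᶜ ∩ interior {x | x ∈ Xᶜ → ν x ≠ 0} = ∅ :=
    hX _ isOpen_interior (by rw [key (fun r => r ≠ 0)]; exact hcpt)
  rw [key (fun r => r ≠ 0)] at hempty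
  rintro e ⟨⟨h1, h2⟩, h3, h4⟩
  by_contra heX
  have : e ∈ {x | x ∈ Xᶜ ∧ ν x ≠ 0} := by
    refine ⟨heX, ?_⟩
    rwa [latticeWinding_floor hv hstep hE heX h1 h2 h3 h4] at hij
  rw [hempty] at this
  exact this

end LatticeWalk

/-- Increments of local logarithms of `g` between two points of a convex set are well defined. -/
lemma exists_increment {X : Set (ℝ × ℝ)} (g : ℝ × ℝ → Circle) :
    ∃ inc : ℝ × ℝ → ℝ × ℝ → ℝ, ∀ (a b : ℝ × ℝ) (C : Set (ℝ × ℝ)) (φ : ℝ × ℝ → ℝ), Convex ℝ C →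
      a ∈ C → b ∈ C → C ⊆ X → Continuous φ → (∀ x ∈ C, Circle.exp (φ x) = g x) →
      φ b - φ a = inc a b := by
  have : ∀ a b : ℝ × ℝ, ∃ c : ℝ, ∀ (C : Set (ℝ × ℝ)) (φ : ℝ × ℝ → ℝ), Convex ℝ C →
      a ∈ C → b ∈ C → C ⊆ X → Continuous φ → (∀ x ∈ C, Circle.exp (φ x) = g x) →
      φ b - φ a = c := by
    intro a b
    by_cases h : ∃ (C : Set (ℝ × ℝ)) (φ : ℝ × ℝ → ℝ), Convex ℝ C ∧ a ∈ C ∧ b ∈ C ∧ C ⊆ X ∧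
      Continuous φ ∧ (∀ x ∈ C, Circle.exp (φ x) = g x)
    · obtain ⟨C, φ, hC, ha, hb, hCX, hφ, hg⟩ := h
      refine ⟨φ b - φ a, ?_⟩
      intro C' ψ hC' ha' hb' hCX' hψ hg'
      have := sub_eq_of_circle_exp_eq (s := C ∩ C') (h := ψ) (k := φ)
        (hC.inter hC').isPreconnected hψ.continuousOn hφ.continuousOn
        (fun x hx => by rw [hg x hx.1, hg' x hx.2]) ⟨ha, ha'⟩ ⟨hb, hb'⟩
      linarith
    · refine ⟨0, ?_⟩
      intro C' ψ hC' ha' hb' hCX' hψ hg'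
      exact absurd ⟨C', ψ, hC', ha', hb', hCX', hψ, hg'⟩ h
  choose inc hinc using this
  exact ⟨inc, fun a b => hinc a b⟩

/-- A loop far from the complement of `X` has no monodromy, if the complement has no islands. -/
lemma monodromy_trivial_of_ball {X : Set (ℝ × ℝ)} (hXo : IsOpen X) (hX : NoIslands X)
    {g : ℝ × ℝ → Circle} (hg : ContinuousOn g X) {ℓ : ℝ → ℝ × ℝ} (hℓ : Continuous ℓ)
    (hℓ01 : ℓ 0 = ℓ 1) (hball : ∀ t ∈ Set.Icc (0 : ℝ) 1, closedBall (ℓ t) 4 ⊆ X) {L : ℝ → ℝ}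
    (hL : Continuous L) (hLg : ∀ t ∈ Set.Icc (0 : ℝ) 1, Circle.exp (L t) = g (ℓ t)) :
    L 1 = L 0 := by
  obtain ⟨inc, hinc⟩ := exists_increment (X := X) g
  -- subdivision
  obtain ⟨δ, hδ, hunif⟩ := Metric.uniformContinuousOn_iff.1
    (isCompact_Icc.uniformContinuousOn_of_continuous
      (hℓ.continuousOn (s := Set.Icc (0 : ℝ) 1))) 1 one_pos
  obtain ⟨m, hm⟩ := exists_nat_one_div_lt hδ
  set n := m + 1 with hn
  have hn0 : (0 : ℝ) < n := by positivity
  have hnδ : 1 / (n : ℝ) < δ := by rw [hn]; push_cast; exact hm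
  let T : ℕ → ℝ := fun k => min (k / n) 1
  have hTle : ∀ k ≤ n, T k = k / n := fun k hk =>
    min_eq_left (by rw [div_le_one hn0]; exact_mod_cast hk)
  have hTmem : ∀ k, T k ∈ Set.Icc (0 : ℝ) 1 := fun k =>
    ⟨le_min (by positivity) zero_le_one, min_le_right _ _⟩
  have hT0 : T 0 = 0 := by simp [T]
  have hTn : T n = 1 := by rw [hTle n le_rfl, div_self hn0.ne']
  have hTs : ∀ k < n, T (k + 1) = T k + 1 / n := by
    intro k hk
    rw [hTle _ hk, hTle _ hk.le]; push_cast; ring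
  have hnear : ∀ k < n, ∀ t ∈ Set.Icc (T k) (T (k + 1)),
      |(ℓ t).1 - (ℓ (T k)).1| < 1 ∧ |(ℓ t).2 - (ℓ (T k)).2| < 1 := by
    intro k hk t ht
    have h01 : t ∈ Set.Icc (0 : ℝ) 1 := ⟨(hTmem k).1.trans ht.1, ht.2.trans (hTmem (k + 1)).2⟩
    have := hunif t h01 (T k) (hTmem k) (by
      rw [Real.dist_eq, abs_of_nonneg (by linarith [ht.1])]
      have := ht.2; rw [hTs k hk] at this; linarith)
    rw [Prod.dist_eq, max_lt_iff, Real.dist_eq, Real.dist_eq] at this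
    exact this
  -- the lattice walk
  let v : ℕ → ℤ × ℤ := fun k => (⌊(ℓ (T k)).1⌋, ⌊(ℓ (T k)).2⌋)
  have hv : v n = v 0 := by simp only [v, hT0, hTn, hℓ01]
  have hfl : ∀ a b : ℝ, |a - b| < 1 → |⌊a⌋ - ⌊b⌋| ≤ 1 := by
    intro a b hab
    rw [abs_lt] at hab
    have h1 : (⌊a⌋ : ℝ) < ⌊b⌋ + 2 := by linarith [Int.floor_le a, Int.lt_floor_add_one b]
    have h2 : (⌊b⌋ : ℝ) < ⌊a⌋ + 2 := by linarith [Int.floor_le b, Int.lt_floor_add_one a]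
    have h1' : ⌊a⌋ < ⌊b⌋ + 2 := by exact_mod_cast h1
    have h2' : ⌊b⌋ < ⌊a⌋ + 2 := by exact_mod_cast h2
    rw [abs_le]; omega
  have hstep : ∀ k < n, |(v (k + 1)).1 - (v k).1| ≤ 1 ∧ |(v (k + 1)).2 - (v k).2| ≤ 1 := by
    intro k hk
    have hmem : T (k + 1) ∈ Set.Icc (T k) (T (k + 1)) :=
      ⟨by rw [hTs k hk]; linarith [one_div_pos.2 hn0], le_rfl⟩
    exact ⟨hfl _ _ (hnear k hk _ hmem).1, hfl _ _ (hnear k hk _ hmem).2⟩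
  have hvz : ∀ k, (((v k).1 : ℝ) ≤ (ℓ (T k)).1 ∧ (ℓ (T k)).1 < (v k).1 + 1) ∧
      (((v k).2 : ℝ) ≤ (ℓ (T k)).2 ∧ (ℓ (T k)).2 < (v k).2 + 1) := fun k =>
    ⟨⟨Int.floor_le _, Int.lt_floor_add_one _⟩, Int.floor_le _, Int.lt_floor_add_one _⟩
  have hE : ∀ k < n, ∀ e ∈ Xᶜ, |e.1 - (v k).1| ≤ 1 → ¬ |e.2 - (v k).2| ≤ 1 := by
    intro k hk e he h1 h2
    apply he
    apply hball (T k) (hTmem k)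
    have := hvz k
    rw [abs_le] at h1 h2
    rw [mem_closedBall, Prod.dist_eq, max_le_iff, Real.dist_eq, Real.dist_eq, abs_le, abs_le]
    refine ⟨⟨?_, ?_⟩, ?_, ?_⟩ <;> linarith
  obtain ⟨R, hR⟩ := (isCompact_Icc.image hℓ : IsCompact (ℓ '' Set.Icc 0 1)).isBounded.exists_norm_le
  set N : ℤ := ⌈R⌉ + 1 with hNdef
  have hN : ∀ k, (-N ≤ (v k).1 ∧ (v k).1 ≤ N) ∧ (-N ≤ (v k).2 ∧ (v k).2 ≤ N) := by
    intro k
    have h1 := hR _ ⟨T k, hTmem k, rfl⟩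
    rw [Prod.norm_def, max_le_iff, Real.norm_eq_abs, Real.norm_eq_abs, abs_le, abs_le] at h1
    have h2 := hvz k
    have h3 := Int.le_ceil R
    have c1 : (-(⌈R⌉ : ℝ)) < (v k).1 + 1 := by linarith
    have c2 : ((v k).1 : ℝ) ≤ ⌈R⌉ := by linarith
    have c3 : (-(⌈R⌉ : ℝ)) < (v k).2 + 1 := by linarith
    have c4 : ((v k).2 : ℝ) ≤ ⌈R⌉ := by linarith
    have c1' : -⌈R⌉ < (v k).1 + 1 := by exact_mod_cast c1
    have c2' : (v k).1 ≤ ⌈R⌉ := by exact_mod_cast c2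
    have c3' : -⌈R⌉ < (v k).2 + 1 := by exact_mod_cast c3
    have c4' : (v k).2 ≤ ⌈R⌉ := by exact_mod_cast c4
    omega
  -- lattice potential
  let ι : ℤ → ℤ → ℝ × ℝ := fun i j => ((i : ℝ), (j : ℝ))
  let U : ℤ → ℤ → ℝ := fun i j => ∑ l ∈ Finset.Ico (-N) i, inc (ι l j) (ι (l + 1) j)
  let W : ℤ → ℤ → ℝ := fun i j => ∑ l ∈ Finset.Ico (-N) j, inc (ι i l) (ι i (l + 1))
  have hU : ∀ i j, -N ≤ i → U (i + 1) j - U i j = inc (ι i j) (ι (i + 1) j) := by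
    intro i j h
    simp only [U]; rw [sum_Ico_int_succ _ h]; ring
  have hW : ∀ i j, -N ≤ j → W i (j + 1) - W i j = inc (ι i j) (ι i (j + 1)) := by
    intro i j h
    simp only [W]; rw [sum_Ico_int_succ _ h]; ring
  -- increments of `L`
  let c : ℕ → ℝ := fun k => inc (ι (v k).1 (v k).2) (ℓ (T k))
  have hincr : ∀ k < n, L (T (k + 1)) - L (T k) = (c (k + 1) - c k) +
      ((U (v (k + 1)).1 (v k).2 - U (v k).1 (v k).2) +
        (W (v (k + 1)).1 (v (k + 1)).2 - W (v (k + 1)).1 (v k).2)) := by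
    intro k hk
    set z := ℓ (T k) with hz
    let C : Set (ℝ × ℝ) := Set.Icc (z.1 - 3) (z.1 + 3) ×ˢ Set.Icc (z.2 - 3) (z.2 + 3)
    have hCconv : Convex ℝ C := (convex_Icc _ _).prod (convex_Icc _ _)
    have hCX : C ⊆ X := by
      intro y hy
      apply hball (T k) (hTmem k)
      rw [mem_closedBall, Prod.dist_eq, max_le_iff, Real.dist_eq, Real.dist_eq, abs_le, abs_le]
      obtain ⟨⟨h1, h2⟩, h3, h4⟩ := hy
      refine ⟨⟨?_, ?_⟩, ?_, ?_⟩ <;> linarith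
    obtain ⟨φ, hφ, hφg⟩ := exists_lift_rect (by linarith) (by linarith) (hg.mono hCX)
    have hmem : T (k + 1) ∈ Set.Icc (T k) (T (k + 1)) :=
      ⟨by rw [hTs k hk]; linarith [one_div_pos.2 hn0], le_rfl⟩
    have hCℓ : ∀ t ∈ Set.Icc (T k) (T (k + 1)), ℓ t ∈ C := by
      intro t ht
      obtain ⟨h1, h2⟩ := hnear k hk t ht
      rw [abs_lt] at h1 h2
      refine ⟨⟨?_, ?_⟩, ?_, ?_⟩ <;> linarith
    have hLφ := sub_eq_of_circle_exp_eq (s := Set.Icc (T k) (T (k + 1))) (h := L)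
      (k := fun t => φ (ℓ t)) isPreconnected_Icc hL.continuousOn (hφ.comp hℓ).continuousOn
      (fun t ht => by
        rw [hφg _ (hCℓ t ht)]
        exact hLg t ⟨(hTmem k).1.trans ht.1, ht.2.trans (hTmem (k + 1)).2⟩)
      (x := T (k + 1)) (y := T k) hmem ⟨le_rfl, hmem.1⟩
    have e0 := hvz k
    have e1 := hvz (k + 1)
    have e2 := hnear k hk _ hmem
    rw [abs_lt, abs_lt] at e2
    have mem : ∀ i j : ℤ, (z.1 - 3 ≤ i ∧ (i : ℝ) ≤ z.1 + 3) → (z.2 - 3 ≤ j ∧ (j : ℝ) ≤ z.2 + 3) →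
      ι i j ∈ C := fun i j h1 h2 => ⟨⟨h1.1, h1.2⟩, h2.1, h2.2⟩
    have m0 : ι (v k).1 (v k).2 ∈ C := mem _ _ ⟨by linarith, by linarith⟩ ⟨by linarith, by linarith⟩
    have m1 : ι (v (k + 1)).1 (v k).2 ∈ C :=
      mem _ _ ⟨by linarith, by linarith⟩ ⟨by linarith, by linarith⟩
    have m2 : ι (v (k + 1)).1 (v (k + 1)).2 ∈ C :=
      mem _ _ ⟨by linarith, by linarith⟩ ⟨by linarith, by linarith⟩
    have c0 : φ z - φ (ι (v k).1 (v k).2) = c k :=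
      hinc _ _ C φ hCconv m0 (hCℓ _ ⟨le_rfl, hmem.1⟩) hCX hφ hφg
    have c1 : φ (ℓ (T (k + 1))) - φ (ι (v (k + 1)).1 (v (k + 1)).2) = c (k + 1) :=
      hinc _ _ C φ hCconv m2 (hCℓ _ hmem) hCX hφ hφg
    have hs := hstep k hk
    rw [abs_le, abs_le] at hs
    have hor : φ (ι (v (k + 1)).1 (v k).2) - φ (ι (v k).1 (v k).2) =
        U (v (k + 1)).1 (v k).2 - U (v k).1 (v k).2 := by
      have h3 : (v (k + 1)).1 = (v k).1 ∨ (v (k + 1)).1 = (v k).1 + 1 ∨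
        (v k).1 = (v (k + 1)).1 + 1 := by omega
      rcases h3 with h | h | h
      · rw [h]; ring
      · rw [h] at m1 ⊢
        rw [hU _ _ (hN k).1.1]
        exact hinc _ _ C φ hCconv m0 m1 hCX hφ hφg
      · rw [h] at m0 ⊢
        have := hU (v (k + 1)).1 (v k).2 (hN (k + 1)).1.1
        have h4 := hinc _ _ C φ hCconv m1 m0 hCX hφ hφg
        linarith
    have ver : φ (ι (v (k + 1)).1 (v (k + 1)).2) - φ (ι (v (k + 1)).1 (v k).2) =
        W (v (k + 1)).1 (v (k + 1)).2 - W (v (k + 1)).1 (v k).2 := by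
      have h3 : (v (k + 1)).2 = (v k).2 ∨ (v (k + 1)).2 = (v k).2 + 1 ∨
        (v k).2 = (v (k + 1)).2 + 1 := by omega
      rcases h3 with h | h | h
      · rw [h]; ring
      · rw [h] at m2 ⊢
        rw [hW _ _ (hN k).2.1]
        exact hinc _ _ C φ hCconv m1 m2 hCX hφ hφg
      · rw [h] at m1 ⊢
        have := hW (v (k + 1)).1 (v (k + 1)).2 (hN (k + 1)).2.1
        have h4 := hinc _ _ C φ hCconv m2 m1 hCX hφ hφg
        linarith
    linarith
  -- discrete Green formula
  have hgreen := sum_vertical_eq_zero hv hN (fun i j => W i j - U i j) (by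
    intro i j hij
    obtain ⟨⟨hi, -⟩, hj, -⟩ := latticeWinding_bounds hv hN hij
    have hsq := square_subset_of_latticeWinding_ne_zero hXo hX hv hstep hE hN hij
    obtain ⟨φ, hφ, hφg⟩ := exists_lift_rect (by linarith) (by linarith) (hg.mono hsq)
    have hconv : Convex ℝ (Set.Icc (i : ℝ) (i + 1) ×ˢ Set.Icc (j : ℝ) (j + 1)) :=
      (convex_Icc _ _).prod (convex_Icc _ _)
    have m00 : ι i j ∈ Set.Icc (i : ℝ) (i + 1) ×ˢ Set.Icc (j : ℝ) (j + 1) := by simp [ι]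
    have m10 : ι (i + 1) j ∈ Set.Icc (i : ℝ) (i + 1) ×ˢ Set.Icc (j : ℝ) (j + 1) := by simp [ι]
    have m01 : ι i (j + 1) ∈ Set.Icc (i : ℝ) (i + 1) ×ˢ Set.Icc (j : ℝ) (j + 1) := by simp [ι]
    have m11 : ι (i + 1) (j + 1) ∈ Set.Icc (i : ℝ) (i + 1) ×ˢ Set.Icc (j : ℝ) (j + 1) := by
      simp [ι]
    have a1 := hinc _ _ _ φ hconv m00 m10 hsq hφ hφg
    have a2 := hinc _ _ _ φ hconv m00 m01 hsq hφ hφg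
    have a3 := hinc _ _ _ φ hconv m10 m11 hsq hφ hφg
    have a4 := hinc _ _ _ φ hconv m01 m11 hsq hφ hφg
    have b1 := hU i j hi
    have b2 := hU i (j + 1) hi
    have b3 := hW i j hj
    have b4 := hW (i + 1) j hj
    linarith)
  have htot : L (T n) - L (T 0) = 0 := by
    rw [← Finset.sum_range_sub (fun k => L (T k)) n,
      Finset.sum_congr rfl fun k hk => hincr k (Finset.mem_range.1 hk), Finset.sum_add_distrib,
      Finset.sum_range_sub c n]
    have h1 : c n = c 0 := by simp only [c, hv, hT0, hTn, hℓ01]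
    have h2 := Finset.sum_range_sub (fun k => U (v k).1 (v k).2) n
    rw [hv, sub_self] at h2
    rw [h1, sub_self, zero_add, ← hgreen, ← sub_eq_zero, ← Finset.sum_sub_distrib, ← h2]
    exact Finset.sum_congr rfl fun k _ => by ring
  rw [hTn, hT0] at htot
  linarith

lemma NoIslands.preimage_smul {X : Set (ℝ × ℝ)} (hX : NoIslands X) {r : ℝ} (hr : r ≠ 0) :
    NoIslands {x | r • x ∈ X} := by
  intro O hO hc
  have himg : (fun x : ℝ × ℝ => r • x) '' ({x | r • x ∈ X}ᶜ ∩ O) =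
      Xᶜ ∩ (fun x : ℝ × ℝ => r • x) '' O := by
    ext y
    constructor
    · rintro ⟨x, ⟨h1, h2⟩, rfl⟩
      exact ⟨h1, x, h2, rfl⟩
    · rintro ⟨h1, x, h2, rfl⟩
      exact ⟨x, ⟨h1, h2⟩, rfl⟩
  have h := hX _ (isOpenMap_smul₀ hr O hO) (by rw [← himg]; exact hc.image (continuous_const_smul r))
  rw [← himg, Set.image_eq_empty] at h
  exact h

lemma monodromy_trivial {X : Set (ℝ × ℝ)} (hXo : IsOpen X) (hX : NoIslands X)
    {g : ℝ × ℝ → Circle} (hg : ContinuousOn g X) {ℓ : ℝ → ℝ × ℝ} (hℓ : Continuous ℓ)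
    (hℓ01 : ℓ 0 = ℓ 1) (hmem : ∀ t ∈ Set.Icc (0 : ℝ) 1, ℓ t ∈ X) {L : ℝ → ℝ}
    (hL : Continuous L) (hLg : ∀ t ∈ Set.Icc (0 : ℝ) 1, Circle.exp (L t) = g (ℓ t)) :
    L 1 = L 0 := by
  have hK : IsCompact (ℓ '' Set.Icc 0 1) := isCompact_Icc.image hℓ
  obtain ⟨δ, hδ, hsub⟩ := hK.exists_cthickening_subset_open hXo
    (by rintro _ ⟨t, ht, rfl⟩; exact hmem t ht)
  set r : ℝ := δ / 4 with hr
  have hr0 : 0 < r := by positivity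
  have hcs : Continuous fun x : ℝ × ℝ => r • x := continuous_const_smul r
  refine monodromy_trivial_of_ball (X := {x | r • x ∈ X}) (g := fun x => g (r • x))
    (ℓ := fun t => r⁻¹ • ℓ t) (hXo.preimage hcs) (hX.preimage_smul hr0.ne')
    (hg.comp hcs.continuousOn fun x hx => hx) (by fun_prop) (by simp only [hℓ01]) ?_ hL ?_
  · intro t ht x hx
    apply hsub
    refine mem_cthickening_of_dist_le _ (ℓ t) _ _ ⟨t, ht, rfl⟩ ?_
    have h1 : ℓ t = r • r⁻¹ • ℓ t := by rw [smul_smul, mul_inv_cancel₀ hr0.ne', one_smul]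
    rw [h1, dist_smul₀, Real.norm_eq_abs, abs_of_pos hr0]
    have h2 : dist x (r⁻¹ • ℓ t) ≤ 4 := hx
    calc r * dist x (r⁻¹ • ℓ t) ≤ r * 4 := by gcongr
      _ = δ := by rw [hr]; ring
  · intro t ht
    rw [hLg t ht, smul_smul, mul_inv_cancel₀ hr0.ne', one_smul]

/-- An open connected planar set whose complement has no islands has circle lifts. -/
theorem hasCircleLifts_of_noIslands {X : Set (ℝ × ℝ)} (hXo : IsOpen X) (hXc : IsConnected X)
    (hX : NoIslands X) : HasCircleLifts X := by
  classical
  intro g hg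
  have : LocallyPathConnectedSpace X := hXo.locallyPathConnectedSpace
  have : PathConnectedSpace X :=
    isPathConnected_iff_pathConnectedSpace.1 (hXo.isConnected_iff_isPathConnected.1 hXc)
  obtain ⟨x0, hx0⟩ := hXc.nonempty
  obtain ⟨e0, he0⟩ := Circle.exp_surjective (g ⟨x0, hx0⟩)
  let G : ℝ × ℝ → Circle := fun x => if h : x ∈ X then g ⟨x, h⟩ else 1
  have hGg : ∀ x : X, G x = g x := fun x => dif_pos x.2
  have hG : ContinuousOn G X := by
    rw [continuousOn_iff_continuous_domRestrict]
    convert hg using 1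
    funext x
    exact hGg x
  obtain ⟨F, ⟨-, hF⟩, -⟩ := isLocalHomeomorph_circleExp.existsUnique_continuousMap_lifts
    ⟨g, hg⟩ ⟨x0, hx0⟩ e0 he0 (fun γ hγ => by
      obtain ⟨Γ, h1, h2⟩ := Circle.isCoveringMap_exp.exists_path_lifts
        ((⟨g, hg⟩ : C(X, Circle)).comp γ) e0 (by simp [hγ, he0])
      exact ⟨Γ, h2, h1⟩) (by
      intro γ γ' Γ Γ' hγ hγ' hΓ hΓ' hl hl' h1
      have hl2 : ∀ t, Circle.exp (Γ t) = g (γ t) := fun t => congrFun hl t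
      have hl2' : ∀ t, Circle.exp (Γ' t) = g (γ' t) := fun t => congrFun hl' t
      let P : ℝ → unitInterval := Set.projIcc 0 1 zero_le_one
      have hP : Continuous P := continuous_projIcc
      let ℓ : ℝ → ℝ × ℝ := fun t => if t ≤ 1 / 2 then γ (P (2 * t)) else γ' (P (2 - 2 * t))
      let L : ℝ → ℝ := fun t =>
        if t ≤ 1 / 2 then Γ (P (2 * t)) else Γ' (P (2 - 2 * t)) + (Γ 1 - Γ' 1)
      have hP1 : P 1 = 1 := Set.projIcc_right _
      have hP0 : P 0 = 0 := Set.projIcc_left _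
      have hℓ : Continuous ℓ := by
        refine Continuous.if_le (by fun_prop) (by fun_prop) continuous_id continuous_const ?_
        rintro t rfl
        norm_num [hP1, h1]
      have hL : Continuous L := by
        refine Continuous.if_le (by fun_prop) (by fun_prop) continuous_id continuous_const ?_
        rintro t rfl
        norm_num [hP1]
      have := monodromy_trivial hXo hX hG hℓ (by norm_num [ℓ, hP0, hγ, hγ']) (by
        intro t _
        simp only [ℓ]
        split_ifs
        · exact Subtype.prop _
        · exact Subtype.prop _) hL (by
        intro t _
        simp only [ℓ, L]
        split_ifs
        · rw [hl2, hGg]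
        · rw [Circle.exp_add, Circle.exp_sub, hl2', hl2, hl2', h1, div_self', mul_one, hGg])
      norm_num [L, hP0, hΓ, hΓ'] at this
      linarith)
  exact ⟨F, F.continuous, fun x => congrFun hF x⟩

/-- The coordinate along `e₂` of the graph point over `p`. -/
def ycoord (c σ : ℝ) (u : ℝ × ℝ → ℝ) (p : ℝ × ℝ) : ℝ := c * u p - σ * p.2

/-- The coordinate along `e₃` of the graph point over `p`. -/
def zcoord (c σ : ℝ) (u : ℝ × ℝ → ℝ) (p : ℝ × ℝ) : ℝ := c * p.2 + σ * u p

/-- Along the line through `p` in direction `d`, the function `u` has first derivative `a` and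
second derivative `b` at `p`. -/
def HasLineJet (u : ℝ × ℝ → ℝ) (p : ℝ × ℝ) (d : ℝ × ℝ) (a b : ℝ) : Prop :=
  ∃ v : ℝ → ℝ, (∀ᶠ r in nhds (0 : ℝ), HasDerivAt (fun r => u (p.1 + r * d.1, p.2 + r * d.2)) (v r) r)
    ∧ v 0 = a ∧ HasDerivAt v b 0

/-- Solutions of the translator equation whose graph is complete and contained in a slab,
with `c = cos θ` and `σ = sin θ`. -/
structure SlabTranslator (c σ w : ℝ) (Ω : Set (ℝ × ℝ)) (u : ℝ × ℝ → ℝ) : Prop where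
  unit : c ^ 2 + σ ^ 2 = 1
  isOpen : IsOpen Ω
  isConnected : IsConnected Ω
  cont : ContinuousOn u Ω
  jet : ∀ p ∈ Ω, ∃ P Q A B C : ℝ,
    (1 + Q ^ 2) * A - 2 * P * Q * B + (1 + P ^ 2) * C = (1 + P ^ 2 + Q ^ 2) * (σ - Q * c) ∧
    ∀ d : ℝ × ℝ, HasLineJet u p d (P * d.1 + Q * d.2)
      (A * d.1 ^ 2 + 2 * B * d.1 * d.2 + C * d.2 ^ 2)
  slab : ∀ p ∈ Ω, |p.1| ≤ w
  cpt : ∀ M : ℝ, IsCompact {p | p ∈ Ω ∧ |ycoord c σ u p| ≤ M ∧ |zcoord c σ u p| ≤ M}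

lemma second_derivative_test {Φ ψ : ℝ → ℝ} {b : ℝ} (hmax : IsLocalMax Φ 0)
    (hΦ : ∀ᶠ r in nhds (0 : ℝ), HasDerivAt Φ (ψ r) r) (hψ : HasDerivAt ψ b 0) :
    ψ 0 = 0 ∧ b ≤ 0 := by
  have h0 : ψ 0 = 0 := hmax.hasDerivAt_eq_zero hΦ.self_of_nhds
  refine ⟨h0, ?_⟩
  by_contra hb
  push Not at hb
  have hd : deriv Φ =ᶠ[nhds 0] ψ := hΦ.mono fun r hr => hr.deriv
  have hdd : deriv (deriv Φ) 0 = b := by rw [hd.deriv_eq]; exact hψ.deriv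
  have hmin : IsLocalMin Φ 0 := isLocalMin_of_deriv_deriv_pos (by rw [hdd]; exact hb)
    (by rw [hd.self_of_nhds, h0]) hΦ.self_of_nhds.continuousAt
  have hconst : Φ =ᶠ[nhds 0] fun _ => Φ 0 := by
    filter_upwards [hmax, hmin] with r h1 h2 using le_antisymm h1 h2
  have h1 : deriv Φ =ᶠ[nhds 0] fun _ => 0 := by
    have := hconst.deriv
    simpa using this
  have h2 : deriv (deriv Φ) 0 = 0 := by rw [h1.deriv_eq]; simp
  linarith

/-- First and second derivative data of a function of one variable at a point. -/
def HasJet (G G1 : ℝ → ℝ) (G2 x : ℝ) : Prop :=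
  (∀ᶠ y in nhds x, HasDerivAt G (G1 y) y) ∧ HasDerivAt G1 G2 x

lemma HasJet.comp_line {u : ℝ × ℝ → ℝ} {p d : ℝ × ℝ} {a b : ℝ} {G G1 : ℝ → ℝ} {G2 α β γ : ℝ}
    (hG : HasJet G G1 G2 (α * p.1 + β * p.2 + γ * u p)) {v : ℝ → ℝ}
    (hv : ∀ᶠ r in nhds (0 : ℝ), HasDerivAt (fun r => u (p.1 + r * d.1, p.2 + r * d.2)) (v r) r)
    (hv0 : v 0 = a) (hv1 : HasDerivAt v b 0) :
    (∀ᶠ r in nhds (0 : ℝ), HasDerivAt (fun r => G (α * (p.1 + r * d.1) + β * (p.2 + r * d.2) +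
        γ * u (p.1 + r * d.1, p.2 + r * d.2)))
      (G1 (α * (p.1 + r * d.1) + β * (p.2 + r * d.2) + γ * u (p.1 + r * d.1, p.2 + r * d.2)) *
        (α * d.1 + β * d.2 + γ * v r)) r) ∧
    HasDerivAt (fun r =>
      G1 (α * (p.1 + r * d.1) + β * (p.2 + r * d.2) + γ * u (p.1 + r * d.1, p.2 + r * d.2)) *
        (α * d.1 + β * d.2 + γ * v r))
      (G2 * (α * d.1 + β * d.2 + γ * a) ^ 2 +
        G1 (α * p.1 + β * p.2 + γ * u p) * (γ * b)) 0 := by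
  let ℓ : ℝ → ℝ := fun r =>
    α * (p.1 + r * d.1) + β * (p.2 + r * d.2) + γ * u (p.1 + r * d.1, p.2 + r * d.2)
  have hℓ : ∀ᶠ r in nhds (0 : ℝ), HasDerivAt ℓ (α * d.1 + β * d.2 + γ * v r) r := by
    filter_upwards [hv] with r hr
    have h1 : HasDerivAt (fun r : ℝ => p.1 + r * d.1) d.1 r := by
      simpa using ((hasDerivAt_id r).mul_const d.1).const_add p.1
    have h2 : HasDerivAt (fun r : ℝ => p.2 + r * d.2) d.2 r := by
      simpa using ((hasDerivAt_id r).mul_const d.2).const_add p.2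
    exact ((h1.const_mul α).add (h2.const_mul β)).add (hr.const_mul γ)
  have hℓ0 : ℓ 0 = α * p.1 + β * p.2 + γ * u p := by simp [ℓ]
  constructor
  · have ht : Filter.Tendsto ℓ (nhds 0) (nhds (α * p.1 + β * p.2 + γ * u p)) := by
      rw [← hℓ0]; exact hℓ.self_of_nhds.continuousAt
    filter_upwards [hℓ, ht.eventually hG.1] with r h1 h2
    exact h2.comp r h1
  · have h1 : HasDerivAt (fun r => G1 (ℓ r)) (G2 * (α * d.1 + β * d.2 + γ * v 0)) 0 := by
      have := hG.2
      rw [← hℓ0] at this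
      exact this.comp 0 hℓ.self_of_nhds
    have h2 : HasDerivAt (fun r => α * d.1 + β * d.2 + γ * v r) (γ * b) 0 :=
      (hv1.const_mul γ).const_add _
    have h3 := h1.mul h2
    rw [hℓ0, hv0] at h3
    exact h3.congr_deriv (by ring)

/-- Maximum principle for sums of functions of three affine functionals of `(s, t, u)`. -/
theorem SlabTranslator.max_principle {c σ w : ℝ} {Ω : Set (ℝ × ℝ)} {u : ℝ × ℝ → ℝ}
    (D : SlabTranslator c σ w Ω u) {p : ℝ × ℝ} (hp : p ∈ Ω) {G H K G1 H1 K1 : ℝ → ℝ}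
    {G2 H2 K2 a₁ b₁ c₁ a₂ b₂ c₂ a₃ b₃ c₃ : ℝ}
    (hG : HasJet G G1 G2 (a₁ * p.1 + b₁ * p.2 + c₁ * u p))
    (hH : HasJet H H1 H2 (a₂ * p.1 + b₂ * p.2 + c₂ * u p))
    (hK : HasJet K K1 K2 (a₃ * p.1 + b₃ * p.2 + c₃ * u p))
    (hmax : IsLocalMax (fun q : ℝ × ℝ => G (a₁ * q.1 + b₁ * q.2 + c₁ * u q) +
      H (a₂ * q.1 + b₂ * q.2 + c₂ * u q) + K (a₃ * q.1 + b₃ * q.2 + c₃ * u q)) p) :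
    ∃ P Q g h k : ℝ, g = G1 (a₁ * p.1 + b₁ * p.2 + c₁ * u p) ∧
      h = H1 (a₂ * p.1 + b₂ * p.2 + c₂ * u p) ∧ k = K1 (a₃ * p.1 + b₃ * p.2 + c₃ * u p) ∧
      g * (a₁ + c₁ * P) + h * (a₂ + c₂ * P) + k * (a₃ + c₃ * P) = 0 ∧
      g * (b₁ + c₁ * Q) + h * (b₂ + c₂ * Q) + k * (b₃ + c₃ * Q) = 0 ∧
      G2 * ((a₁ + c₁ * P) ^ 2 + (b₁ + c₁ * Q) ^ 2 + (a₁ * Q - b₁ * P) ^ 2) +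
      H2 * ((a₂ + c₂ * P) ^ 2 + (b₂ + c₂ * Q) ^ 2 + (a₂ * Q - b₂ * P) ^ 2) +
      K2 * ((a₃ + c₃ * P) ^ 2 + (b₃ + c₃ * Q) ^ 2 + (a₃ * Q - b₃ * P) ^ 2) +
      (g * c₁ + h * c₂ + k * c₃) * ((1 + P ^ 2 + Q ^ 2) * (σ - Q * c)) ≤ 0 := by
  obtain ⟨P, Q, A, B, C, hpde, hjet⟩ := D.jet p hp
  have key : ∀ d : ℝ × ℝ,
      (G1 (a₁ * p.1 + b₁ * p.2 + c₁ * u p) * (a₁ * d.1 + b₁ * d.2 + c₁ * (P * d.1 + Q * d.2)) +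
        H1 (a₂ * p.1 + b₂ * p.2 + c₂ * u p) * (a₂ * d.1 + b₂ * d.2 + c₂ * (P * d.1 + Q * d.2)) +
        K1 (a₃ * p.1 + b₃ * p.2 + c₃ * u p) *
          (a₃ * d.1 + b₃ * d.2 + c₃ * (P * d.1 + Q * d.2)) = 0) ∧
      (G2 * (a₁ * d.1 + b₁ * d.2 + c₁ * (P * d.1 + Q * d.2)) ^ 2 +
          G1 (a₁ * p.1 + b₁ * p.2 + c₁ * u p) *
            (c₁ * (A * d.1 ^ 2 + 2 * B * d.1 * d.2 + C * d.2 ^ 2)) +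
        (H2 * (a₂ * d.1 + b₂ * d.2 + c₂ * (P * d.1 + Q * d.2)) ^ 2 +
          H1 (a₂ * p.1 + b₂ * p.2 + c₂ * u p) *
            (c₂ * (A * d.1 ^ 2 + 2 * B * d.1 * d.2 + C * d.2 ^ 2))) +
        (K2 * (a₃ * d.1 + b₃ * d.2 + c₃ * (P * d.1 + Q * d.2)) ^ 2 +
          K1 (a₃ * p.1 + b₃ * p.2 + c₃ * u p) *
            (c₃ * (A * d.1 ^ 2 + 2 * B * d.1 * d.2 + C * d.2 ^ 2))) ≤ 0) := by
    intro d
    obtain ⟨v, hv, hv0, hv1⟩ := hjet d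
    obtain ⟨g1, g2⟩ := hG.comp_line hv hv0 hv1
    obtain ⟨h1, h2⟩ := hH.comp_line hv hv0 hv1
    obtain ⟨k1, k2⟩ := hK.comp_line hv hv0 hv1
    have hline : Filter.Tendsto (fun r : ℝ => ((p.1 + r * d.1, p.2 + r * d.2) : ℝ × ℝ)) (nhds 0)
        (nhds p) := by
      have : Continuous fun r : ℝ => ((p.1 + r * d.1, p.2 + r * d.2) : ℝ × ℝ) := by fun_prop
      simpa using this.tendsto 0
    have hm := hline.eventually hmax
    have hloc : IsLocalMax (fun r : ℝ =>
      G (a₁ * (p.1 + r * d.1) + b₁ * (p.2 + r * d.2) + c₁ * u (p.1 + r * d.1, p.2 + r * d.2)) +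
      H (a₂ * (p.1 + r * d.1) + b₂ * (p.2 + r * d.2) + c₂ * u (p.1 + r * d.1, p.2 + r * d.2)) +
      K (a₃ * (p.1 + r * d.1) + b₃ * (p.2 + r * d.2) + c₃ * u (p.1 + r * d.1, p.2 + r * d.2)))
      0 := by
      filter_upwards [hm] with r hr
      simpa using hr
    obtain ⟨t1, t2⟩ := second_derivative_test hloc
      ((g1.and (h1.and k1)).mono fun r hr => (hr.1.add hr.2.1).add hr.2.2) ((g2.add h2).add k2)
    refine ⟨?_, t2⟩
    simpa [hv0] using t1
  obtain ⟨x1, x2⟩ := key (1, 0)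
  obtain ⟨y1, y2⟩ := key (0, 1)
  obtain ⟨-, z2⟩ := key (Q, -P)
  refine ⟨P, Q, _, _, _, rfl, rfl, rfl, ?_, ?_, ?_⟩
  · linear_combination x1
  · linear_combination y1
  · set g := G1 (a₁ * p.1 + b₁ * p.2 + c₁ * u p)
    set h := H1 (a₂ * p.1 + b₂ * p.2 + c₂ * u p)
    set k := K1 (a₃ * p.1 + b₃ * p.2 + c₃ * u p)
    rw [← hpde]
    linarith

/-- Maximum principle in the coordinates `x`, `y`, `z`. -/
theorem SlabTranslator.max_principle_xyz {c σ w : ℝ} {Ω : Set (ℝ × ℝ)} {u : ℝ × ℝ → ℝ}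
    (D : SlabTranslator c σ w Ω u) {p : ℝ × ℝ} (hp : p ∈ Ω) {G H K G1 H1 K1 : ℝ → ℝ}
    {G2 H2 K2 : ℝ} (hG : HasJet G G1 G2 p.1) (hH : HasJet H H1 H2 (ycoord c σ u p))
    (hK : HasJet K K1 K2 (zcoord c σ u p))
    (hmax : IsLocalMax (fun q => G q.1 + H (ycoord c σ u q) + K (zcoord c σ u q)) p) :
    ∃ P Y Z l : ℝ, 1 ≤ Y ^ 2 + Z ^ 2 ∧ G1 p.1 = -l * P ∧ H1 (ycoord c σ u p) = l * Z ∧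
      K1 (zcoord c σ u p) = -l * Y ∧
      G2 * (Y ^ 2 + Z ^ 2) + H2 * (P ^ 2 + Y ^ 2) + K2 * (P ^ 2 + Z ^ 2) +
        K1 (zcoord c σ u p) * (P ^ 2 + Y ^ 2 + Z ^ 2) ≤ 0 := by
  have ex : ∀ q : ℝ × ℝ, q.1 = 1 * q.1 + 0 * q.2 + 0 * u q := fun q => by ring
  have ey : ∀ q : ℝ × ℝ, ycoord c σ u q = 0 * q.1 + -σ * q.2 + c * u q := fun q => by
    rw [ycoord]; ring
  have ez : ∀ q : ℝ × ℝ, zcoord c σ u q = 0 * q.1 + c * q.2 + σ * u q := fun q => by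
    rw [zcoord]; ring
  have hmax' : IsLocalMax (fun q : ℝ × ℝ => G (1 * q.1 + 0 * q.2 + 0 * u q) +
      H (0 * q.1 + -σ * q.2 + c * u q) + K (0 * q.1 + c * q.2 + σ * u q)) p := by
    simp only [← ex, ← ey, ← ez]
    exact hmax
  rw [ex p] at hG
  rw [ey p] at hH
  rw [ez p] at hK
  obtain ⟨P, Q, g, h, k, hg, hh, hk, e1, e2, e3⟩ := D.max_principle hp hG hH hK hmax'
  rw [← ex p] at hg
  rw [← ey p] at hh
  rw [← ez p] at hk
  have hu := D.unit
  have hl : h = (h * c + k * σ) * (c + σ * Q) := by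
    linear_combination (-h) * hu + (-σ) * e2
  have hk' : k = -(h * c + k * σ) * (c * Q - σ) := by
    linear_combination (-k) * hu + c * e2
  refine ⟨P, c * Q - σ, c + σ * Q, h * c + k * σ, ?_, ?_, ?_, ?_, ?_⟩
  · nlinarith [sq_nonneg Q]
  · rw [← hg]; linear_combination e1
  · rw [← hh]; exact hl
  · rw [← hk]; exact hk'
  · rw [← hk]
    have h1 : (c * Q - σ) ^ 2 + (c + σ * Q) ^ 2 = 1 + Q ^ 2 := by
      linear_combination (1 + Q ^ 2) * hu
    have hWk : (h * c + k * σ) * ((1 + P ^ 2 + Q ^ 2) * (σ - Q * c)) =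
        k * (P ^ 2 + (c * Q - σ) ^ 2 + (c + σ * Q) ^ 2) := by
      linear_combination (-(1 + P ^ 2 + Q ^ 2)) * hk' - k * h1
    have hP2 : c ^ 2 * P ^ 2 + σ ^ 2 * P ^ 2 = P ^ 2 := by linear_combination P ^ 2 * hu
    have e4 : (h * c + k * σ) = g * 0 + h * c + k * σ := by ring
    rw [← e4, hWk] at e3
    have q1 : (1 + 0 * P) ^ 2 + (0 + 0 * Q) ^ 2 + (1 * Q - 0 * P) ^ 2 =
      (c * Q - σ) ^ 2 + (c + σ * Q) ^ 2 := by rw [h1]; ring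
    have q2 : (0 + c * P) ^ 2 + (-σ + c * Q) ^ 2 + (0 * Q - -σ * P) ^ 2 =
      P ^ 2 + (c * Q - σ) ^ 2 := by linear_combination hP2
    have q3 : (0 + σ * P) ^ 2 + (c + σ * Q) ^ 2 + (0 * Q - c * P) ^ 2 =
      P ^ 2 + (c + σ * Q) ^ 2 := by linear_combination hP2
    rw [q1, q2, q3] at e3
    exact e3

namespace SlabTranslator

variable {c σ w : ℝ} {Ω : Set (ℝ × ℝ)} {u : ℝ × ℝ → ℝ}

lemma continuousOn_ycoord (D : SlabTranslator c σ w Ω u) : ContinuousOn (ycoord c σ u) Ω := by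
  unfold ycoord
  exact (continuousOn_const.mul D.cont).sub (by fun_prop)

lemma continuousOn_zcoord (D : SlabTranslator c σ w Ω u) : ContinuousOn (zcoord c σ u) Ω := by
  unfold zcoord
  exact ContinuousOn.add (by fun_prop) (continuousOn_const.mul D.cont)

lemma snd_eq (D : SlabTranslator c σ w Ω u) (q : ℝ × ℝ) :
    q.2 = c * zcoord c σ u q - σ * ycoord c σ u q := by
  unfold ycoord zcoord
  linear_combination (-q.2) * D.unit

/-- A continuous function satisfying the boundary estimate and proper on its superlevel set
attains an interior maximum. -/
theorem exists_isLocalMax (D : SlabTranslator c σ w Ω u) {V : Set (ℝ × ℝ)} (hV : IsOpen V)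
    (hVΩ : V ⊆ Ω) {F : ℝ × ℝ → ℝ} (hF : ContinuousOn F (Ω ∩ closure V)) {p₀ : ℝ × ℝ}
    (hp₀ : p₀ ∈ V) {M : ℝ}
    (hM : ∀ q ∈ V, F p₀ ≤ F q → |ycoord c σ u q| ≤ M ∧ |zcoord c σ u q| ≤ M)
    (hb : ∀ q ∈ Ω, q ∈ closure V → q ∉ V → F q < F p₀) :
    ∃ p ∈ V, F p₀ ≤ F p ∧ IsLocalMax F p := by
  have hK := (D.cpt M).inter_right (isClosed_closure (s := V))
  have hp₀K : p₀ ∈ {p | p ∈ Ω ∧ |ycoord c σ u p| ≤ M ∧ |zcoord c σ u p| ≤ M} ∩ closure V :=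
    ⟨⟨hVΩ hp₀, hM p₀ hp₀ le_rfl⟩, subset_closure hp₀⟩
  obtain ⟨p, hpK, hpmax⟩ := hK.exists_isMaxOn ⟨p₀, hp₀K⟩ (hF.mono fun q hq => ⟨hq.1.1, hq.2⟩)
  have hle : F p₀ ≤ F p := hpmax hp₀K
  have hpV : p ∈ V := by
    by_contra h
    exact absurd (hb p hpK.1.1 hpK.2 h) (not_lt.mpr hle)
  refine ⟨p, hpV, hle, ?_⟩
  filter_upwards [hV.mem_nhds hpV] with q hq
  by_cases h : F p₀ ≤ F q
  · exact hpmax ⟨⟨hVΩ hq, hM q hq h⟩, subset_closure hq⟩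
  · exact (not_le.mp h).le.trans hle

end SlabTranslator

lemma le_of_mem_closure_of_continuousOn {Ω V : Set (ℝ × ℝ)} (hΩ : IsOpen Ω) {g : ℝ × ℝ → ℝ}
    (hg : ContinuousOn g Ω) {a : ℝ} (h : ∀ v ∈ V, g v ≤ a) {q : ℝ × ℝ} (hq : q ∈ Ω)
    (hqV : q ∈ closure V) : g q ≤ a := by
  by_contra hlt
  push Not at hlt
  obtain ⟨v, hv, hvV⟩ := mem_closure_iff_nhds.mp hqV _
    ((hg.continuousAt (hΩ.mem_nhds hq)).eventually (lt_mem_nhds hlt))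
  exact absurd (h v hvV) (not_le.mpr hv)

lemma ge_of_mem_closure_of_continuousOn {Ω V : Set (ℝ × ℝ)} (hΩ : IsOpen Ω) {g : ℝ × ℝ → ℝ}
    (hg : ContinuousOn g Ω) {a : ℝ} (h : ∀ v ∈ V, a ≤ g v) {q : ℝ × ℝ} (hq : q ∈ Ω)
    (hqV : q ∈ closure V) : a ≤ g q :=
  neg_le_neg_iff.mp (le_of_mem_closure_of_continuousOn hΩ hg.neg
    (fun v hv => neg_le_neg (h v hv)) hq hqV)

lemma mem_connectedComponentIn_of_mem_closure {X : Type*} [TopologicalSpace X]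
    {O : Set X} {p q : X} (hq : q ∈ O)
    (hcl : q ∈ closure (connectedComponentIn O p)) : q ∈ connectedComponentIn O p := by
  have hp : p ∈ O := by
    by_contra h
    rw [connectedComponentIn_eq_empty h] at hcl
    simp at hcl
  have hpre : IsPreconnected (insert q (connectedComponentIn O p)) :=
    isPreconnected_connectedComponentIn.subset_closure (Set.subset_insert _ _)
      (Set.insert_subset hcl subset_closure)
  exact hpre.subset_connectedComponentIn (Set.mem_insert_of_mem _ (mem_connectedComponentIn hp))
    (Set.insert_subset hq (connectedComponentIn_subset _ _)) (Set.mem_insert _ _)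

/-- `V` is a union of connected components of `{p ∈ Ω | f p < c₀}`. -/
structure IsPiece (Ω : Set (ℝ × ℝ)) (f : ℝ × ℝ → ℝ) (c₀ : ℝ) (V : Set (ℝ × ℝ)) : Prop where
  isOpen : IsOpen V
  subset : V ⊆ Ω
  lt : ∀ q ∈ V, f q < c₀
  mem : ∀ q ∈ Ω, q ∈ closure V → f q < c₀ → q ∈ V

lemma hasJet_quadratic (a b d x : ℝ) :
    HasJet (fun x => a * x ^ 2 + b * x + d) (fun x => 2 * a * x + b) (2 * a) x := by
  refine ⟨Filter.Eventually.of_forall fun y => ?_, ?_⟩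
  · have h := (((hasDerivAt_id y).pow 2).const_mul a).add ((hasDerivAt_id y).const_mul b)
    exact (h.add_const d).congr_deriv (by simp; ring)
  · have h := ((hasDerivAt_id x).const_mul (2 * a)).add_const b
    exact h.congr_deriv (by simp)

lemma hasJet_log_cos {μ a x : ℝ} (h : 0 < Real.cos (μ * (x - a))) :
    HasJet (fun x => Real.log (Real.cos (μ * (x - a)))) (fun x => -(μ * Real.tan (μ * (x - a))))
      (-(μ ^ 2 + (μ * Real.tan (μ * (x - a))) ^ 2)) x := by
  have hlin : ∀ y : ℝ, HasDerivAt (fun y => μ * (y - a)) μ y := fun y => by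
    simpa using ((hasDerivAt_id y).sub_const a).const_mul μ
  constructor
  · have hc : Continuous fun y : ℝ => Real.cos (μ * (y - a)) := by fun_prop
    filter_upwards [hc.continuousAt.eventually (lt_mem_nhds h)] with y hy
    refine (((Real.hasDerivAt_cos _).comp y (hlin y)).log hy.ne').congr_deriv ?_
    simp only [Function.comp_apply]
    rw [Real.tan_eq_sin_div_cos]
    field_simp
  · have := (((Real.hasDerivAt_tan h.ne').comp x (hlin x)).const_mul μ).neg
    refine this.congr_deriv ?_
    rw [Real.tan_eq_sin_div_cos]
    have h1 := Real.sin_sq_add_cos_sq (μ * (x - a))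
    have h2 := h.ne'
    field_simp
    linear_combination μ ^ 2 * h1

namespace SlabTranslator

variable {c σ w : ℝ} {Ω : Set (ℝ × ℝ)} {u : ℝ × ℝ → ℝ}

theorem barrier (D : SlabTranslator c σ w Ω u) {V : Set (ℝ × ℝ)} (hV : IsOpen V)
    (hVΩ : V ⊆ Ω) {G H K G1 H1 K1 G2 H2 K2 : ℝ → ℝ}
    (hG : ∀ q ∈ V, HasJet G G1 (G2 q.1) q.1)
    (hH : ∀ q ∈ V, HasJet H H1 (H2 (ycoord c σ u q)) (ycoord c σ u q))
    (hK : ∀ q ∈ V, HasJet K K1 (K2 (zcoord c σ u q)) (zcoord c σ u q))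
    {F : ℝ × ℝ → ℝ} (hFeq : ∀ q, F q = G q.1 + H (ycoord c σ u q) + K (zcoord c σ u q))
    (hF : ContinuousOn F (Ω ∩ closure V))
    {p₀ : ℝ × ℝ} (hp₀ : p₀ ∈ V) {M : ℝ}
    (hM : ∀ q ∈ V, F p₀ ≤ F q → |ycoord c σ u q| ≤ M ∧ |zcoord c σ u q| ≤ M)
    (hb : ∀ q ∈ Ω, q ∈ closure V → q ∉ V → F q < F p₀) :
    ∃ p ∈ V, F p₀ ≤ F p ∧ ∃ P Y Z l : ℝ, 1 ≤ Y ^ 2 + Z ^ 2 ∧ G1 p.1 = -l * P ∧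
      H1 (ycoord c σ u p) = l * Z ∧ K1 (zcoord c σ u p) = -l * Y ∧
      G2 p.1 * (Y ^ 2 + Z ^ 2) + H2 (ycoord c σ u p) * (P ^ 2 + Y ^ 2) +
        K2 (zcoord c σ u p) * (P ^ 2 + Z ^ 2) +
        K1 (zcoord c σ u p) * (P ^ 2 + Y ^ 2 + Z ^ 2) ≤ 0 := by
  obtain ⟨p, hpV, hle, hmax⟩ := D.exists_isLocalMax hV hVΩ hF hp₀ hM hb
  obtain rfl : F = fun q => G q.1 + H (ycoord c σ u q) + K (zcoord c σ u q) := funext hFeq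
  exact ⟨p, hpV, hle, D.max_principle_xyz (hVΩ hpV) (hG p hpV) (hH p hpV) (hK p hpV) hmax⟩

theorem barrier_quadratic (D : SlabTranslator c σ w Ω u) {V : Set (ℝ × ℝ)} (hV : IsOpen V)
    (hVΩ : V ⊆ Ω) (a₁ b₁ a₂ b₂ a₃ b₃ : ℝ) {F : ℝ × ℝ → ℝ}
    (hFeq : ∀ q, F q = (a₁ * q.1 ^ 2 + b₁ * q.1) +
      (a₂ * ycoord c σ u q ^ 2 + b₂ * ycoord c σ u q) +
      (a₃ * zcoord c σ u q ^ 2 + b₃ * zcoord c σ u q))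
    {p₀ : ℝ × ℝ} (hp₀ : p₀ ∈ V) {M : ℝ}
    (hM : ∀ q ∈ V, F p₀ ≤ F q → |ycoord c σ u q| ≤ M ∧ |zcoord c σ u q| ≤ M)
    (hb : ∀ q ∈ Ω, q ∈ closure V → q ∉ V → F q < F p₀) :
    ∃ p ∈ V, F p₀ ≤ F p ∧ ∃ P Y Z l : ℝ, 1 ≤ Y ^ 2 + Z ^ 2 ∧ 2 * a₁ * p.1 + b₁ = -l * P ∧
      2 * a₂ * ycoord c σ u p + b₂ = l * Z ∧ 2 * a₃ * zcoord c σ u p + b₃ = -l * Y ∧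
      2 * a₁ * (Y ^ 2 + Z ^ 2) + 2 * a₂ * (P ^ 2 + Y ^ 2) + 2 * a₃ * (P ^ 2 + Z ^ 2) +
        (2 * a₃ * zcoord c σ u p + b₃) * (P ^ 2 + Y ^ 2 + Z ^ 2) ≤ 0 := by
  have hy := D.continuousOn_ycoord
  have hz := D.continuousOn_zcoord
  have hF : ContinuousOn F Ω := by
    obtain rfl : F = fun q : ℝ × ℝ => (a₁ * q.1 ^ 2 + b₁ * q.1) +
      (a₂ * ycoord c σ u q ^ 2 + b₂ * ycoord c σ u q) +
      (a₃ * zcoord c σ u q ^ 2 + b₃ * zcoord c σ u q) := funext hFeq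
    fun_prop
  exact D.barrier hV hVΩ (G2 := fun _ => 2 * a₁) (H2 := fun _ => 2 * a₂) (K2 := fun _ => 2 * a₃)
    (fun q _ => hasJet_quadratic a₁ b₁ 0 q.1)
    (fun q _ => hasJet_quadratic a₂ b₂ 0 _) (fun q _ => hasJet_quadratic a₃ b₃ 0 _)
    (fun q => by rw [hFeq q]; ring) (hF.mono Set.inter_subset_left) hp₀ hM hb

/-- `f` is unbounded below on every piece of a sublevel set of `f`. -/
theorem exists_ycoord_lt (D : SlabTranslator c σ w Ω u) {c₀ : ℝ} {V : Set (ℝ × ℝ)}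
    (hV : IsPiece Ω (ycoord c σ u) c₀ V) (hne : V.Nonempty) (b : ℝ) :
    ∃ q ∈ V, ycoord c σ u q < b := by
  by_contra hcon
  push Not at hcon
  obtain ⟨p, hp⟩ := hne
  set f := ycoord c σ u with hf
  set z := zcoord c σ u with hz
  have hpc : f p < c₀ := hV.lt p hp
  set m := |b| + |c₀| with hm
  have hbm : |b| ≤ m := by rw [hm]; linarith [abs_nonneg c₀]
  have hcm : |c₀| ≤ m := by rw [hm]; linarith [abs_nonneg b]
  have hm0 : 0 ≤ m := (abs_nonneg b).trans hbm
  have hfm : ∀ q ∈ V, |f q| ≤ m := fun q hq => by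
    have h1 := hcon q hq
    have h2 := hV.lt q hq
    rw [abs_le]
    constructor
    · linarith [(abs_le.mp hbm).1]
    · linarith [(abs_le.mp hcm).2]
  obtain ⟨ε, hε, hε1⟩ : ∃ ε : ℝ, 0 < ε ∧ ε * (w ^ 2 + c₀ ^ 2) < c₀ - f p := by
    have h0 : 0 < w ^ 2 + c₀ ^ 2 + 1 := by positivity
    refine ⟨(c₀ - f p) / (w ^ 2 + c₀ ^ 2 + 1), div_pos (by linarith) h0, ?_⟩
    rw [div_mul_eq_mul_div, div_lt_iff₀ h0]
    nlinarith
  set B := ε * (w ^ 2 + m ^ 2) + 2 * m with hB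
  have hB0 : 0 ≤ B := by positivity
  obtain ⟨κ, hκ, hκ1⟩ : ∃ κ : ℝ, 0 < κ ∧ κ ^ 2 + κ * (B + 1) < ε := by
    refine ⟨min 1 (ε / (B + 3)), by positivity, ?_⟩
    have h1 : min 1 (ε / (B + 3)) ≤ 1 := min_le_left _ _
    have h2 : min 1 (ε / (B + 3)) * (B + 3) ≤ ε := by
      rw [← le_div_iff₀ (by positivity)]
      exact min_le_right _ _
    have h3 : 0 < min 1 (ε / (B + 3)) := by positivity
    nlinarith
  have hslab : ∀ q ∈ Ω, q.1 ^ 2 ≤ w ^ 2 := fun q hq => sq_le_sq' (abs_le.mp (D.slab q hq)).1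
    (abs_le.mp (D.slab q hq)).2
  have hmf : ∀ q ∈ V, f q ^ 2 ≤ m ^ 2 := fun q hq => sq_le_sq' (abs_le.mp (hfm q hq)).1
    (abs_le.mp (hfm q hq)).2
  let F : ℝ × ℝ → ℝ := fun q => ε * (q.1 ^ 2 + f q ^ 2) - f q - κ ^ 2 * (z q ^ 2 - 2 * z p * z q)
  have hsup : ∀ q ∈ V, F p ≤ F q → κ ^ 2 * (z q - z p) ^ 2 ≤ B := by
    intro q hq h
    have h1 := hslab q (hV.subset hq)
    have h2 := hmf q hq
    have h3 := (abs_le.mp (hfm q hq)).1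
    have h4 := (abs_le.mp (hfm p hp)).2
    simp only [F] at h
    have h5 : 0 ≤ ε * (p.1 ^ 2 + f p ^ 2) := by positivity
    have h6 : ε * (q.1 ^ 2 + f q ^ 2) ≤ ε * (w ^ 2 + m ^ 2) := by gcongr
    rw [hB]
    nlinarith
  have hsup2 : ∀ q ∈ V, F p ≤ F q → κ * |z q - z p| ≤ B + 1 := by
    intro q hq h
    have h1 := hsup q hq h
    rw [← sq_abs (z q - z p), ← mul_pow] at h1
    have h2 : 0 ≤ κ * |z q - z p| := by positivity
    nlinarith
  have hbdd : ∀ r ∈ V, F p ≤ F r → |f r| ≤ m + |z p| + (B + 1) / κ ∧ |z r| ≤ m + |z p| + (B + 1) / κ := by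
    intro r hr h
    have h1 := hsup2 r hr h
    have h2 : |z r - z p| ≤ (B + 1) / κ := by rw [le_div_iff₀ hκ]; linarith
    have h3 : |z r| ≤ |z r - z p| + |z p| := by
      have := abs_add_le (z r - z p) (z p); simpa using this
    have h4 := hfm r hr
    have h5 : 0 ≤ (B + 1) / κ := by positivity
    exact ⟨by linarith [abs_nonneg (z p)], by linarith⟩
  have hbdry : ∀ q ∈ Ω, q ∈ closure V → q ∉ V → F q < F p := by
    intro q hqΩ hqc hqV
    have h1 : f q = c₀ := le_antisymm
      (le_of_mem_closure_of_continuousOn D.isOpen D.continuousOn_ycoord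
        (fun v hv => (hV.lt v hv).le) hqΩ hqc)
      (not_lt.mp fun h => hqV (hV.mem q hqΩ hqc h))
    simp only [F, h1]
    have h2 : ε * (q.1 ^ 2 + c₀ ^ 2) ≤ ε * (w ^ 2 + c₀ ^ 2) := by
      have := hslab q hqΩ
      nlinarith
    have h3 : 0 ≤ ε * (p.1 ^ 2 + f p ^ 2) := by positivity
    have h4 : 0 ≤ κ ^ 2 * (z q - z p) ^ 2 := by positivity
    nlinarith
  obtain ⟨q, hq, hFq, P, Y, Z, l, hYZ, -, -, -, hfin⟩ := D.barrier_quadratic hV.isOpen hV.subset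
    ε 0 ε (-1) (-κ ^ 2) (κ ^ 2 * (2 * z p)) (F := F)
    (fun q => by simp only [F]; ring) hp (M := m + |z p| + (B + 1) / κ) hbdd hbdry
  set T := P ^ 2 + Y ^ 2 + Z ^ 2 with hT
  have hT1 : 1 ≤ T := by have := sq_nonneg P; linarith
  have hk : -(2 * κ * (B + 1)) ≤ 2 * -κ ^ 2 * z q + κ ^ 2 * (2 * z p) := by
    have h1 : κ * (z q - z p) ≤ κ * |z q - z p| := by gcongr; exact le_abs_self _
    have h2 := hsup2 q hq hFq
    nlinarith
  have hk2 : -(2 * κ * (B + 1)) * T ≤ (2 * -κ ^ 2 * z q + κ ^ 2 * (2 * z p)) * T := by gcongr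
  have h3 : 0 < (ε - κ ^ 2 - κ * (B + 1)) * T := mul_pos (by linarith) (by linarith)
  have h4 : 0 ≤ ε * Y ^ 2 := by positivity
  have h5 : 0 ≤ κ ^ 2 * Y ^ 2 := by positivity
  have h6 : ε * T = ε * P ^ 2 + ε * Y ^ 2 + ε * Z ^ 2 := by rw [hT]; ring
  have h7 : κ ^ 2 * T = κ ^ 2 * P ^ 2 + κ ^ 2 * Y ^ 2 + κ ^ 2 * Z ^ 2 := by rw [hT]; ring
  linarith

set_option maxHeartbeats 800000 in
/-- Linear lower bound for the height on a piece. -/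
theorem exists_zcoord_lower_bound (D : SlabTranslator c σ w Ω u) {c₀ y₁ Z₁ : ℝ} {V : Set (ℝ × ℝ)}
    (hV : IsPiece Ω (ycoord c σ u) c₀ V) (hy₁ : y₁ < c₀)
    (hZ : ∀ q ∈ V, ycoord c σ u q = y₁ → -Z₁ ≤ zcoord c σ u q) (hw : 0 ≤ w) :
    ∃ C : ℝ, 0 ≤ C ∧ ∀ q ∈ V, ycoord c σ u q ≤ y₁ →
      -(C * (1 + |ycoord c σ u q|)) ≤ zcoord c σ u q := by
  set f := ycoord c σ u with hf
  set z := zcoord c σ u with hz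
  set lam := 2 * w + 1 with hlam
  have hlam1 : 1 ≤ lam := by linarith
  have hC0 : 0 ≤ 4 * w ^ 2 + 4 * lam * (|y₁| + 1) + 4 + 2 * |Z₁| := by positivity
  refine ⟨4 * w ^ 2 + 4 * lam * (|y₁| + 1) + 4 + 2 * |Z₁|, hC0, ?_⟩
  intro p hp hpy
  by_contra hcon
  push Not at hcon
  set b := f p with hb
  set N := -z p with hN
  have hNb : 4 * w ^ 2 + 4 * lam * (|y₁| + |b|) + 4 + 2 * |Z₁| < N := by
    have h1 : 0 ≤ (4 * w ^ 2 + 4 * lam * |y₁| + 4 + 2 * |Z₁|) * |b| := by positivity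
    nlinarith
  have hNb2 : 4 * w ^ 2 + 4 * lam * (|y₁| + |b|) + 4 < N := by linarith [abs_nonneg Z₁]
  have hN4 : 4 < N := by
    have : 0 ≤ 4 * w ^ 2 + 4 * lam * (|y₁| + |b|) + 2 * |Z₁| := by positivity
    linarith
  have hNZ : 2 * |Z₁| < N := by
    have : 0 ≤ 4 * w ^ 2 + 4 * lam * (|y₁| + |b|) + 4 := by positivity
    linarith
  have hZ1 := le_abs_self Z₁
  have hb1 : b < y₁ := by
    rcases hpy.lt_or_eq with h | h
    · exact h
    · exfalso
      have := hZ p hp h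
      linarith [abs_nonneg Z₁]
  set κ := (N + 3)⁻¹ with hκ
  have hκ0 : 0 < κ := by positivity
  have hκN : κ * (N + 3) = 1 := inv_mul_cancel₀ (by linarith)
  set B := |b| + w ^ 2 + 1 with hB
  have hBb : -B < b := by have := neg_abs_le b; have := sq_nonneg w; linarith
  have hB0 : 0 ≤ B := by positivity
  have hNb3 : w ^ 2 + lam * |y₁| + lam * |b| < (N - 3) / 4 := by linarith
  clear_value lam κ N B b
  set V' : Set (ℝ × ℝ) := V ∩ (Ω ∩ {q | -B < f q ∧ f q < y₁ ∧ |z q - z p| < N / 2}) with hV'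
  have hV'o : IsOpen V' := by
    refine hV.isOpen.inter ?_
    have h1 := D.continuousOn_ycoord.isOpen_inter_preimage D.isOpen (isOpen_Ioo (a := -B) (b := y₁))
    have h2 : ContinuousOn (fun q => |z q - z p|) Ω := by
      have := D.continuousOn_zcoord
      fun_prop
    have h3 := h2.isOpen_inter_preimage D.isOpen (isOpen_Iio (a := N / 2))
    convert h1.inter h3 using 1
    ext q
    simp only [Set.mem_inter_iff, Set.mem_ofPred_eq, Set.mem_preimage, Set.mem_Ioo, Set.mem_Iio]
    tauto
  have hpV' : p ∈ V' := ⟨hp, hV.subset hp, by rwa [← hb], by rwa [← hb], by simp; linarith⟩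
  let F : ℝ × ℝ → ℝ := fun q => q.1 ^ 2 + lam * f q - κ * (z q ^ 2 - 2 * z p * z q)
  have hslab : ∀ q ∈ Ω, q.1 ^ 2 ≤ w ^ 2 := fun q hq => sq_le_sq' (abs_le.mp (D.slab q hq)).1
    (abs_le.mp (D.slab q hq)).2
  have hbdd : ∀ r ∈ V', F p ≤ F r → |f r| ≤ B + |y₁| + 2 * N ∧ |z r| ≤ B + |y₁| + 2 * N := by
    intro r hr h
    obtain ⟨hrV, -, h1, h2, h3⟩ := hr
    have h4 := abs_lt.mp h3
    exact ⟨abs_le.mpr ⟨by linarith [abs_nonneg y₁], by linarith [le_abs_self y₁]⟩,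
      abs_le.mpr ⟨by linarith [abs_nonneg y₁], by linarith [abs_nonneg y₁]⟩⟩
  have hbdry : ∀ q ∈ Ω, q ∈ closure V' → q ∉ V' → F q < F p := by
    intro q hqΩ hqc hqV
    have hy := D.continuousOn_ycoord
    have hz' : ContinuousOn (fun q => |z q - z p|) Ω := by
      have := D.continuousOn_zcoord
      fun_prop
    have h1 : f q ≤ y₁ := le_of_mem_closure_of_continuousOn D.isOpen hy
      (fun v hv => hv.2.2.2.1.le) hqΩ hqc
    have h2 : -B ≤ f q := ge_of_mem_closure_of_continuousOn D.isOpen hy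
      (fun v hv => hv.2.2.1.le) hqΩ hqc
    have h3 : |z q - z p| ≤ N / 2 := le_of_mem_closure_of_continuousOn D.isOpen hz'
      (fun v hv => hv.2.2.2.2.le) hqΩ hqc
    have hqV0 : q ∈ V := hV.mem q hqΩ (closure_mono Set.inter_subset_left hqc) (by linarith)
    have h4 := hslab q hqΩ
    have h5 : 0 ≤ κ * (z q - z p) ^ 2 := by positivity
    have hFp : F p = p.1 ^ 2 + lam * b + κ * z p ^ 2 := by simp only [F]; rw [hb]; ring
    have hFq : F q = q.1 ^ 2 + lam * f q - κ * (z q - z p) ^ 2 + κ * z p ^ 2 := by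
      simp only [F]; ring
    rw [hFp, hFq]
    have h6 := sq_nonneg p.1
    rcases h2.lt_or_eq with h2 | h2
    · rcases h1.lt_or_eq with h1 | h1
      · rcases h3.lt_or_eq with h3 | h3
        · exact absurd ⟨hqV0, hqΩ, h2, h1, h3⟩ hqV
        · have h7 : (z q - z p) ^ 2 = N ^ 2 / 4 := by rw [← sq_abs, h3]; ring
          have h8 : N - 3 ≤ κ * N ^ 2 := by
            have : (N - 3) * (κ * (N + 3)) ≤ κ * N ^ 2 := by nlinarith
            rwa [hκN, mul_one] at this
          rw [h7]
          have h9 : lam * f q ≤ lam * |y₁| := by gcongr; exact h1.le.trans (le_abs_self _)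
          have h10 : -(lam * |b|) ≤ lam * b := by
            have := neg_abs_le b
            nlinarith
          have h11 : κ * (N ^ 2 / 4) = κ * N ^ 2 / 4 := by ring
          rw [h11]
          linarith only [h4, h6, h8, h9, h10, hNb3]
      · exfalso
        have h7 := hZ q hqV0 h1
        have h8 := (abs_le.mp h3).2
        linarith
    · rw [← h2]
      have h10 : -(lam * |b|) ≤ lam * b := by
        have := neg_abs_le b
        nlinarith
      have h11 : lam * B = lam * |b| + lam * w ^ 2 + lam := by rw [hB]; ring
      have h12 : 1 * w ^ 2 ≤ lam * w ^ 2 := by gcongr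
      linarith
  obtain ⟨q, hq, hFq, P, Y, Z, l, hYZ, hP, hl, -, hfin⟩ := D.barrier_quadratic hV'o
    (fun q hq => hV.subset hq.1) 1 0 0 lam (-κ) (κ * (2 * z p)) (F := F)
    (fun q => by simp only [F]; ring) hpV' (M := B + |y₁| + 2 * N) hbdd hbdry
  have h1 := hslab q (hV.subset hq.1)
  have hl2 : lam ^ 2 = l ^ 2 * Z ^ 2 := by rw [← mul_pow, ← hl]; ring
  have hP2 : 4 * q.1 ^ 2 = l ^ 2 * P ^ 2 := by
    have : (2 * 1 * q.1 + 0) ^ 2 = (-l * P) ^ 2 := by rw [hP]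
    linarith
  have hPZ : P ^ 2 ≤ Z ^ 2 := by
    by_contra h
    push Not at h
    have h2 : 0 < l ^ 2 := by
      have : l ≠ 0 := by rintro rfl; simp at hl2; linarith
      positivity
    nlinarith
  obtain ⟨-, -, -, -, h2⟩ := hq
  have h3 := (abs_lt.mp h2).2
  have h4 : κ * (z q - z p) ≤ κ * (N / 2) := by gcongr
  set T := P ^ 2 + Y ^ 2 + Z ^ 2 with hT
  have hT1 : 1 ≤ T := by have := sq_nonneg P; linarith
  have h5 : -(κ * N) * T ≤ (2 * -κ * z q + κ * (2 * z p)) * T := by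
    gcongr
    linarith
  have h6 : κ * (P ^ 2 + Z ^ 2) ≤ κ * T := by gcongr; have := sq_nonneg Y; linarith
  have h7 : 0 < (1 - 2 * κ - κ * N) * T := mul_pos (by linarith) (by linarith)
  linarith [sq_nonneg Y]

end SlabTranslator

namespace SlabTranslator

variable {c σ w : ℝ} {Ω : Set (ℝ × ℝ)} {u : ℝ × ℝ → ℝ}

lemma fst_sq_le (D : SlabTranslator c σ w Ω u) {q : ℝ × ℝ} (hq : q ∈ Ω) : q.1 ^ 2 ≤ w ^ 2 :=
  sq_le_sq' (abs_le.mp (D.slab q hq)).1 (abs_le.mp (D.slab q hq)).2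

theorem log_cos_barrier (D : SlabTranslator c σ w Ω u) {Q : Set (ℝ × ℝ)} (hQo : IsOpen Q)
    (hQΩ : Q ⊆ Ω) {μ ym A a τ T : ℝ} (hμ : 0 < μ) (hA : 0 ≤ A) (hτ : τ ^ 2 = 1)
    (hQ : ∀ q ∈ Q, |μ * (ycoord c σ u q - ym)| < π / 2) {p : ℝ × ℝ} (hp : p ∈ Q)
    (hT : ∀ q ∈ Q, A * (q.1 - a) ^ 2 + τ * zcoord c σ u q ≤ T)
    (hb : ∀ q ∈ Ω, q ∈ closure Q → q ∉ Q → |μ * (ycoord c σ u q - ym)| = π / 2 ∨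
      A * (q.1 - a) ^ 2 + τ * zcoord c σ u q < A * (p.1 - a) ^ 2 + τ * zcoord c σ u p +
        Real.log (Real.cos (μ * (ycoord c σ u p - ym)))) :
    ∃ q ∈ Q, ∃ h : ℝ, 2 * A * (1 + h ^ 2) - (μ ^ 2 + h ^ 2) * ((2 * A * (q.1 - a)) ^ 2 + 1) +
      τ * ((2 * A * (q.1 - a)) ^ 2 + 1 + h ^ 2) ≤ 0 := by
  set f := ycoord c σ u with hf
  set z := zcoord c σ u with hz
  let F : ℝ × ℝ → ℝ := fun q => A * (q.1 - a) ^ 2 + τ * z q + Real.log (Real.cos (μ * (f q - ym)))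
  have hpos : ∀ q ∈ Q, 0 < Real.cos (μ * (f q - ym)) := fun q hq =>
    Real.cos_pos_of_mem_Ioo ⟨by linarith [(abs_lt.mp (hQ q hq)).1], (abs_lt.mp (hQ q hq)).2⟩
  have hlog : ∀ q, Real.log (Real.cos (μ * (f q - ym))) ≤ 0 := fun q => by
    rw [← Real.log_abs]
    exact Real.log_nonpos (abs_nonneg _) (Real.abs_cos_le_one _)
  obtain ⟨ε, hε, hε1, hε2⟩ : ∃ ε : ℝ, 0 < ε ∧ ε < Real.cos (μ * (f p - ym)) ∧
      T + Real.log ε < F p := by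
    refine ⟨min (Real.cos (μ * (f p - ym)) / 2) (Real.exp (F p - T - 1)),
      lt_min (half_pos (hpos p hp)) (Real.exp_pos _),
      (min_le_left _ _).trans_lt (half_lt_self (hpos p hp)), ?_⟩
    have h1 : Real.log (min (Real.cos (μ * (f p - ym)) / 2) (Real.exp (F p - T - 1))) ≤
        F p - T - 1 := by
      rw [← Real.log_exp (F p - T - 1)]
      refine Real.log_le_log (lt_min (half_pos (hpos p hp)) (Real.exp_pos _)) ?_
      rw [Real.log_exp]
      exact min_le_right _ _
    linarith
  have hy := D.continuousOn_ycoord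
  have hzc := D.continuousOn_zcoord
  have hcos : ContinuousOn (fun q => Real.cos (μ * (f q - ym))) Ω := by fun_prop
  set V : Set (ℝ × ℝ) := Q ∩ (Ω ∩ {q | ε < Real.cos (μ * (f q - ym))}) with hV
  have hVo : IsOpen V := hQo.inter (hcos.isOpen_inter_preimage D.isOpen isOpen_Ioi)
  have hpV : p ∈ V := ⟨hp, hQΩ hp, hε1⟩
  have hcl : ∀ q ∈ Ω, q ∈ closure V → ε ≤ Real.cos (μ * (f q - ym)) := fun q hq hqV =>
    ge_of_mem_closure_of_continuousOn D.isOpen hcos (fun v hv => hv.2.2.le) hq hqV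
  have hF : ContinuousOn F (Ω ∩ closure V) := by
    have h1 : ContinuousOn (fun q : ℝ × ℝ => A * (q.1 - a) ^ 2 + τ * z q) Ω := by fun_prop
    have h2 := ContinuousOn.log (hcos.mono (Set.inter_subset_left (t := closure V)))
      (fun q hq => (hε.trans_le (hcl q hq.1 hq.2)).ne')
    exact (h1.mono Set.inter_subset_left).add h2
  have hbdd : ∀ r ∈ V, F p ≤ F r → |f r| ≤ |T| + |F p| + A * (|w| + |a|) ^ 2 + |ym| + π / 2 / μ ∧
      |z r| ≤ |T| + |F p| + A * (|w| + |a|) ^ 2 + |ym| + π / 2 / μ := by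
    intro r hr h
    have h1 := hT r hr.1
    have h2 := hlog r
    have h3 : (r.1 - a) ^ 2 ≤ (|w| + |a|) ^ 2 := by
      rw [← sq_abs (r.1 - a)]
      have h4 : |r.1 - a| ≤ |r.1| + |a| := abs_sub _ _
      have h5 := D.slab r (hQΩ hr.1)
      have h6 := le_abs_self w
      gcongr
      linarith
    have h4 : A * (r.1 - a) ^ 2 ≤ A * (|w| + |a|) ^ 2 := by gcongr
    have h5 : 0 ≤ A * (r.1 - a) ^ 2 := by positivity
    have h6 : F p ≤ A * (r.1 - a) ^ 2 + τ * z r + Real.log (Real.cos (μ * (f r - ym))) := h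
    have h7 : |τ * z r| ≤ |T| + |F p| + A * (|w| + |a|) ^ 2 := by
      rw [abs_le]
      constructor
      · linarith [neg_abs_le (F p), abs_nonneg T]
      · linarith [le_abs_self T, abs_nonneg (F p)]
    have h8 : |τ| = 1 := by
      rw [← sq_eq_sq₀ (abs_nonneg _) zero_le_one, sq_abs, hτ, one_pow]
    rw [abs_mul, h8, one_mul] at h7
    have h9 : 0 ≤ π / 2 / μ := by have := Real.pi_pos; positivity
    have h10 : |f r - ym| < π / 2 / μ := by
      have := hQ r hr.1
      rw [abs_mul, abs_of_pos hμ] at this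
      rw [lt_div_iff₀ hμ]
      linarith
    have h11 : |f r| ≤ |f r - ym| + |ym| := by
      have := abs_add_le (f r - ym) ym; simpa using this
    have h12 : 0 ≤ |T| + |F p| + A * (|w| + |a|) ^ 2 := by positivity
    exact ⟨by linarith, by linarith [abs_nonneg ym]⟩
  have hbdry : ∀ q ∈ Ω, q ∈ closure V → q ∉ V → F q < F p := by
    intro q hqΩ hqc hqV
    have h1 := hcl q hqΩ hqc
    have hTq : A * (q.1 - a) ^ 2 + τ * z q ≤ T := by
      refine le_of_mem_closure_of_continuousOn (V := V)
        (g := fun q => A * (q.1 - a) ^ 2 + τ * z q) D.isOpen ?_ (fun v hv => hT v hv.1) hqΩ hqc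
      fun_prop
    by_cases hqQ : q ∈ Q
    · have h2 : Real.cos (μ * (f q - ym)) = ε :=
        le_antisymm (not_lt.mp fun h => hqV ⟨hqQ, hqΩ, h⟩) h1
      simp only [F] at hε2 ⊢
      rw [h2]
      linarith
    · rcases hb q hqΩ (closure_mono Set.inter_subset_left hqc) hqQ with h2 | h2
      · exfalso
        rw [← Real.cos_abs, h2, Real.cos_pi_div_two] at h1
        linarith
      · have := hlog q
        simp only [F]
        linarith
  obtain ⟨q, hq, -, P, Y, Z, l, hYZ, hP, hH, hK, hfin⟩ := D.barrier hVo (fun q hq => hQΩ hq.1)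
    (G2 := fun _ => 2 * A) (H2 := fun y => -(μ ^ 2 + (μ * Real.tan (μ * (y - ym))) ^ 2))
    (K2 := fun _ => 2 * 0) (fun q _ => hasJet_quadratic A (-(2 * A * a)) (A * a ^ 2) q.1)
    (fun q hq => hasJet_log_cos (hpos q hq.1)) (fun q _ => hasJet_quadratic 0 τ 0 _)
    (fun q => by simp only [F, hf, hz]; ring) hF hpV hbdd hbdry
  refine ⟨q, hq.1, l * Z, ?_⟩
  simp only [mul_zero, zero_mul, zero_add, add_zero] at hK hfin hP
  rw [← hf] at hH hfin
  set h := μ * Real.tan (μ * (f q - ym)) with hh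
  have e1 : (2 * A * (q.1 - a)) ^ 2 = l ^ 2 * P ^ 2 := by
    have : 2 * A * (q.1 - a) = -l * P := by linarith
    rw [this]; ring
  have e2 : 1 = l ^ 2 * Y ^ 2 := by rw [← hτ, hK]; ring
  have e3 : h ^ 2 = l ^ 2 * Z ^ 2 := by
    have : h = -(l * Z) := by linarith
    rw [this]; ring
  have e4 := mul_nonneg (sq_nonneg l) (neg_nonneg.mpr hfin)
  rw [e1, mul_pow]
  rw [e3] at e4
  linear_combination e4 + (2 * A - (μ ^ 2 + l ^ 2 * Z ^ 2) + τ) * e2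

/-- A region in a strip of width `8` around which the surface only leaves through the sides of the
strip is not bounded above. -/
theorem false_of_zcoord_le (D : SlabTranslator c σ w Ω u) {Q : Set (ℝ × ℝ)} (hQo : IsOpen Q)
    (hQΩ : Q ⊆ Ω) {ym T : ℝ} (hQ : ∀ q ∈ Q, |ycoord c σ u q - ym| < 4) (hne : Q.Nonempty)
    (hT : ∀ q ∈ Q, zcoord c σ u q ≤ T)
    (hb : ∀ q ∈ Ω, q ∈ closure Q → q ∉ Q → |ycoord c σ u q - ym| = 4) : False := by
  obtain ⟨p, hp⟩ := hne
  have hμ : 0 < π / 8 := by have := Real.pi_pos; positivity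
  obtain ⟨q, hq, h, hh⟩ := D.log_cos_barrier hQo hQΩ (μ := π / 8) (ym := ym) (A := 0) (a := 0)
    (τ := 1) (T := T) hμ le_rfl (by norm_num)
    (fun q hq => by rw [abs_mul, abs_of_pos hμ]; nlinarith [hQ q hq]) hp
    (fun q hq => by simpa using hT q hq)
    (fun q h1 h2 h3 => Or.inl (by rw [abs_mul, abs_of_pos hμ, hb q h1 h2 h3]; ring))
  have h4 := Real.pi_lt_d2
  have h5 : (π / 8) ^ 2 < 1 := by nlinarith [Real.pi_pos]
  nlinarith

/-- Near any point of a piece on which `z` is locally bounded below there are points of the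
piece, joined below a given height, which are at a definite distance in the `x` direction. -/
theorem exists_wide (D : SlabTranslator c σ w Ω u) {c₀ : ℝ} {V : Set (ℝ × ℝ)}
    (hV : IsPiece Ω (ycoord c σ u) c₀ V) {p : ℝ × ℝ} (hp : p ∈ V)
    (hpc : ycoord c σ u p + π / 2 < c₀) {Z : ℝ}
    (hZ : ∀ q ∈ V, |ycoord c σ u q - ycoord c σ u p| < π / 2 → -Z ≤ zcoord c σ u q) :
    ∃ C ⊆ V, IsOpen C ∧ IsConnected C ∧ p ∈ C ∧
      (∀ q ∈ C, |ycoord c σ u q - ycoord c σ u p| < π / 2 ∧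
        zcoord c σ u q < zcoord c σ u p + 1) ∧
      ∃ p₁ ∈ C, ∃ p₂ ∈ C, p₁.1 + 1 / 4 ≤ p₂.1 := by
  set f := ycoord c σ u with hf
  set z := zcoord c σ u with hz
  have hy := D.continuousOn_ycoord
  have hzc := D.continuousOn_zcoord
  set O : Set (ℝ × ℝ) := V ∩ (Ω ∩ {q | |f q - f p| < π / 2 ∧ z q < z p + 1}) with hO
  have hOo : IsOpen O := by
    refine hV.isOpen.inter ?_
    have h1 : ContinuousOn (fun q => |f q - f p|) Ω := by fun_prop
    have h2 := h1.isOpen_inter_preimage D.isOpen (isOpen_Iio (a := π / 2))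
    have h3 := hzc.isOpen_inter_preimage D.isOpen (isOpen_Iio (a := z p + 1))
    convert h2.inter h3 using 1
    ext q
    simp only [Set.mem_inter_iff, Set.mem_ofPred_eq, Set.mem_preimage, Set.mem_Iio, hz]
    tauto
  have hpO : p ∈ O := ⟨hp, hV.subset hp, by simpa using Real.pi_pos, by linarith⟩
  set C := connectedComponentIn O p with hC
  have hCO : C ⊆ O := connectedComponentIn_subset _ _
  have hpC : p ∈ C := mem_connectedComponentIn hpO
  refine ⟨C, fun q hq => (hCO hq).1, hOo.connectedComponentIn,
    isConnected_connectedComponentIn_iff.mpr hpO, hpC, fun q hq => (hCO hq).2.2, ?_⟩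
  by_contra hcon
  push Not at hcon
  set I := (fun q : ℝ × ℝ => q.1) '' C with hI
  have hIne : I.Nonempty := ⟨p.1, p, hpC, rfl⟩
  have hIw : ∀ x ∈ I, |x| ≤ w := by
    rintro x ⟨q, hq, rfl⟩
    exact D.slab q (hCO hq).2.1
  have hbelow : BddBelow I := ⟨-w, fun x hx => (abs_le.mp (hIw x hx)).1⟩
  set a := sInf I + 1 / 8 with ha
  have hxa : ∀ q ∈ C, |q.1 - a| ≤ 1 / 8 := by
    intro q hq
    have h1 : sInf I ≤ q.1 := csInf_le hbelow ⟨q, hq, rfl⟩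
    have h2 : q.1 - 1 / 4 ≤ sInf I := by
      refine le_csInf hIne ?_
      rintro x ⟨r, hr, rfl⟩
      have := hcon r hr q hq
      simp only
      linarith
    rw [abs_le]
    constructor <;> linarith
  have hxa2 : ∀ q ∈ C, (q.1 - a) ^ 2 ≤ 1 / 64 := by
    intro q hq
    have h1 := abs_le.mp (hxa q hq)
    nlinarith
  have hbdry : ∀ q ∈ Ω, q ∈ closure C → q ∉ C → |1 * (f q - f p)| = π / 2 ∨
      4 * (q.1 - a) ^ 2 + -1 * z q < 4 * (p.1 - a) ^ 2 + -1 * z p +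
        Real.log (Real.cos (1 * (f p - f p))) := by
    intro q hqΩ hqc hqC
    have hqx : (q.1 - a) ^ 2 ≤ 1 / 64 :=
      le_of_mem_closure_of_continuousOn (g := fun q => (q.1 - a) ^ 2) D.isOpen
        (by fun_prop) hxa2 hqΩ hqc
    have h1 : |f q - f p| ≤ π / 2 :=
      le_of_mem_closure_of_continuousOn (g := fun q => |f q - f p|) D.isOpen
        (by fun_prop) (fun v hv => (hCO hv).2.2.1.le) hqΩ hqc
    have h2 : z q ≤ z p + 1 :=
      le_of_mem_closure_of_continuousOn D.isOpen hzc (fun v hv => (hCO hv).2.2.2.le) hqΩ hqc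
    have hqV : q ∈ V := hV.mem q hqΩ (closure_mono (hCO.trans Set.inter_subset_left) hqc)
      (by linarith [(abs_le.mp h1).2])
    rw [one_mul]
    rcases h1.lt_or_eq with h1 | h1
    · right
      have h3 : z q = z p + 1 := le_antisymm h2 (not_lt.mp fun h3 =>
        hqC (mem_connectedComponentIn_of_mem_closure ⟨hqV, hqΩ, h1, h3⟩ hqc))
      have h4 : 0 ≤ (p.1 - a) ^ 2 := sq_nonneg _
      simp only [sub_self, mul_zero, Real.cos_zero, Real.log_one]
      linarith
    · exact Or.inl h1
  obtain ⟨q, hq, h, hh⟩ := D.log_cos_barrier hOo.connectedComponentIn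
    (Q := C) (fun q hq => (hCO hq).2.1) (μ := 1) (ym := f p) (A := 4) (a := a)
    (τ := -1) (T := 4 * (1 / 64) + Z) one_pos (by norm_num) (by norm_num)
    (fun q hq => by rw [one_mul]; exact (hCO hq).2.2.1) hpC
    (fun q hq => by
      have h1 := hxa2 q hq
      have h2 := hZ q (hCO hq).1 (hCO hq).2.2.1
      linarith) hbdry
  have h1 := hxa2 q hq
  have h2 : (2 * 4 * (q.1 - a)) ^ 2 ≤ 1 := by nlinarith
  nlinarith [sq_nonneg h]

end SlabTranslator

lemma joinedIn_of_isOpen_isConnected {C W : Set (ℝ × ℝ)} (hC : IsOpen C) (hCc : IsConnected C)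
    (hCW : C ⊆ W) {p q : ℝ × ℝ} (hp : p ∈ C) (hq : q ∈ C) : JoinedIn W p q :=
  (((hC.isConnected_iff_isPathConnected).mp hCc).joinedIn p hp q hq).mono hCW

lemma joinedIn_of_mem_closure {O W N : Set (ℝ × ℝ)} (hO : IsOpen O) {p q : ℝ × ℝ} {H : ℝ}
    (hp : p ∈ O) (hOW : O ⊆ W) (hOH : ∀ r ∈ O, r.2 ≤ H)
    (hq : q ∈ closure (connectedComponentIn O p)) (hN : IsOpen N) (hqN : q ∈ N)
    (hNW : ∀ r ∈ N, r.2 ≤ H → r ∈ W) : JoinedIn W p q := by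
  have hsub := connectedComponentIn_subset O p
  obtain ⟨ε, hε, hball⟩ := Metric.isOpen_iff.mp hN q hqN
  obtain ⟨r, hr, hrC⟩ := mem_closure_iff_nhds.mp hq _ (Metric.ball_mem_nhds q hε)
  have hqH : q.2 ≤ H := le_of_mem_closure_of_continuousOn isOpen_univ (g := fun r => r.2)
    (by fun_prop) (fun v hv => hOH v (hsub hv)) (Set.mem_univ q) hq
  have h1 : JoinedIn W p r := joinedIn_of_isOpen_isConnected hO.connectedComponentIn
    (isConnected_connectedComponentIn_iff.mpr hp) (hsub.trans hOW)
    (mem_connectedComponentIn hp) hrC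
  have hconv : Convex ℝ (Metric.ball q ε ∩ {r : ℝ × ℝ | r.2 ≤ H}) := by
    refine (convex_ball q ε).inter ?_
    exact convex_halfSpace_le (f := fun r : ℝ × ℝ => r.2) ⟨fun _ _ => rfl, fun _ _ => rfl⟩ H
  have h2 : JoinedIn W r q :=
    ((hconv.isPathConnected ⟨q, Metric.mem_ball_self hε, hqH⟩).joinedIn r ⟨hr, hOH r (hsub hrC)⟩ q
      ⟨Metric.mem_ball_self hε, hqH⟩).mono fun x hx => hNW x (hball hx.1) hx.2
  exact h1.trans h2

namespace SlabTranslator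

variable {c σ w : ℝ} {Ω : Set (ℝ × ℝ)} {u : ℝ × ℝ → ℝ}

lemma nonneg_width (D : SlabTranslator c σ w Ω u) : 0 ≤ w := by
  obtain ⟨p, hp⟩ := D.isConnected.nonempty
  exact (abs_nonneg _).trans (D.slab p hp)

lemma abs_le_one (D : SlabTranslator c σ w Ω u) : |c| ≤ 1 ∧ |σ| ≤ 1 := by
  have := D.unit
  constructor <;> refine abs_le_of_sq_le_sq ?_ zero_le_one <;> nlinarith [sq_nonneg c, sq_nonneg σ]

/-- Within a piece one can climb to height `H` without much change in the `x` direction. -/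
theorem exists_climb (D : SlabTranslator c σ w Ω u) (hc : 0 < c) {c₀ : ℝ} {V : Set (ℝ × ℝ)}
    (hV : IsPiece Ω (ycoord c σ u) c₀ V) {p : ℝ × ℝ} (hp : p ∈ V) {τ H b M κ κ' δ : ℝ}
    (hτ : τ ^ 2 = 1) (hM : -M ≤ c₀) (hpM : ycoord c σ u p < -M) (hpH : p.2 < H) (hκ' : 0 < κ')
    (hκ : 2 * κ' < κ * c) (hδ : 0 < δ)
    (h₁ : κ * (H - p.2) + κ' * (ycoord c σ u p - b) ^ 2 < δ)
    (h₂ : 2 * w + κ * (H - p.2) + κ' * (ycoord c σ u p - b) ^ 2 < κ' * (-M - b) ^ 2) :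
    ∃ q ∈ V, q.2 = H ∧ τ * q.1 ≤ τ * p.1 + δ ∧
      JoinedIn (V ∩ {r | ycoord c σ u r < -M ∧ r.2 ≤ H}) p q := by
  have hy := D.continuousOn_ycoord
  set f := ycoord c σ u with hf
  set z := zcoord c σ u with hz
  have hκ0 : 0 < κ := by
    have : 0 < κ * c := by linarith
    exact pos_of_mul_pos_left this hc.le
  have hτ1 : |τ| = 1 := by rw [← sq_eq_sq₀ (abs_nonneg _) zero_le_one, sq_abs, hτ, one_pow]
  have hτx : ∀ q ∈ Ω, |τ * q.1| ≤ w := fun q hq => by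
    rw [abs_mul, hτ1, one_mul]; exact D.slab q hq
  set O : Set (ℝ × ℝ) := V ∩ (Ω ∩ {q | f q < -M}) ∩ {q | τ * q.1 < τ * p.1 + δ ∧ q.2 < H} with hO
  have hOo : IsOpen O := by
    refine (hV.isOpen.inter (hy.isOpen_inter_preimage D.isOpen isOpen_Iio)).inter ?_
    have h1 : IsOpen {q : ℝ × ℝ | τ * q.1 < τ * p.1 + δ} := isOpen_lt (by fun_prop) (by fun_prop)
    have h2 : IsOpen {q : ℝ × ℝ | q.2 < H} := isOpen_lt (by fun_prop) (by fun_prop)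
    exact h1.inter h2
  have hpO : p ∈ O := ⟨⟨hp, hV.subset hp, hpM⟩, by linarith, hpH⟩
  set C := connectedComponentIn O p with hC
  have hCO : C ⊆ O := connectedComponentIn_subset _ _
  have hpC : p ∈ C := mem_connectedComponentIn hpO
  have hcl : ∀ q ∈ Ω, q ∈ closure C → q ∈ V ∨ f q = -M := by
    intro q hq hqC
    have h1 : f q ≤ -M := le_of_mem_closure_of_continuousOn D.isOpen hy
      (fun v hv => (hCO hv).1.2.2.le) hq hqC
    rcases h1.lt_or_eq with h1 | h1
    · exact Or.inl (hV.mem q hq (closure_mono (fun v hv => (hCO hv).1.1) hqC) (by linarith))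
    · exact Or.inr h1
  have hclx : ∀ q, q ∈ closure C → τ * q.1 ≤ τ * p.1 + δ := fun q hqC =>
    le_of_mem_closure_of_continuousOn isOpen_univ (g := fun q => τ * q.1) (by fun_prop)
      (fun v hv => (hCO hv).2.1.le) (Set.mem_univ q) hqC
  have hclt : ∀ q, q ∈ closure C → q.2 ≤ H := fun q hqC =>
    le_of_mem_closure_of_continuousOn isOpen_univ (g := fun q => q.2) (by fun_prop)
      (fun v hv => (hCO hv).2.2.le) (Set.mem_univ q) hqC
  by_contra hcon
  have hno : ∀ q ∈ Ω, q ∈ closure C → f q < -M → q.2 ≠ H := by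
    intro q hq hqC hqM hqH
    have hqV : q ∈ V := (hcl q hq hqC).resolve_right hqM.ne
    refine hcon ⟨q, hqV, hqH, hclx q hqC, ?_⟩
    refine joinedIn_of_mem_closure hOo hpO (N := V ∩ (Ω ∩ {q | f q < -M})) (H := H)
      (fun r hr => ⟨hr.1.1, hr.1.2.2, hr.2.2.le⟩) (fun r hr => hr.2.2.le) hqC
      (hV.isOpen.inter (hy.isOpen_inter_preimage D.isOpen isOpen_Iio)) ⟨hqV, hq, hqM⟩
      (fun r hr h => ⟨hr.1, hr.2.2, h⟩)
  let F : ℝ × ℝ → ℝ := fun q => -τ * q.1 + κ * q.2 - κ' * (f q ^ 2 - 2 * b * f q)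
  have hFv : ∀ q, F q = -(τ * q.1) + κ * q.2 - κ' * (f q - b) ^ 2 + κ' * b ^ 2 := fun q => by
    simp only [F]; ring
  have hbdry : ∀ q ∈ Ω, q ∈ closure C → q ∉ C → F q < F p := by
    intro q hq hqC hqn
    have hx := abs_le.mp (hτx q hq)
    have hpx := abs_le.mp (hτx p (hV.subset hp))
    have ht := hclt q hqC
    have ht2 : κ * q.2 ≤ κ * H := by gcongr
    rw [hFv, hFv]
    rcases hcl q hq hqC with hqV | hqM
    · by_cases hqM : f q = -M
      · rw [hqM]
        linarith
      · have hqM' : f q < -M := lt_of_le_of_ne (le_of_mem_closure_of_continuousOn D.isOpen hy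
          (fun v hv => (hCO hv).1.2.2.le) hq hqC) hqM
        have h5 : q.2 < H := lt_of_le_of_ne ht (hno q hq hqC hqM')
        have h6 : τ * q.1 = τ * p.1 + δ := le_antisymm (hclx q hqC) (not_lt.mp fun h =>
          hqn (mem_connectedComponentIn_of_mem_closure (O := O)
            (show q ∈ O from ⟨⟨hqV, hq, hqM'⟩, h, h5⟩) hqC))
        have h7 : 0 ≤ κ' * (f q - b) ^ 2 := by positivity
        linarith
    · rw [hqM]
      linarith
  set A := w + κ * |H| + κ' * b ^ 2 + |F p| with hA
  have hA0 : 0 ≤ A := by have := D.nonneg_width; positivity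
  have hbdd : ∀ r ∈ C, F p ≤ F r →
      |f r| ≤ (A / κ' + 1 + |b| + (A / κ + |H|)) / c ∧
      |z r| ≤ (A / κ' + 1 + |b| + (A / κ + |H|)) / c := by
    intro r hr h
    rw [hFv r] at h
    have hx := abs_le.mp (hτx r (hCO hr).1.2.1)
    have h1 := (hCO hr).2.2
    have h2 : κ * r.2 ≤ κ * |H| := by
      have := h1.le.trans (le_abs_self H)
      gcongr
    have h3 : κ' * (f r - b) ^ 2 ≤ A := by linarith [neg_abs_le (F p)]
    have h4 : |f r - b| ≤ A / κ' + 1 := by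
      have h5 : (f r - b) ^ 2 ≤ A / κ' := by rw [le_div_iff₀ hκ']; linarith
      rw [← sq_abs] at h5
      nlinarith [abs_nonneg (f r - b)]
    have h6 : |f r| ≤ |f r - b| + |b| := by
      have := abs_add_le (f r - b) b; simpa using this
    have h7 : -(A / κ) ≤ r.2 := by
      have h0 : 0 ≤ κ' * (f r - b) ^ 2 := by positivity
      have h9 : 0 ≤ κ * |H| := by positivity
      have h8 : -A ≤ κ * r.2 := by linarith [neg_abs_le (F p)]
      rw [← neg_div, div_le_iff₀ hκ0]
      linarith
    have hAκ : 0 ≤ A / κ := by positivity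
    have h8 : |r.2| ≤ A / κ + |H| :=
      abs_le.mpr ⟨by linarith [abs_nonneg H], by linarith [le_abs_self H]⟩
    obtain ⟨hc1, hσ1⟩ := D.abs_le_one
    rw [abs_of_pos hc] at hc1
    constructor
    · rw [le_div_iff₀ hc]
      have : |f r| * c ≤ |f r| * 1 := by gcongr
      linarith [abs_nonneg H]
    · rw [le_div_iff₀ hc]
      have e1 : z r * c = r.2 + σ * f r := by rw [D.snd_eq r]; ring
      rw [← abs_of_pos hc, ← abs_mul, e1]
      have h9 : |σ * f r| ≤ |f r| := by
        rw [abs_mul]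
        exact mul_le_of_le_one_left (abs_nonneg _) hσ1
      linarith [abs_add_le r.2 (σ * f r)]
  obtain ⟨q, hq, -, P, Y, Z, l, hYZ, -, -, -, hfin⟩ := D.barrier_quadratic
    hOo.connectedComponentIn (V := C) (fun q hq => (hCO hq).1.2.1) 0 (-τ) (-κ')
    (2 * κ' * b - κ * σ) 0 (κ * c) (F := F)
    (fun q => by simp only [F]; rw [D.snd_eq q]; ring) hpC hbdd hbdry
  nlinarith [sq_nonneg P, sq_nonneg Y, sq_nonneg Z]

/-- From a point of a piece one can descend in the `y` direction with controlled height. -/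
theorem exists_descend (D : SlabTranslator c σ w Ω u) (hc : 0 < c) {c₀ y₁ Z₁ : ℝ}
    {V : Set (ℝ × ℝ)} (hV : IsPiece Ω (ycoord c σ u) c₀ V) (hy₁ : y₁ < c₀)
    (hZ : ∀ q ∈ V, ycoord c σ u q = y₁ → -Z₁ ≤ zcoord c σ u q)
    {o : ℝ × ℝ} (ho : o ∈ V) (hoy : ycoord c σ u o < y₁) :
    ∃ C : ℝ, 0 ≤ C ∧ ∀ β : ℝ, 0 ≤ β → -β < ycoord c σ u o →
      ∃ q ∈ V, ycoord c σ u q = -β ∧ zcoord c σ u q ≤ C * (1 + β) ∧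
        JoinedIn (V ∩ {r | r.2 ≤ C * (1 + β)}) o q := by
  have hw := D.nonneg_width
  obtain ⟨C', hC', hlow⟩ := D.exists_zcoord_lower_bound hV hy₁ hZ hw
  have hy := D.continuousOn_ycoord
  have hzc := D.continuousOn_zcoord
  set f := ycoord c σ u with hf
  set z := zcoord c σ u with hz
  obtain ⟨lam, hlam, hlam2⟩ : ∃ lam : ℝ, 2 * w + 1 ≤ lam ∧
      w ^ 2 + Z₁ + z o < lam * (y₁ - f o) := by
    refine ⟨max (2 * w + 1) ((w ^ 2 + Z₁ + z o) / (y₁ - f o) + 1), le_max_left _ _, ?_⟩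
    have h1 : 0 < y₁ - f o := by linarith
    have h2 : (w ^ 2 + Z₁ + z o) / (y₁ - f o) <
      max (2 * w + 1) ((w ^ 2 + Z₁ + z o) / (y₁ - f o) + 1) :=
      (lt_add_one _).trans_le (le_max_right _ _)
    rwa [div_lt_iff₀ h1] at h2
  have hlam0 : 0 ≤ lam := by linarith
  refine ⟨w ^ 2 + lam + |z o| + lam * |f o| + 2 + |y₁|, by positivity, ?_⟩
  intro β hβ hβo
  set H := w ^ 2 + lam * β + |z o| + lam * |f o| + 1 with hH
  have hH0 : 0 ≤ H := by positivity
  have hHC : H + β + |y₁| ≤ (w ^ 2 + lam + |z o| + lam * |f o| + 2 + |y₁|) * (1 + β) := by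
    have h1 : 0 ≤ (w ^ 2 + |z o| + lam * |f o| + 1 + |y₁|) * β := by positivity
    nlinarith
  have hzoH : z o < H := by
    have : 0 ≤ w ^ 2 + lam * β + lam * |f o| := by positivity
    linarith [le_abs_self (z o)]
  set O : Set (ℝ × ℝ) := V ∩ (Ω ∩ {q | -β < f q ∧ f q < y₁ ∧ z q < H}) with hO
  have hOo : IsOpen O := by
    refine hV.isOpen.inter ?_
    have h1 := hy.isOpen_inter_preimage D.isOpen (isOpen_Ioo (a := -β) (b := y₁))
    have h3 := hzc.isOpen_inter_preimage D.isOpen (isOpen_Iio (a := H))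
    convert h1.inter h3 using 1
    ext q
    simp only [Set.mem_inter_iff, Set.mem_ofPred_eq, Set.mem_preimage, Set.mem_Ioo, Set.mem_Iio,
      hf, hz]
    tauto
  have hoO : o ∈ O := ⟨ho, hV.subset ho, hβo, hoy, hzoH⟩
  set C := connectedComponentIn O o with hC
  have hCO : C ⊆ O := connectedComponentIn_subset _ _
  have hoC : o ∈ C := mem_connectedComponentIn hoO
  obtain ⟨hc1, hσ1⟩ := D.abs_le_one
  rw [abs_of_pos hc] at hc1
  have hOt : ∀ r ∈ O, r.2 ≤ H + β + |y₁| := by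
    rintro r ⟨-, -, h1, h2, h3⟩
    rw [D.snd_eq r]
    have h4 : c * z r ≤ H := by
      rcases le_total (z r) 0 with h | h
      · nlinarith
      · nlinarith
    have h5 : |f r| ≤ β + |y₁| :=
      abs_le.mpr ⟨by linarith [abs_nonneg y₁], by linarith [le_abs_self y₁]⟩
    have h6 : |σ * f r| ≤ |f r| := by
      rw [abs_mul]
      exact mul_le_of_le_one_left (abs_nonneg _) hσ1
    linarith [neg_abs_le (σ * f r)]
  let F : ℝ × ℝ → ℝ := fun q => q.1 ^ 2 - z q - lam * f q
  have hFo : -z o - lam * f o ≤ F o := by simp only [F]; linarith [sq_nonneg o.1]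
  have hex : ∃ q ∈ Ω, q ∈ closure C ∧ f q = -β ∧ F o ≤ F q := by
    by_contra hcon
    push Not at hcon
    have hbdry : ∀ q ∈ Ω, q ∈ closure C → q ∉ C → F q < F o := by
      intro q hq hqC hqn
      have h1 : f q ≤ y₁ := le_of_mem_closure_of_continuousOn D.isOpen hy
        (fun v hv => (hCO hv).2.2.2.1.le) hq hqC
      have h2 : -β ≤ f q := ge_of_mem_closure_of_continuousOn D.isOpen hy
        (fun v hv => (hCO hv).2.2.1.le) hq hqC
      have h3 : z q ≤ H := le_of_mem_closure_of_continuousOn D.isOpen hzc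
        (fun v hv => (hCO hv).2.2.2.2.le) hq hqC
      have hqV : q ∈ V := hV.mem q hq (closure_mono (fun v hv => (hCO hv).1) hqC) (by linarith)
      have h4 := D.fst_sq_le hq
      rcases h2.lt_or_eq with h2 | h2
      · rcases h1.lt_or_eq with h1 | h1
        · rcases h3.lt_or_eq with h3 | h3
          · exact absurd (mem_connectedComponentIn_of_mem_closure (O := O)
              (show q ∈ O from ⟨hqV, hq, h2, h1, h3⟩) hqC) hqn
          · refine lt_of_lt_of_le ?_ hFo
            simp only [F]
            rw [h3]
            have h5 : lam * -f q ≤ lam * β := by gcongr; linarith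
            have h6 : lam * f o ≤ lam * |f o| := by gcongr; exact le_abs_self _
            linarith [le_abs_self (z o)]
        · refine lt_of_lt_of_le ?_ hFo
          have := hZ q hqV h1
          simp only [F]
          rw [h1]
          linarith
      · exact hcon q hq hqC h2.symm
    have hbdd : ∀ r ∈ C, F o ≤ F r → |f r| ≤ β + |y₁| + H + C' * (1 + (β + |y₁|)) ∧
        |z r| ≤ β + |y₁| + H + C' * (1 + (β + |y₁|)) := by
      intro r hr _
      obtain ⟨hrV, -, h1, h2, h3⟩ := hCO hr
      have h5 : |f r| ≤ β + |y₁| :=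
        abs_le.mpr ⟨by linarith [abs_nonneg y₁], by linarith [le_abs_self y₁]⟩
      have h6 := hlow r hrV h2.le
      have h7 : C' * (1 + |f r|) ≤ C' * (1 + (β + |y₁|)) := by gcongr
      have h8 : 0 ≤ C' * (1 + (β + |y₁|)) := by positivity
      exact ⟨by linarith, abs_le.mpr ⟨by linarith [abs_nonneg y₁], by linarith [abs_nonneg y₁]⟩⟩
    obtain ⟨q, hq, -, P, Y, Z, l, hYZ, hP, hl, hK, hfin⟩ := D.barrier_quadratic
      hOo.connectedComponentIn (V := C) (fun q hq => (hCO hq).2.1) 1 0 0 (-lam) 0 (-1) (F := F)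
      (fun q => by simp only [F]; ring) hoC hbdd hbdry
    have h1 := D.fst_sq_le (hCO hq).2.1
    have e1 : 4 * q.1 ^ 2 = l ^ 2 * P ^ 2 := by
      have : (2 * 1 * q.1 + 0) ^ 2 = (-l * P) ^ 2 := by rw [hP]
      linarith
    have e2 : 1 = l ^ 2 * Y ^ 2 := by
      have : (2 * 0 * z q + -1) ^ 2 = (-l * Y) ^ 2 := by rw [hK]
      linarith
    have e3 : lam ^ 2 = l ^ 2 * Z ^ 2 := by
      have : (2 * 0 * f q + -lam) ^ 2 = (l * Z) ^ 2 := by rw [hl]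
      linarith
    have h2 : l ^ 2 * (Y ^ 2 + Z ^ 2) ≤ l ^ 2 * P ^ 2 := by
      gcongr
      linarith
    nlinarith
  obtain ⟨q, hq, hqC, hqβ, hFq⟩ := hex
  have hqV : q ∈ V := hV.mem q hq (closure_mono (fun v hv => (hCO hv).1) hqC) (by linarith)
  refine ⟨q, hqV, hqβ, ?_, ?_⟩
  · have h4 := D.fst_sq_le hq
    have h5 : F q = q.1 ^ 2 - z q - lam * f q := rfl
    rw [hqβ] at h5
    have h6 : lam * f o ≤ lam * |f o| := by gcongr; exact le_abs_self _
    linarith [le_abs_self (z o), abs_nonneg y₁]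
  · exact joinedIn_of_mem_closure hOo hoO (H := H + β + |y₁|) (N := V)
      (fun r hr => ⟨hr.1, (hOt r hr).trans hHC⟩) hOt hqC hV.isOpen hqV
      (fun r hr h => ⟨hr, h.trans hHC⟩)

end SlabTranslator

namespace SlabTranslator

variable {c σ w : ℝ} {Ω : Set (ℝ × ℝ)} {u : ℝ × ℝ → ℝ}

/-- A piece reaches every large height `H` at two points whose `x` coordinates are at distance
at least `1 / 8`. -/
theorem exists_finger (D : SlabTranslator c σ w Ω u) (hc : 0 < c) {c₀ Z M : ℝ}
    {V : Set (ℝ × ℝ)} (hV : IsPiece Ω (ycoord c σ u) c₀ V) (hM : -M ≤ c₀)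
    (hZ : ∀ q ∈ V, |ycoord c σ u q - (c₀ - 5)| < 4 → -Z ≤ zcoord c σ u q)
    {o : ℝ × ℝ} (ho : o ∈ V) (hoy : ycoord c σ u o < c₀ - 2) :
    ∀ᶠ β : ℝ in Filter.atTop, ∃ l r : ℝ × ℝ, l.2 = c / (4096 * (w + 1)) * β ^ 2 ∧
      r.2 = c / (4096 * (w + 1)) * β ^ 2 ∧ l.1 + 1 / 8 ≤ r.1 ∧
      JoinedIn (V ∩ {q | q.2 ≤ c / (4096 * (w + 1)) * β ^ 2}) o l ∧
      JoinedIn (V ∩ {q | ycoord c σ u q < -M ∧ q.2 ≤ c / (4096 * (w + 1)) * β ^ 2}) l r := by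
  have hw := D.nonneg_width
  have hZ1 : ∀ q ∈ V, ycoord c σ u q = c₀ - 2 → -Z ≤ zcoord c σ u q := fun q hq h =>
    hZ q hq (by rw [h, show c₀ - 2 - (c₀ - 5) = 3 by ring]; norm_num)
  obtain ⟨C, hC, hdesc⟩ := D.exists_descend hc hV (by linarith) hZ1 ho hoy
  obtain ⟨C', hC', hlow⟩ := D.exists_zcoord_lower_bound hV (by linarith) hZ1 hw
  obtain ⟨hc1, hσ1⟩ := D.abs_le_one
  rw [abs_of_pos hc] at hc1
  set f := ycoord c σ u with hf
  set z := zcoord c σ u with hz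
  set η := c / (4096 * (w + 1)) with hη
  have hη0 : 0 < η := by positivity
  set K := C + 3 * C' + 3 with hK
  have hK0 : 0 ≤ K := by positivity
  set A := 16 * (w + 1) with hA
  have hA0 : 0 < A := by positivity
  filter_upwards [Filter.eventually_ge_atTop 1, Filter.eventually_gt_atTop (-f o),
    Filter.eventually_gt_atTop (4 - c₀), Filter.eventually_ge_atTop (2 * |M| + 2),
    Filter.eventually_ge_atTop (256 * A), Filter.eventually_gt_atTop (2 * K / η)]
    with β hβ1 hβo hβc hβM hβA hβK
  have hβ2 : 0 < β ^ 2 := by positivity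
  rw [div_lt_iff₀ hη0] at hβK
  have hKH : K * (1 + β) < η * β ^ 2 := by nlinarith
  obtain ⟨q0, hq0V, hq0f, hq0z, hq0j⟩ := hdesc β (by linarith) (by linarith)
  have hπ : π / 2 < 2 := by have := Real.pi_lt_four; linarith
  have hwideZ : ∀ q ∈ V, |f q - f q0| < π / 2 → -(C' * (3 + β)) ≤ z q := by
    intro q hq h
    rw [hq0f, abs_lt] at h
    have h1 := hlow q hq (by linarith [h.2])
    have h2 : |f q| ≤ β + 2 := abs_le.mpr ⟨by linarith [h.1], by linarith [h.2]⟩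
    have h3 : C' * (1 + |f q|) ≤ C' * (3 + β) := by
      gcongr ?_ * ?_
      linarith
    linarith
  obtain ⟨W, hWV, hWo, hWc, hq0W, hW, p₁, hp₁, p₂, hp₂, hp12⟩ :=
    D.exists_wide hV hq0V (by rw [← hf, hq0f]; linarith) hwideZ
  have hWt : ∀ q ∈ W, |q.2| ≤ K * (1 + β) := by
    intro q hq
    obtain ⟨h1, h2⟩ := hW q hq
    have h3 := hwideZ q (hWV hq) h1
    change |f q - f q0| < π / 2 at h1
    change z q < z q0 + 1 at h2
    rw [hq0f, abs_lt] at h1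
    rw [D.snd_eq q]
    have h4 : |z q| ≤ C * (1 + β) + 1 + C' * (3 + β) := by
      have e1 : 0 ≤ C * (1 + β) := by positivity
      have e2 : 0 ≤ C' * (3 + β) := by positivity
      exact abs_le.mpr ⟨by linarith, by linarith⟩
    have h5 : |f q| ≤ β + 2 := abs_le.mpr ⟨by linarith [h1.1], by linarith [h1.2]⟩
    have h6 : |σ * f q| ≤ |f q| := by
      rw [abs_mul]
      exact mul_le_of_le_one_left (abs_nonneg _) hσ1
    have h7 : |c * z q| ≤ |z q| := by
      rw [abs_mul, abs_of_pos hc]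
      exact mul_le_of_le_one_left (abs_nonneg _) hc1
    have h8 := abs_sub (c * z q) (σ * f q)
    have h9 : 0 ≤ C' * β := by positivity
    change |c * z q - σ * f q| ≤ K * (1 + β)
    rw [hK]
    linarith
  have hWM : ∀ q ∈ W, f q < -M := by
    intro q hq
    have h1 : |f q - f q0| < π / 2 := (hW q hq).1
    rw [hq0f, abs_lt] at h1
    linarith [h1.2, le_abs_self M, abs_nonneg M]
  have hWsub : W ⊆ V ∩ {q | f q < -M ∧ q.2 ≤ η * β ^ 2} := fun q hq =>
    ⟨hWV hq, hWM q hq, ((le_abs_self _).trans (hWt q hq)).trans hKH.le⟩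
  have hclimb : ∀ p ∈ W, ∀ τ : ℝ, τ ^ 2 = 1 → ∃ q ∈ V, q.2 = η * β ^ 2 ∧
      τ * q.1 ≤ τ * p.1 + 1 / 16 ∧ JoinedIn (V ∩ {r | f r < -M ∧ r.2 ≤ η * β ^ 2}) p q := by
    intro p hp τ hτ
    have h1 : |f p - f q0| < π / 2 := (hW p hp).1
    rw [hq0f, abs_lt] at h1
    have ht := abs_le.mp (hWt p hp)
    have e1 : 4 * A / (c * β ^ 2) * (η * β ^ 2 - p.2) ≤ 1 / 32 := by
      have : 4 * A / (c * β ^ 2) * (η * β ^ 2 - p.2) ≤ 4 * A / (c * β ^ 2) * (2 * (η * β ^ 2)) := by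
        gcongr
        linarith [ht.1]
      refine this.trans (le_of_eq ?_)
      rw [hη, hA]
      field_simp
      norm_num
    have e2 : A / β ^ 2 * (f p - -β) ^ 2 ≤ 1 / 64 := by
      have e3 : (f p - -β) ^ 2 ≤ 4 := by nlinarith
      have e4 : A / β ^ 2 ≤ 1 / 256 := by
        rw [div_le_iff₀ hβ2]
        nlinarith
      have : 0 ≤ A / β ^ 2 := by positivity
      nlinarith
    have e3 : 4 * (w + 1) ≤ A / β ^ 2 * (-M - -β) ^ 2 := by
      have e5 : β / 2 ≤ -M - -β := by linarith [le_abs_self M]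
      have e6 : (β / 2) ^ 2 ≤ (-M - -β) ^ 2 := by gcongr
      have e7 : A / β ^ 2 * (β / 2) ^ 2 ≤ A / β ^ 2 * (-M - -β) ^ 2 := by gcongr
      refine le_trans (le_of_eq ?_) e7
      rw [hA]
      field_simp
      norm_num
    refine D.exists_climb hc hV (hWV hp) (b := -β) (κ := 4 * A / (c * β ^ 2)) (κ' := A / β ^ 2)
      hτ hM (hWM p hp) (by linarith [ht.2]) (by positivity) ?_ (by norm_num) ?_ ?_
    · have : 4 * A / (c * β ^ 2) * c = 4 * (A / β ^ 2) := by field_simp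
      rw [this]
      have : 0 < A / β ^ 2 := by positivity
      linarith
    · change _ + A / β ^ 2 * (f p - -β) ^ 2 < _
      linarith
    · change 2 * w + _ + A / β ^ 2 * (f p - -β) ^ 2 < _
      linarith
  obtain ⟨l, hlV, hlH, hl1, hlj⟩ := hclimb p₁ hp₁ 1 (by norm_num)
  obtain ⟨r, hrV, hrH, hr1, hrj⟩ := hclimb p₂ hp₂ (-1) (by norm_num)
  have hj : ∀ a ∈ W, ∀ b ∈ W, JoinedIn (V ∩ {q | f q < -M ∧ q.2 ≤ η * β ^ 2}) a b :=
    fun a ha b hb => joinedIn_of_isOpen_isConnected hWo hWc hWsub ha hb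
  have hmono : V ∩ {q | f q < -M ∧ q.2 ≤ η * β ^ 2} ⊆ V ∩ {q | q.2 ≤ η * β ^ 2} :=
    fun q hq => ⟨hq.1, hq.2.2⟩
  refine ⟨l, r, hlH, hrH, by linarith, ?_, ?_⟩
  · have hsub : V ∩ {q | q.2 ≤ C * (1 + β)} ⊆ V ∩ {q | q.2 ≤ η * β ^ 2} := by
      rintro q ⟨hqV, h1⟩
      change q.2 ≤ C * (1 + β) at h1
      have h2 : 0 ≤ (3 * C' + 3) * (1 + β) := by positivity
      exact ⟨hqV, show q.2 ≤ η * β ^ 2 by linarith⟩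
    exact (hq0j.mono hsub).trans (((hj q0 hq0W p₁ hp₁).trans hlj).mono hmono)
  · exact (hlj.symm.trans (hj p₁ hp₁ p₂ hp₂)).trans hrj

end SlabTranslator

lemma exists_mem_of_joinedIn_of_interlaced {A B : Set (ℝ × ℝ)} {H : ℝ} {l₁ l₂ l₃ r₂ : ℝ × ℝ}
    (hA : ∀ q ∈ A, q.2 ≤ H) (hB : ∀ q ∈ B, q.2 ≤ H) (hp : JoinedIn A l₁ l₃)
    (hq : JoinedIn B l₂ r₂) (h₁ : l₁.2 = H) (h₂ : l₂.2 = H) (h₃ : l₃.2 = H) (h₄ : r₂.2 = H)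
    (h12 : l₁.1 < l₂.1) (h23 : l₂.1 < l₃.1) (h34 : l₃.1 < r₂.1) : (A ∩ B).Nonempty := by
  obtain ⟨γ, hγ⟩ := hp
  obtain ⟨ρ, hρ⟩ := hq
  have hγ' : ∀ v, γ.extend v ∈ A := fun v => hγ (Set.projIcc 0 1 zero_le_one v)
  have hρ' : ∀ v, ρ.extend v ∈ B := fun v => hρ (Set.projIcc 0 1 zero_le_one v)
  obtain ⟨a, b, hab⟩ := exists_crossing γ.continuous_extend ρ.continuous_extend
    (fun v => hA _ (hγ' v)) (fun v => hB _ (hρ' v)) (by simpa using h₁) (by simpa using h₃)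
    (by simpa using h₂) (by simpa using h₄) (by simpa using h12) (by simpa using h23)
    (by simpa using h34)
  exact ⟨γ.extend a, hγ' a, hab ▸ hρ' b⟩

namespace SlabTranslator

variable {c σ w : ℝ} {Ω : Set (ℝ × ℝ)} {u : ℝ × ℝ → ℝ}

lemma isOpen_sublevel (D : SlabTranslator c σ w Ω u) (a : ℝ) :
    IsOpen (Ω ∩ {q | ycoord c σ u q < a}) :=
  D.continuousOn_ycoord.isOpen_inter_preimage D.isOpen isOpen_Iio

lemma isPiece_connectedComponentIn (D : SlabTranslator c σ w Ω u) (a : ℝ) (p : ℝ × ℝ) :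
    IsPiece Ω (ycoord c σ u) a (connectedComponentIn (Ω ∩ {q | ycoord c σ u q < a}) p) where
  isOpen := (D.isOpen_sublevel a).connectedComponentIn
  subset := fun _ hq => (connectedComponentIn_subset _ _ hq).1
  lt := fun _ hq => (connectedComponentIn_subset _ _ hq).2
  mem := fun _ hq hcl h => mem_connectedComponentIn_of_mem_closure ⟨hq, h⟩ hcl

lemma exists_joinedIn_bounded (D : SlabTranslator c σ w Ω u) {p q : ℝ × ℝ} (hp : p ∈ Ω)
    (hq : q ∈ Ω) : ∃ M, JoinedIn (Ω ∩ {r | |ycoord c σ u r| ≤ M ∧ r.2 ≤ M}) p q := by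
  obtain ⟨γ, hγ⟩ := ((D.isOpen.isConnected_iff_isPathConnected).mp D.isConnected).joinedIn p hp q hq
  have hK : IsCompact (Set.range γ) := isCompact_range γ.continuous
  have hKΩ : Set.range γ ⊆ Ω := by rintro _ ⟨v, rfl⟩; exact hγ v
  obtain ⟨M₁, hM₁⟩ := hK.exists_bound_of_continuousOn (D.continuousOn_ycoord.mono hKΩ)
  obtain ⟨M₂, hM₂⟩ := hK.exists_bound_of_continuousOn (f := fun r : ℝ × ℝ => r.2) (by fun_prop)
  refine ⟨max M₁ M₂, γ, fun v => ⟨hγ v, ?_, ?_⟩⟩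
  · exact (hM₁ _ ⟨v, rfl⟩).trans (le_max_left _ _)
  · exact ((le_abs_self _).trans (hM₂ _ ⟨v, rfl⟩)).trans (le_max_right _ _)

/-- A piece on which `z` is not bounded below contains points with `z = 0`. -/
lemma exists_zcoord_eq_zero (D : SlabTranslator c σ w Ω u) {c₀ : ℝ} {V : Set (ℝ × ℝ)}
    (hV : IsPiece Ω (ycoord c σ u) c₀ V)
    (hZ : ¬ ∃ Z, ∀ q ∈ V, |ycoord c σ u q - (c₀ - 5)| < 4 → -Z ≤ zcoord c σ u q) :
    ∃ q ∈ V, |ycoord c σ u q - (c₀ - 5)| ≤ 4 ∧ zcoord c σ u q = 0 := by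
  have hy := D.continuousOn_ycoord
  have hz := D.continuousOn_zcoord
  by_contra hcon
  push Not at hcon hZ
  obtain ⟨q₀, hq₀, h₀, hz₀⟩ := hZ 0
  have hQo : IsOpen (V ∩ (Ω ∩ {q | |ycoord c σ u q - (c₀ - 5)| < 4 ∧ zcoord c σ u q < 0})) := by
    refine hV.isOpen.inter ?_
    have h1 := (hy.sub (continuousOn_const (c := c₀ - 5))).abs.isOpen_inter_preimage D.isOpen (isOpen_Iio (a := 4))
    have h2 := hz.isOpen_inter_preimage D.isOpen (isOpen_Iio (a := 0))
    convert h1.inter h2 using 1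
    ext q
    simp only [Set.mem_inter_iff, Set.mem_ofPred_eq, Set.mem_preimage, Set.mem_Iio]
    tauto
  refine D.false_of_zcoord_le hQo (fun q hq => hq.2.1) (ym := c₀ - 5) (T := 0)
    (fun q hq => hq.2.2.1) ⟨q₀, hq₀, hV.subset hq₀, h₀, by simpa using hz₀⟩
    (fun q hq => hq.2.2.2.le) ?_
  intro q hq hcl hqn
  have h1 : |ycoord c σ u q - (c₀ - 5)| ≤ 4 := le_of_mem_closure_of_continuousOn D.isOpen
    (hy.sub (continuousOn_const (c := c₀ - 5))).abs (fun v hv => hv.2.2.1.le) hq hcl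
  have h2 : zcoord c σ u q ≤ 0 := le_of_mem_closure_of_continuousOn D.isOpen hz
    (fun v hv => hv.2.2.2.le) hq hcl
  have hqV : q ∈ V := hV.mem q hq (closure_mono Set.inter_subset_left hcl)
    (by linarith [(abs_le.mp h1).2])
  have h3 : zcoord c σ u q < 0 := lt_of_le_of_ne h2 (hcon q hqV h1)
  by_contra h4
  exact hqn ⟨hqV, hq, lt_of_le_of_ne h1 h4, h3⟩

/-- The set of components of `{y < c₀}`. -/
def components (c σ : ℝ) (Ω : Set (ℝ × ℝ)) (u : ℝ × ℝ → ℝ) (c₀ : ℝ) : Set (Set (ℝ × ℝ)) :=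
  connectedComponentIn (Ω ∩ {q | ycoord c σ u q < c₀}) '' (Ω ∩ {q | ycoord c σ u q < c₀})

lemma eq_of_mem_components {c₀ : ℝ} {V W : Set (ℝ × ℝ)} (hV : V ∈ components c σ Ω u c₀)
    (hW : W ∈ components c σ Ω u c₀) {q : ℝ × ℝ} (h₁ : q ∈ V) (h₂ : q ∈ W) : V = W := by
  obtain ⟨a, -, rfl⟩ := hV
  obtain ⟨b, -, rfl⟩ := hW
  rw [connectedComponentIn_eq h₁, connectedComponentIn_eq h₂]

lemma finite_components_unbounded (D : SlabTranslator c σ w Ω u) (c₀ : ℝ) :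
    {V ∈ components c σ Ω u c₀ |
      ¬ ∃ Z, ∀ q ∈ V, |ycoord c σ u q - (c₀ - 5)| < 4 → -Z ≤ zcoord c σ u q}.Finite := by
  have hy := D.continuousOn_ycoord
  have hz := D.continuousOn_zcoord
  set O := Ω ∩ {q | ycoord c σ u q < c₀} with hO
  set K : Set (ℝ × ℝ) := {q | q ∈ Ω ∧ |ycoord c σ u q - (c₀ - 5)| ≤ 4 ∧ zcoord c σ u q = 0} with hK
  have hKO : K ⊆ O := fun q hq => ⟨hq.1, by
    have := (abs_le.mp hq.2.1).2
    exact (show ycoord c σ u q < c₀ by linarith)⟩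
  have hKc : IsCompact K := by
    set L : Set (ℝ × ℝ) :=
      {p | p ∈ Ω ∧ |ycoord c σ u p| ≤ |c₀| + 9 ∧ |zcoord c σ u p| ≤ |c₀| + 9} with hL
    have hLc : IsCompact L := D.cpt _
    have hLΩ : L ⊆ Ω := fun q hq => hq.1
    have h1 := ((hy.mono hLΩ).sub (continuousOn_const (c := c₀ - 5))).abs.preimage_isClosed_of_isClosed hLc.isClosed
      (isClosed_Iic (a := 4))
    have h2 := (hz.mono hLΩ).preimage_isClosed_of_isClosed hLc.isClosed
      (isClosed_singleton (x := 0))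
    have h3 := hLc.of_isClosed_subset (h1.inter h2) (fun q hq => hq.1.1)
    · convert h3 using 1
      ext q
      simp only [hK, hL, Set.mem_inter_iff, Set.mem_ofPred_eq, Set.mem_preimage, Set.mem_Iic,
        Set.mem_singleton_iff]
      constructor
      · rintro ⟨h1, h2, h3⟩
        have h4 : |ycoord c σ u q| ≤ |c₀| + 9 := by
          rw [abs_le] at h2 ⊢
          constructor <;> linarith [neg_abs_le c₀, le_abs_self c₀]
        have h5 : |zcoord c σ u q| ≤ |c₀| + 9 := by rw [h3, abs_zero]; positivity
        exact ⟨⟨⟨h1, h4, h5⟩, h2⟩, ⟨h1, h4, h5⟩, h3⟩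
      · rintro ⟨⟨⟨h1, -, -⟩, h2⟩, -, h3⟩
        exact ⟨h1, h2, h3⟩
  obtain ⟨t, ht⟩ := hKc.elim_nhds_subcover' (fun q _ => connectedComponentIn O q)
    (fun q hq => ((D.isOpen_sublevel c₀).connectedComponentIn).mem_nhds
      (mem_connectedComponentIn (hKO hq)))
  refine ((t.finite_toSet).image fun q : K => connectedComponentIn O (q : ℝ × ℝ)).subset ?_
  rintro V ⟨⟨p, hp, rfl⟩, hZ⟩
  obtain ⟨q, hqV, hq4, hq0⟩ := D.exists_zcoord_eq_zero (D.isPiece_connectedComponentIn c₀ p) hZ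
  have hqΩ := (connectedComponentIn_subset _ _ hqV).1
  have hq := ht (show q ∈ K from ⟨hqΩ, hq4, hq0⟩)
  simp only [Set.mem_iUnion] at hq
  obtain ⟨r, hr, hqr⟩ := hq
  exact ⟨r, hr, by
    change connectedComponentIn O r = connectedComponentIn O p
    rw [connectedComponentIn_eq hqr, connectedComponentIn_eq hqV]⟩

end SlabTranslator

namespace SlabTranslator

variable {c σ w : ℝ} {Ω : Set (ℝ × ℝ)} {u : ℝ × ℝ → ℝ}

lemma finite_components_bounded (D : SlabTranslator c σ w Ω u) (hc : 0 < c) (c₀ : ℝ) :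
    {V ∈ components c σ Ω u c₀ |
      ∃ Z, ∀ q ∈ V, |ycoord c σ u q - (c₀ - 5)| < 4 → -Z ≤ zcoord c σ u q}.Finite := by
  set 𝒱 := {V ∈ components c σ Ω u c₀ |
      ∃ Z, ∀ q ∈ V, |ycoord c σ u q - (c₀ - 5)| < 4 → -Z ≤ zcoord c σ u q} with h𝒱
  have hw := D.nonneg_width
  obtain ⟨p₀, hp₀⟩ := D.isConnected.nonempty
  by_contra hinf
  have hpiece : ∀ V ∈ 𝒱, IsPiece Ω (ycoord c σ u) c₀ V := by
    rintro _ ⟨⟨p, -, rfl⟩, -⟩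
    exact D.isPiece_connectedComponentIn c₀ p
  have hne : ∀ V ∈ 𝒱, V.Nonempty := by
    rintro _ ⟨⟨p, hp, rfl⟩, -⟩
    exact ⟨p, mem_connectedComponentIn hp⟩
  have hbase : ∀ V ∈ 𝒱, ∃ o ∈ V, ycoord c σ u o < c₀ - 2 := fun V hV =>
    D.exists_ycoord_lt (hpiece V hV) (hne V hV) _
  choose! o ho hoy using hbase
  have hpath : ∀ V ∈ 𝒱, ∃ M, JoinedIn (Ω ∩ {r | |ycoord c σ u r| ≤ M ∧ r.2 ≤ M}) (o V) p₀ :=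
    fun V hV => D.exists_joinedIn_bounded ((hpiece V hV).subset (ho V hV)) hp₀
  choose! m hm using hpath
  set I : Finset ℤ := Finset.Icc ⌊-(16 * w)⌋ ⌊16 * w⌋ with hI
  obtain ⟨s, hs𝒱, hscard⟩ := Set.Infinite.exists_subset_card_eq hinf (I.card * 2 + 1)
  obtain ⟨M, hM⟩ := (s.image m).exists_le
  have hM' : ∀ V ∈ s, m V ≤ M := fun V hV => hM _ (Finset.mem_image_of_mem m hV)
  set M' := max M (-c₀) with hM'def
  have hfinger : ∀ V ∈ s, ∀ᶠ β : ℝ in Filter.atTop, ∃ l r : ℝ × ℝ,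
      l.2 = c / (4096 * (w + 1)) * β ^ 2 ∧
      r.2 = c / (4096 * (w + 1)) * β ^ 2 ∧ l.1 + 1 / 8 ≤ r.1 ∧
      JoinedIn (V ∩ {q | q.2 ≤ c / (4096 * (w + 1)) * β ^ 2}) (o V) l ∧
      JoinedIn (V ∩ {q | ycoord c σ u q < -M' ∧ q.2 ≤ c / (4096 * (w + 1)) * β ^ 2}) l r := by
    intro V hV
    obtain ⟨Z, hZ⟩ := (hs𝒱 hV).2
    exact D.exists_finger hc (hpiece V (hs𝒱 hV)) (by linarith [le_max_right M (-c₀)]) hZ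
      (ho V (hs𝒱 hV)) (hoy V (hs𝒱 hV))
  have hη : 0 < c / (4096 * (w + 1)) := by positivity
  obtain ⟨β, hβ, hβ1, hβM⟩ := (((Filter.eventually_all_finset s).mpr hfinger).and
    ((Filter.eventually_ge_atTop 1).and
      (Filter.eventually_ge_atTop (M / (c / (4096 * (w + 1))))))).exists
  set H := c / (4096 * (w + 1)) * β ^ 2 with hH
  have hMH : M ≤ H := by
    rw [div_le_iff₀ hη] at hβM
    have : β ≤ β ^ 2 := by nlinarith
    rw [hH]
    nlinarith
  choose! l r hl hr hlr hol hlrj using hβ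
  have hlV : ∀ V ∈ s, l V ∈ V := fun V hV => (hlrj V hV).source_mem.1
  have hmaps : ∀ V ∈ s, ⌊16 * (l V).1⌋ ∈ I := by
    intro V hV
    have := abs_le.mp (D.slab _ ((hpiece V (hs𝒱 hV)).subset (hlV V hV)))
    rw [hI, Finset.mem_Icc]
    exact ⟨Int.floor_le_floor (by linarith), Int.floor_le_floor (by linarith)⟩
  obtain ⟨n, -, hn⟩ := Finset.exists_lt_card_fiber_of_mul_lt_card_of_maps_to hmaps
    (show I.card * 2 < s.card by omega)
  have hdisj : ∀ V ∈ s, ∀ W ∈ s, ∀ q ∈ V, q ∈ W → V = W := fun V hV W hW q h1 h2 =>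
    eq_of_mem_components (hs𝒱 hV).1 (hs𝒱 hW).1 h1 h2
  have key : ∀ V₁ ∈ s, ∀ V₂ ∈ s, ∀ V₃ ∈ s, ⌊16 * (l V₂).1⌋ = ⌊16 * (l V₃).1⌋ →
      (l V₁).1 < (l V₂).1 → (l V₂).1 < (l V₃).1 → False := by
    intro V₁ h₁ V₂ h₂ V₃ h₃ hfl h12 h23
    set N := Ω ∩ {q | |ycoord c σ u q| ≤ M ∧ q.2 ≤ H} with hN
    have hjN : ∀ V ∈ s, JoinedIn N (o V) p₀ := fun V hV => (hm V (hs𝒱 hV)).mono fun q hq =>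
      ⟨hq.1, hq.2.1.trans (hM' V hV), (hq.2.2.trans (hM' V hV)).trans hMH⟩
    have hjA : JoinedIn ((V₁ ∪ V₃) ∩ {q | q.2 ≤ H} ∪ N) (l V₁) (l V₃) := by
      have e1 := ((hol V₁ h₁).symm.mono
        (show V₁ ∩ {q | q.2 ≤ H} ⊆ (V₁ ∪ V₃) ∩ {q | q.2 ≤ H} ∪ N from
          fun q hq => Or.inl ⟨Or.inl hq.1, hq.2⟩))
      have e2 := ((hol V₃ h₃).mono
        (show V₃ ∩ {q | q.2 ≤ H} ⊆ (V₁ ∪ V₃) ∩ {q | q.2 ≤ H} ∪ N from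
          fun q hq => Or.inl ⟨Or.inr hq.1, hq.2⟩))
      exact (e1.trans ((hjN V₁ h₁).mono Set.subset_union_right)).trans
        (((hjN V₃ h₃).symm.mono Set.subset_union_right).trans e2)
    have h34 : (l V₃).1 < (r V₂).1 := by
      have e1 := Int.floor_le (16 * (l V₂).1)
      have e2 := Int.lt_floor_add_one (16 * (l V₃).1)
      rw [← hfl] at e2
      linarith [hlr V₂ h₂]
    have hAH : ∀ q ∈ (V₁ ∪ V₃) ∩ {q | q.2 ≤ H} ∪ N, q.2 ≤ H := by
      rintro q (hq | hq)
      exacts [hq.2, hq.2.2]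
    obtain ⟨q, hqA, hqV, hqM, -⟩ := exists_mem_of_joinedIn_of_interlaced hAH
      (fun q hq => hq.2.2) hjA (hlrj V₂ h₂) (hl V₁ h₁) (hl V₂ h₂) (hl V₃ h₃) (hr V₂ h₂) h12 h23 h34
    rcases hqA with ⟨hq | hq, -⟩ | hq
    · rw [hdisj V₁ h₁ V₂ h₂ q hq hqV] at h12
      exact lt_irrefl _ h12
    · rw [hdisj V₃ h₃ V₂ h₂ q hq hqV] at h23
      exact lt_irrefl _ h23
    · have e1 := (abs_le.mp hq.2.1).1
      linarith [le_max_left M (-c₀)]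
  have hne' : ∀ V ∈ s, ∀ W ∈ s, V ≠ W → (l V).1 ≠ (l W).1 := by
    intro V hV W hW hVW h
    have h' : l V = l W := Prod.ext h (by rw [hl V hV, hl W hW])
    exact hVW (hdisj V hV W hW (l V) (hlV V hV) (h' ▸ hlV W hW))
  obtain ⟨V₁, hV₁, V₂, hV₂, V₃, hV₃, h12, h13, h23⟩ := Finset.two_lt_card.mp hn
  rw [Finset.mem_filter] at hV₁ hV₂ hV₃
  obtain ⟨hV₁, f₁⟩ := hV₁
  obtain ⟨hV₂, f₂⟩ := hV₂
  obtain ⟨hV₃, f₃⟩ := hV₃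
  rcases (hne' _ hV₁ _ hV₂ h12).lt_or_gt with a | a <;>
    rcases (hne' _ hV₁ _ hV₃ h13).lt_or_gt with b | b <;>
    rcases (hne' _ hV₂ _ hV₃ h23).lt_or_gt with d | d
  · exact key _ hV₁ _ hV₂ _ hV₃ (f₂.trans f₃.symm) a d
  · exact key _ hV₁ _ hV₃ _ hV₂ (f₃.trans f₂.symm) b d
  · linarith
  · exact key _ hV₃ _ hV₁ _ hV₂ (f₁.trans f₂.symm) b a
  · exact key _ hV₂ _ hV₁ _ hV₃ (f₁.trans f₃.symm) a b
  · linarith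
  · exact key _ hV₂ _ hV₃ _ hV₁ (f₃.trans f₁.symm) d b
  · exact key _ hV₃ _ hV₂ _ hV₁ (f₂.trans f₁.symm) d a

/-- If `c > 0`, all sufficiently high sublevel sets of `y` are connected. -/
theorem exists_isConnected_sublevel_of_pos (D : SlabTranslator c σ w Ω u) (hc : 0 < c) :
    ∃ c₁ : ℝ, ∀ t, c₁ < t → IsConnected (Ω ∩ {q | ycoord c σ u q < t}) := by
  obtain ⟨p₀, hp₀⟩ := D.isConnected.nonempty
  set c₀ := ycoord c σ u p₀ + 1 with hc₀
  have hfin : (components c σ Ω u c₀).Finite := by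
    refine ((D.finite_components_unbounded c₀).union (D.finite_components_bounded hc c₀)).subset ?_
    intro V hV
    by_cases h : ∃ Z, ∀ q ∈ V, |ycoord c σ u q - (c₀ - 5)| < 4 → -Z ≤ zcoord c σ u q
    · exact Or.inr ⟨hV, h⟩
    · exact Or.inl ⟨hV, h⟩
  have hpath : ∀ V ∈ components c σ Ω u c₀, ∃ M, ∃ o ∈ V,
      JoinedIn (Ω ∩ {r | |ycoord c σ u r| ≤ M ∧ r.2 ≤ M}) o p₀ := by
    rintro _ ⟨p, hp, rfl⟩
    obtain ⟨M, hM⟩ := D.exists_joinedIn_bounded hp.1 hp₀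
    exact ⟨M, p, mem_connectedComponentIn hp, hM⟩
  choose! m o ho hm using hpath
  obtain ⟨M, hM⟩ := (hfin.image m).bddAbove
  refine ⟨max M c₀, fun t ht => ?_⟩
  have htM : M < t := (le_max_left _ _).trans_lt ht
  have htc : c₀ < t := (le_max_right _ _).trans_lt ht
  set O := Ω ∩ {q | ycoord c σ u q < t} with hO
  have hp₀O : p₀ ∈ O := ⟨hp₀, show ycoord c σ u p₀ < t by linarith⟩
  suffices h : O ⊆ connectedComponentIn O p₀ by
    rw [← h.antisymm' (connectedComponentIn_subset _ _)]
    exact isConnected_connectedComponentIn_iff.mpr hp₀O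
  intro p hp
  obtain ⟨q, hq, hqc⟩ := D.exists_ycoord_lt (D.isPiece_connectedComponentIn t p)
    ⟨p, mem_connectedComponentIn hp⟩ c₀
  have hqO := connectedComponentIn_subset _ _ hq
  set V := connectedComponentIn (Ω ∩ {q | ycoord c σ u q < c₀}) q with hV
  have hqV : q ∈ V := mem_connectedComponentIn ⟨hqO.1, hqc⟩
  have hVc : V ∈ components c σ Ω u c₀ := ⟨q, ⟨hqO.1, hqc⟩, rfl⟩
  have hVO : V ⊆ O := fun r hr => by
    have := connectedComponentIn_subset _ _ hr
    exact ⟨this.1, lt_trans this.2 htc⟩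
  have h1 : o V ∈ connectedComponentIn O p := by
    rw [connectedComponentIn_eq hq]
    exact isPreconnected_connectedComponentIn.subset_connectedComponentIn hqV hVO (ho V hVc)
  have h2 : JoinedIn O (o V) p₀ := (hm V hVc).mono fun r hr => ⟨hr.1, by
    have e1 := (le_abs_self _).trans hr.2.1
    have e2 := hM (Set.mem_image_of_mem m hVc)
    exact (show ycoord c σ u r < t by linarith)⟩
  have h3 : p₀ ∈ connectedComponentIn O (o V) := by
    obtain ⟨γ, hγ⟩ := h2
    refine (isPreconnected_range γ.continuous).subset_connectedComponentIn ⟨0, γ.source⟩ ?_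
      ⟨1, γ.target⟩
    rintro _ ⟨v, rfl⟩
    exact hγ v
  rw [← connectedComponentIn_eq h3, ← connectedComponentIn_eq h1]
  exact mem_connectedComponentIn hp

end SlabTranslator

namespace SlabTranslator

variable {c σ w : ℝ} {Ω : Set (ℝ × ℝ)} {u : ℝ × ℝ → ℝ}

set_option maxHeartbeats 600000 in
/-- A quadratic function cannot touch `y` from below if it is sufficiently convex in the
direction of its gradient. -/
lemma not_isLocalMax_quadratic (D : SlabTranslator c σ w Ω u) (hc : 0 < c) {p : ℝ × ℝ}
    (hp : p ∈ Ω) {n₁ n₂ ξ₀ η₀ A B ε : ℝ} (hn : n₁ ^ 2 + n₂ ^ 2 = 1) (hε : 0 < ε) (hε1 : ε ≤ 1)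
    (hA0 : 0 < A) (hB0 : 0 < B) (hA : (B + 2) * (1 + 41 / c ^ 2) < A)
    (hξ : A * |n₁ * p.1 + n₂ * p.2 - ξ₀| ≤ 1 / 2)
    (hη : B * |-n₂ * p.1 + n₁ * p.2 - η₀| ≤ 1) :
    ¬ IsLocalMax (fun q : ℝ × ℝ => ε * ((n₁ * q.1 + n₂ * q.2 - ξ₀) +
      A * (n₁ * q.1 + n₂ * q.2 - ξ₀) ^ 2 - B * (-n₂ * q.1 + n₁ * q.2 - η₀) ^ 2) -
        ycoord c σ u q) p := by
  intro hmax
  have hmax' : IsLocalMax (fun q : ℝ × ℝ =>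
      ((ε * A) * (n₁ * q.1 + n₂ * q.2 + 0 * u q) ^ 2 +
        (ε * (1 - 2 * A * ξ₀)) * (n₁ * q.1 + n₂ * q.2 + 0 * u q) + ε * (A * ξ₀ ^ 2 - ξ₀)) +
      ((-(ε * B)) * (-n₂ * q.1 + n₁ * q.2 + 0 * u q) ^ 2 +
        (2 * ε * B * η₀) * (-n₂ * q.1 + n₁ * q.2 + 0 * u q) + (-(ε * B * η₀ ^ 2))) +
      (0 * (0 * q.1 + -σ * q.2 + c * u q) ^ 2 + (-1) * (0 * q.1 + -σ * q.2 + c * u q) + 0)) p := by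
    convert hmax using 2 with q
    rw [ycoord]
    ring
  obtain ⟨P, Q, g, h, k, hg, hh, hk, e1, e2, e3⟩ := D.max_principle hp
    (hasJet_quadratic _ _ _ _) (hasJet_quadratic _ _ _ _) (hasJet_quadratic _ _ _ _) hmax'
  obtain rfl : k = -1 := by rw [hk]; ring
  set ξ := n₁ * p.1 + n₂ * p.2 - ξ₀ with hξd
  set η := -n₂ * p.1 + n₁ * p.2 - η₀ with hηd
  have hg' : g = ε * (1 + 2 * (A * ξ)) := by rw [hg, hξd]; ring
  have hh' : h = -(2 * ε * (B * η)) := by rw [hh, hηd]; ring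
  have hAξ : |A * ξ| ≤ 1 / 2 := by rw [abs_mul, abs_of_pos hA0]; exact hξ
  have hBη : |B * η| ≤ 1 := by rw [abs_mul, abs_of_pos hB0]; exact hη
  rw [abs_le] at hAξ hBη
  have hg2 : |g| ≤ 2 * ε := by
    rw [hg', abs_mul, abs_of_pos hε, mul_comm 2 ε]
    gcongr
    exact abs_le.mpr ⟨by linarith [hAξ.1], by linarith [hAξ.2]⟩
  have hh2 : |h| ≤ 2 * ε := by
    rw [hh', abs_neg, abs_mul, abs_of_pos (by positivity : 0 < 2 * ε)]
    exact mul_le_of_le_one_right (by positivity) (abs_le.mpr hBη)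
  have hn1 : |n₁| ≤ 1 := abs_le_of_sq_le_sq (by nlinarith [sq_nonneg n₂]) zero_le_one
  have hn2 : |n₂| ≤ 1 := abs_le_of_sq_le_sq (by nlinarith [sq_nonneg n₁]) zero_le_one
  have hσ1 := D.abs_le_one.2
  have hmul : ∀ {a b r : ℝ}, |a| ≤ r → |b| ≤ 1 → |a * b| ≤ r := fun {a b r} ha hb => by
    rw [abs_mul]
    exact (mul_le_of_le_one_right (abs_nonneg a) hb).trans ha
  have hcP : c * P = g * n₁ - h * n₂ := by linear_combination -e1
  have hcQ : c * Q = g * n₂ + h * n₁ + σ := by linear_combination -e2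
  have a1 := abs_le.mp (hmul hg2 hn1)
  have a2 := abs_le.mp (hmul hg2 hn2)
  have a3 := abs_le.mp (hmul hh2 hn1)
  have a4 := abs_le.mp (hmul hh2 hn2)
  have a5 := abs_le.mp hσ1
  have hcP2 : (c * P) ^ 2 ≤ 16 := by
    rw [hcP]
    have h1 : -4 ≤ g * n₁ - h * n₂ := by linarith
    have h2 : g * n₁ - h * n₂ ≤ 4 := by linarith
    exact (sq_le_sq' h1 h2).trans (by norm_num)
  have hcQ2 : (c * Q) ^ 2 ≤ 25 := by
    rw [hcQ]
    have h1 : -5 ≤ g * n₂ + h * n₁ + σ := by linarith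
    have h2 : g * n₂ + h * n₁ + σ ≤ 5 := by linarith
    exact (sq_le_sq' h1 h2).trans (by norm_num)
  have hK : 1 + P ^ 2 + Q ^ 2 ≤ 1 + 41 / c ^ 2 := by
    have : P ^ 2 + Q ^ 2 ≤ 41 / c ^ 2 := by
      rw [le_div_iff₀ (by positivity)]
      linarith
    linarith
  set W := 1 + P ^ 2 + Q ^ 2 with hW
  have hW0 : 0 < W := by positivity
  have hc1 : c ≤ 1 := (le_abs_self c).trans D.abs_le_one.1
  have e4 : 2 * (ε * A) * (1 + (n₁ * Q - n₂ * P) ^ 2) - 2 * (ε * B) * (1 + (n₁ * P + n₂ * Q) ^ 2) +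
      c * W * (g * n₂ + h * n₁) ≤ 0 := by
    have e5 : σ - Q * c = -(g * n₂ + h * n₁) := by linear_combination -hcQ
    rw [e5] at e3
    have q1 : (n₁ + 0 * P) ^ 2 + (n₂ + 0 * Q) ^ 2 + (n₁ * Q - n₂ * P) ^ 2 =
      1 + (n₁ * Q - n₂ * P) ^ 2 := by linear_combination hn
    have q2 : (-n₂ + 0 * P) ^ 2 + (n₁ + 0 * Q) ^ 2 + (-n₂ * Q - n₁ * P) ^ 2 =
      1 + (n₁ * P + n₂ * Q) ^ 2 := by linear_combination hn
    rw [q1, q2] at e3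
    linarith
  have e6 : 1 + (n₁ * P + n₂ * Q) ^ 2 ≤ W := by
    have : W - (1 + (n₁ * P + n₂ * Q) ^ 2) = (n₁ * Q - n₂ * P) ^ 2 := by
      rw [hW]; linear_combination (-(P ^ 2 + Q ^ 2)) * hn
    linarith [sq_nonneg (n₁ * Q - n₂ * P)]
  have e7 : -(4 * ε * W) ≤ c * W * (g * n₂ + h * n₁) := by
    have h1 : -(4 * ε) ≤ g * n₂ + h * n₁ := by linarith
    have h2 : c * W ≤ W := mul_le_of_le_one_left hW0.le hc1
    have h3 : c * W * -(4 * ε) ≤ c * W * (g * n₂ + h * n₁) :=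
      mul_le_mul_of_nonneg_left h1 (by positivity)
    have h4 : c * W * (4 * ε) ≤ W * (4 * ε) := by gcongr
    linarith
  have e8 : 2 * (ε * B) * (1 + (n₁ * P + n₂ * Q) ^ 2) ≤ 2 * (ε * B) * W := by gcongr
  have e9 : 2 * (ε * A) ≤ 2 * (ε * A) * (1 + (n₁ * Q - n₂ * P) ^ 2) := by
    have : 0 ≤ 2 * (ε * A) * (n₁ * Q - n₂ * P) ^ 2 := by positivity
    linarith
  have e10 : ε * ((B + 2) * W) < ε * A := by
    have : (B + 2) * W ≤ (B + 2) * (1 + 41 / c ^ 2) := by gcongr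
    exact mul_lt_mul_of_pos_left (this.trans_lt hA) hε
  linarith

end SlabTranslator

namespace SlabTranslator

variable {c σ w : ℝ} {Ω : Set (ℝ × ℝ)} {u : ℝ × ℝ → ℝ}

set_option maxHeartbeats 1600000 in
/-- Strong maximum principle for the coordinate `y`. -/
theorem eventually_eq_of_isLocalMin (D : SlabTranslator c σ w Ω u) (hc : 0 < c) {p : ℝ × ℝ}
    (hp : p ∈ Ω) (hmin : IsLocalMin (ycoord c σ u) p) :
    ∀ᶠ q in nhds p, ycoord c σ u q = ycoord c σ u p := by
  have hy := D.continuousOn_ycoord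
  set f := ycoord c σ u with hf
  set m := f p with hm
  obtain ⟨ρ₀, hρ₀, hball⟩ := Metric.nhds_basis_closedBall.mem_iff.mp
    (Filter.inter_mem (D.isOpen.mem_nhds hp) hmin)
  by_contra hne
  have hfreq : ∃ᶠ q in nhds p, f q ≠ m := Filter.not_eventually.mp hne
  obtain ⟨q, hqm, hqp⟩ := (hfreq.and_eventually (Metric.ball_mem_nhds p
    (by positivity : 0 < ρ₀ / 4))).exists
  have hmem : ∀ x : ℝ × ℝ, x ∈ Metric.closedBall p ρ₀ ↔ |x.1 - p.1| ≤ ρ₀ ∧ |x.2 - p.2| ≤ ρ₀ := by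
    intro x
    rw [Metric.mem_closedBall, Prod.dist_eq, max_le_iff, Real.dist_eq, Real.dist_eq]
  have hqp' : |q.1 - p.1| < ρ₀ / 4 ∧ |q.2 - p.2| < ρ₀ / 4 := by
    change dist q p < _ at hqp
    rwa [Prod.dist_eq, max_lt_iff, Real.dist_eq, Real.dist_eq] at hqp
  have hyB : ContinuousOn f (Metric.closedBall p ρ₀) := hy.mono fun x hx => (hball hx).1
  have hge : ∀ x ∈ Metric.closedBall p ρ₀, m ≤ f x := fun x hx => (hball hx).2
  set K := Metric.closedBall p ρ₀ ∩ f ⁻¹' {m} with hK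
  have hKc : IsCompact K := (isCompact_closedBall p ρ₀).of_isClosed_subset
    (hyB.preimage_isClosed_of_isClosed Metric.isClosed_closedBall isClosed_singleton)
    Set.inter_subset_left
  have hpK : p ∈ K := ⟨Metric.mem_closedBall_self hρ₀.le, rfl⟩
  let N : ℝ × ℝ → ℝ := fun x => (x.1 - q.1) ^ 2 + (x.2 - q.2) ^ 2
  obtain ⟨e, heK, hemin⟩ := hKc.exists_isMinOn (f := N) ⟨p, hpK⟩ (by fun_prop)
  have hNp : N p < ρ₀ ^ 2 / 8 := by
    have h1 : (p.1 - q.1) ^ 2 < (ρ₀ / 4) ^ 2 := by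
      rw [sq_lt_sq, abs_sub_comm, abs_of_pos (by positivity : 0 < ρ₀ / 4)]; exact hqp'.1
    have h2 : (p.2 - q.2) ^ 2 < (ρ₀ / 4) ^ 2 := by
      rw [sq_lt_sq, abs_sub_comm, abs_of_pos (by positivity : 0 < ρ₀ / 4)]; exact hqp'.2
    simp only [N]
    linarith
  have hNe : N e < ρ₀ ^ 2 / 8 := lt_of_le_of_lt (hemin hpK) hNp
  have heq : |e.1 - q.1| < ρ₀ / 2 ∧ |e.2 - q.2| < ρ₀ / 2 := by
    simp only [N] at hNe
    constructor <;> refine abs_lt_of_sq_lt_sq ?_ (by positivity) <;>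
      linarith [sq_nonneg (e.1 - q.1), sq_nonneg (e.2 - q.2)]
  have hinside : ∀ x : ℝ × ℝ, N x < N e → x ∈ Metric.closedBall p ρ₀ → m < f x := by
    intro x hx hxB
    refine lt_of_le_of_ne (hge x hxB) fun h => ?_
    exact absurd (hemin (show x ∈ K from ⟨hxB, h.symm⟩)) (not_le.mpr hx)
  have hNpos : 0 < N e := by
    refine lt_of_le_of_ne (by positivity) fun h => hqm ?_
    have h1 : (e.1 - q.1) ^ 2 = 0 := by
      simp only [N] at h; linarith [sq_nonneg (e.1 - q.1), sq_nonneg (e.2 - q.2)]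
    have h2 : (e.2 - q.2) ^ 2 = 0 := by
      simp only [N] at h; linarith [sq_nonneg (e.1 - q.1), sq_nonneg (e.2 - q.2)]
    have h3 : e = q := Prod.ext (by linarith [pow_eq_zero_iff (two_ne_zero) |>.mp h1])
      (by linarith [pow_eq_zero_iff (two_ne_zero) |>.mp h2])
    rw [← h3]
    exact heK.2
  set R := √(N e) with hR
  have hR0 : 0 < R := Real.sqrt_pos.mpr hNpos
  have hR2 : R ^ 2 = N e := Real.sq_sqrt hNpos.le
  set n₁ := (q.1 - e.1) / R with hn₁
  set n₂ := (q.2 - e.2) / R with hn₂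
  have hRn₁ : R * n₁ = q.1 - e.1 := by rw [hn₁]; field_simp
  have hRn₂ : R * n₂ = q.2 - e.2 := by rw [hn₂]; field_simp
  have hn : n₁ ^ 2 + n₂ ^ 2 = 1 := by
    have : R ^ 2 * (n₁ ^ 2 + n₂ ^ 2) = R ^ 2 * 1 := by
      rw [show R ^ 2 * (n₁ ^ 2 + n₂ ^ 2) = (R * n₁) ^ 2 + (R * n₂) ^ 2 by ring, hRn₁, hRn₂,
        mul_one, hR2]
      simp only [N]
      ring
    exact mul_left_cancel₀ (by positivity) this
  have hn1 : |n₁| ≤ 1 := abs_le_of_sq_le_sq (by nlinarith [sq_nonneg n₂]) zero_le_one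
  have hn2 : |n₂| ≤ 1 := abs_le_of_sq_le_sq (by nlinarith [sq_nonneg n₁]) zero_le_one
  set ξ₀ := n₁ * e.1 + n₂ * e.2 with hξ₀
  set η₀ := -n₂ * e.1 + n₁ * e.2 with hη₀
  let ξ : ℝ × ℝ → ℝ := fun x => n₁ * x.1 + n₂ * x.2 - ξ₀
  let η : ℝ × ℝ → ℝ := fun x => -n₂ * x.1 + n₁ * x.2 - η₀
  have hNξ : ∀ x, N x = ξ x ^ 2 + η x ^ 2 - 2 * R * ξ x + R ^ 2 := by
    intro x
    have e1 : x.1 - q.1 = (x.1 - e.1) - R * n₁ := by rw [hRn₁]; ring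
    have e2 : x.2 - q.2 = (x.2 - e.2) - R * n₂ := by rw [hRn₂]; ring
    simp only [N, ξ, η, hξ₀, hη₀]
    rw [e1, e2]
    linear_combination (R ^ 2 - (x.1 - e.1) ^ 2 - (x.2 - e.2) ^ 2) * hn
  set B := 2 / R with hB
  have hB0 : 0 < B := by positivity
  set A := (B + 2) * (1 + 41 / c ^ 2) + 1 with hA
  have hA0 : 0 < A := by positivity
  obtain ⟨ρ, hρ, hρ1, hρA, hρB, hρR⟩ : ∃ ρ : ℝ, 0 < ρ ∧ ρ ≤ ρ₀ / 4 ∧ A * (2 * ρ) ≤ 1 / 2 ∧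
      B * (2 * ρ) ≤ 1 ∧ 2 * ρ < R := by
    refine ⟨min (min (ρ₀ / 4) (R / 4)) (min (1 / (4 * A)) (1 / (2 * B))), by positivity, ?_, ?_,
      ?_, ?_⟩
    · exact (min_le_left _ _).trans (min_le_left _ _)
    · have : min (min (ρ₀ / 4) (R / 4)) (min (1 / (4 * A)) (1 / (2 * B))) ≤ 1 / (4 * A) :=
        (min_le_right _ _).trans (min_le_left _ _)
      rw [le_div_iff₀ (by positivity)] at this
      linarith
    · have : min (min (ρ₀ / 4) (R / 4)) (min (1 / (4 * A)) (1 / (2 * B))) ≤ 1 / (2 * B) :=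
        (min_le_right _ _).trans (min_le_right _ _)
      rw [le_div_iff₀ (by positivity)] at this
      linarith
    · have : min (min (ρ₀ / 4) (R / 4)) (min (1 / (4 * A)) (1 / (2 * B))) ≤ R / 4 :=
        (min_le_left _ _).trans (min_le_right _ _)
      linarith
  have hnear : ∀ x ∈ Metric.closedBall e ρ, |ξ x| ≤ 2 * ρ ∧ |η x| ≤ 2 * ρ ∧
      x ∈ Metric.closedBall p ρ₀ := by
    intro x hx
    rw [Metric.mem_closedBall, Prod.dist_eq, max_le_iff, Real.dist_eq, Real.dist_eq] at hx
    have hmul : ∀ {a b : ℝ}, |a| ≤ 1 → |b| ≤ ρ → |a * b| ≤ ρ := fun {a b} ha hb => by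
      rw [abs_mul]
      exact (mul_le_of_le_one_left (abs_nonneg b) ha).trans hb
    have a1 := abs_le.mp (hmul hn1 hx.1)
    have a2 := abs_le.mp (hmul hn2 hx.1)
    have a3 := abs_le.mp (hmul hn1 hx.2)
    have a4 := abs_le.mp (hmul hn2 hx.2)
    have e1 : ξ x = n₁ * (x.1 - e.1) + n₂ * (x.2 - e.2) := by simp only [ξ, hξ₀]; ring
    have e2 : η x = n₁ * (x.2 - e.2) - n₂ * (x.1 - e.1) := by simp only [η, hη₀]; ring
    refine ⟨?_, ?_, ?_⟩
    · rw [e1, abs_le]; constructor <;> linarith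
    · rw [e2, abs_le]; constructor <;> linarith
    · rw [hmem]
      have h1 := abs_le.mp hx.1
      have h2 := abs_le.mp hx.2
      have h3 := abs_lt.mp heq.1
      have h4 := abs_lt.mp heq.2
      have h5 := abs_lt.mp hqp'.1
      have h6 := abs_lt.mp hqp'.2
      constructor <;> rw [abs_le] <;> constructor <;> linarith
  let v : ℝ × ℝ → ℝ := fun x => ξ x + A * ξ x ^ 2 - B * η x ^ 2
  have hvc : Continuous v := by fun_prop
  have hpos : ∀ x ∈ Metric.closedBall e ρ, x ≠ e → 0 ≤ v x → m < f x := by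
    intro x hx hxe hv
    obtain ⟨h1, h2, h3⟩ := hnear x hx
    have hAξ : |A * ξ x| ≤ 1 / 2 := by
      rw [abs_mul, abs_of_pos hA0]
      exact (mul_le_mul_of_nonneg_left h1 hA0.le).trans hρA
    have hBη : 0 ≤ B * η x ^ 2 := by positivity
    have hv' : B * η x ^ 2 ≤ ξ x * (1 + A * ξ x) := by simp only [v] at hv; linarith
    have hAξ' := abs_le.mp hAξ
    have hξ0 : 0 ≤ ξ x := by
      by_contra hlt
      push Not at hlt
      have := mul_neg_of_neg_of_pos hlt (by linarith : 0 < 1 + A * ξ x)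
      linarith
    have hηξ : B * η x ^ 2 ≤ ξ x * (3 / 2) := hv'.trans (by gcongr; linarith)
    have hηξ' : η x ^ 2 ≤ 3 / 4 * R * ξ x := by
      have : B * η x ^ 2 * R = 2 * η x ^ 2 := by rw [hB]; field_simp
      have := mul_le_mul_of_nonneg_right hηξ hR0.le
      linarith
    rcases hξ0.lt_or_eq with hξ0 | hξ0
    · refine hinside x ?_ h3
      rw [hNξ x, ← hR2]
      have h4 : ξ x < R := (le_abs_self _).trans_lt (h1.trans_lt hρR)
      have h5 : ξ x * ξ x < R * ξ x := mul_lt_mul_of_pos_right h4 hξ0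
      have h6 : 0 < R * ξ x := by positivity
      rw [sq (ξ x)]
      linarith
    · exfalso
      apply hxe
      rw [← hξ0] at hηξ'
      have hη0 : η x = 0 := by
        have : η x ^ 2 = 0 := le_antisymm (by linarith) (sq_nonneg _)
        exact pow_eq_zero_iff two_ne_zero |>.mp this
      have e1 : ξ x = n₁ * (x.1 - e.1) + n₂ * (x.2 - e.2) := by simp only [ξ, hξ₀]; ring
      have e2 : η x = n₁ * (x.2 - e.2) - n₂ * (x.1 - e.1) := by simp only [η, hη₀]; ring
      rw [← hξ0] at e1
      rw [hη0] at e2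
      refine Prod.ext ?_ ?_
      · linear_combination (-n₁) * e1 + n₂ * e2 - (x.1 - e.1) * hn
      · linear_combination (-n₂) * e1 - n₁ * e2 - (x.2 - e.2) * hn
  have hsph : IsCompact (Metric.sphere e ρ ∩ {x | 0 ≤ v x}) :=
    (isCompact_sphere e ρ).inter_right (isClosed_le continuous_const hvc)
  have hsphB : Metric.sphere e ρ ⊆ Metric.closedBall e ρ := Metric.sphere_subset_closedBall
  have hne_of_sph : ∀ x ∈ Metric.sphere e ρ, x ≠ e := fun x hx h => by
    rw [h, Metric.mem_sphere, dist_self] at hx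
    exact hρ.ne hx
  obtain ⟨μ, hμ, hμle⟩ : ∃ μ : ℝ, 0 < μ ∧ ∀ x ∈ Metric.sphere e ρ ∩ {x | 0 ≤ v x}, m + μ ≤ f x := by
    rcases (Metric.sphere e ρ ∩ {x | 0 ≤ v x}).eq_empty_or_nonempty with h | h
    · exact ⟨1, one_pos, fun x hx => absurd hx (by rw [h]; simp)⟩
    · obtain ⟨y, hyS, hymin⟩ := hsph.exists_isMinOn h
        (hyB.mono fun x hx => (hnear x (hsphB hx.1)).2.2)
      refine ⟨f y - m, sub_pos.mpr (hpos y (hsphB hyS.1) (hne_of_sph y hyS.1) hyS.2), ?_⟩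
      intro x hx
      have := hymin hx
      change f y ≤ f x at this
      linarith
  obtain ⟨ε, hε, hε1, hεμ⟩ : ∃ ε : ℝ, 0 < ε ∧ ε ≤ 1 ∧ ε * (2 * ρ + A * (2 * ρ) ^ 2) < μ := by
    refine ⟨min 1 (μ / (2 * ρ + A * (2 * ρ) ^ 2 + 1)), by positivity, min_le_left _ _, ?_⟩
    have h1 : min 1 (μ / (2 * ρ + A * (2 * ρ) ^ 2 + 1)) ≤ μ / (2 * ρ + A * (2 * ρ) ^ 2 + 1) :=
      min_le_right _ _
    have h2 : 0 < min 1 (μ / (2 * ρ + A * (2 * ρ) ^ 2 + 1)) := by positivity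
    rw [le_div_iff₀ (by positivity)] at h1
    linarith
  have hφc : ContinuousOn (fun x => ε * v x - f x) (Metric.closedBall e ρ) :=
    (continuousOn_const.mul hvc.continuousOn).sub (hyB.mono fun x hx => (hnear x hx).2.2)
  obtain ⟨y, hyB', hymax⟩ := (isCompact_closedBall e ρ).exists_isMaxOn
    ⟨e, Metric.mem_closedBall_self hρ.le⟩ hφc
  have hve : v e = 0 := by simp only [v, ξ, η, hξ₀, hη₀]; ring
  have hyle : -m ≤ ε * v y - f y := by
    have h1 := hymax (Metric.mem_closedBall_self hρ.le)
    change ε * v e - f e ≤ ε * v y - f y at h1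
    have h2 : f e = m := heK.2
    rw [hve, h2] at h1
    linarith
  obtain ⟨hy1, hy2, hy3⟩ := hnear y hyB'
  have hyball : y ∈ Metric.ball e ρ := by
    by_contra hyn
    have hyS : y ∈ Metric.sphere e ρ := by
      rw [Metric.mem_sphere]
      exact le_antisymm hyB' (not_lt.mp hyn)
    rcases le_or_gt 0 (v y) with hv | hv
    · have h1 := hμle y ⟨hyS, hv⟩
      have h2 : v y ≤ 2 * ρ + A * (2 * ρ) ^ 2 := by
        have h3 : ξ y ^ 2 ≤ (2 * ρ) ^ 2 := sq_le_sq' (abs_le.mp hy1).1 (abs_le.mp hy1).2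
        have h4 : A * ξ y ^ 2 ≤ A * (2 * ρ) ^ 2 := by gcongr
        have h5 : 0 ≤ B * η y ^ 2 := by positivity
        simp only [v]
        linarith [(abs_le.mp hy1).2]
      have h3 : ε * v y ≤ ε * (2 * ρ + A * (2 * ρ) ^ 2) := by gcongr
      linarith
    · have h1 := hge y hy3
      have h2 : ε * v y < 0 := mul_neg_of_pos_of_neg hε hv
      linarith
  refine D.not_isLocalMax_quadratic hc (hball hy3).1 (ξ₀ := ξ₀) (η₀ := η₀) hn hε hε1 hA0 hB0
    (lt_add_one _) ?_ ?_ ?_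
  · exact (mul_le_mul_of_nonneg_left hy1 hA0.le).trans hρA
  · exact (mul_le_mul_of_nonneg_left hy2 hB0.le).trans hρB
  · exact hymax.isLocalMax (Metric.closedBall_mem_nhds_of_mem hyball)

end SlabTranslator

namespace SlabTranslator

variable {c σ w : ℝ} {Ω : Set (ℝ × ℝ)} {u : ℝ × ℝ → ℝ}

/-- The part of a bounded closed set on which `|u| ≤ M` is compact. -/
lemma isCompact_inter_abs_le (D : SlabTranslator c σ w Ω u) {F : Set (ℝ × ℝ)} (hF : IsCompact F)
    (M : ℝ) : IsCompact (F ∩ {q | q ∈ Ω ∧ |u q| ≤ M}) := by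
  obtain ⟨R, hR⟩ := hF.isBounded.exists_norm_le
  have hK := D.cpt (|c| * M + |σ| * R + |c| * R + |σ| * M)
  have hsub : F ∩ {q | q ∈ Ω ∧ |u q| ≤ M} ⊆ {p | p ∈ Ω ∧
      |ycoord c σ u p| ≤ |c| * M + |σ| * R + |c| * R + |σ| * M ∧
      |zcoord c σ u p| ≤ |c| * M + |σ| * R + |c| * R + |σ| * M} := by
    rintro q ⟨hqF, hqΩ, hqu⟩
    have h2 : |q.2| ≤ R := (norm_snd_le q).trans (hR q hqF)
    have hM : 0 ≤ M := (abs_nonneg _).trans hqu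
    have hR0 : 0 ≤ R := (abs_nonneg _).trans h2
    have a1 : |c * u q| ≤ |c| * M := by rw [abs_mul]; gcongr
    have a2 : |σ * q.2| ≤ |σ| * R := by rw [abs_mul]; gcongr
    have a3 : |c * q.2| ≤ |c| * R := by rw [abs_mul]; gcongr
    have a4 : |σ * u q| ≤ |σ| * M := by rw [abs_mul]; gcongr
    have b1 : 0 ≤ |c| * M := by positivity
    have b2 : 0 ≤ |σ| * R := by positivity
    have b3 : 0 ≤ |c| * R := by positivity
    have b4 : 0 ≤ |σ| * M := by positivity
    refine ⟨hqΩ, ?_, ?_⟩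
    · exact (abs_sub _ _).trans (by linarith)
    · exact (abs_add_le _ _).trans (by linarith)
  have hcl : ContinuousOn (fun q => |u q|) {p | p ∈ Ω ∧
      |ycoord c σ u p| ≤ |c| * M + |σ| * R + |c| * R + |σ| * M ∧
      |zcoord c σ u p| ≤ |c| * M + |σ| * R + |c| * R + |σ| * M} :=
    (D.cont.mono fun q hq => hq.1).abs
  have := (hK.of_isClosed_subset (hcl.preimage_isClosed_of_isClosed hK.isClosed
    (isClosed_Iic (a := M))) Set.inter_subset_left).inter_left hF.isClosed
  convert this using 1
  ext q
  constructor
  · intro hq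
    exact ⟨hq.1, hsub hq, hq.2.2⟩
  · intro hq
    exact ⟨hq.1, hq.2.1.1, hq.2.2⟩

/-- The comparison function `s ^ 2 + (t - t₀) ^ 2 - (u - a) ^ 2 / 4` has no local maximum at a
point where `|u - a| < 1` and `c * (t - t₀) ≥ 0`. -/
lemma not_isLocalMax_hyperboloid (D : SlabTranslator c σ w Ω u) {p : ℝ × ℝ} (hp : p ∈ Ω)
    {t₀ a : ℝ} (hu : |u p - a| ≤ 1) (ht : 0 ≤ c * (p.2 - t₀)) :
    ¬ IsLocalMax (fun q : ℝ × ℝ => q.1 ^ 2 + (q.2 - t₀) ^ 2 - (u q - a) ^ 2 / 4) p := by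
  intro hmax
  have hmax' : IsLocalMax (fun q : ℝ × ℝ =>
      (1 * (1 * q.1 + 0 * q.2 + 0 * u q) ^ 2 + 0 * (1 * q.1 + 0 * q.2 + 0 * u q) + 0) +
      (1 * (0 * q.1 + 1 * q.2 + 0 * u q) ^ 2 + (-(2 * t₀)) * (0 * q.1 + 1 * q.2 + 0 * u q) +
        t₀ ^ 2) +
      ((-(1 / 4)) * (0 * q.1 + 0 * q.2 + 1 * u q) ^ 2 + (a / 2) * (0 * q.1 + 0 * q.2 + 1 * u q) +
        (-(a ^ 2 / 4)))) p := by
    convert hmax using 2 with q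
    ring
  obtain ⟨P, Q, g, h, k, hg, hh, hk, e1, e2, e3⟩ := D.max_principle hp
    (hasJet_quadratic _ _ _ _) (hasJet_quadratic _ _ _ _) (hasJet_quadratic _ _ _ _) hmax'
  have hk' : k = -((u p - a) / 2) := by rw [hk]; ring
  have hh' : h = 2 * (p.2 - t₀) := by rw [hh]; ring
  have e2' : k * Q = -h := by linarith
  have hσ := D.unit
  have hσ1 : |σ| ≤ 1 := abs_le_of_sq_le_sq (by nlinarith [sq_nonneg c]) zero_le_one
  have hkσ : |k * σ| ≤ 1 / 2 := by
    rw [hk', abs_mul, abs_neg, abs_div, abs_two]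
    have := mul_le_mul hu hσ1 (abs_nonneg σ) zero_le_one
    linarith
  have hS : 0 ≤ P ^ 2 + Q ^ 2 := by positivity
  have h1 : k * (σ - Q * c) = k * σ + 2 * (c * (p.2 - t₀)) := by
    linear_combination (-c) * e2' + c * hh'
  have h2 : -(1 / 2) ≤ k * (σ - Q * c) := by
    rw [h1]; linarith [(abs_le.mp hkσ).1]
  have h3 : (1 + P ^ 2 + Q ^ 2) * (-(1 / 2)) ≤ (1 + P ^ 2 + Q ^ 2) * (k * (σ - Q * c)) := by
    gcongr
  have h4 : (g * 0 + h * 0 + k * 1) * ((1 + P ^ 2 + Q ^ 2) * (σ - Q * c)) =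
    (1 + P ^ 2 + Q ^ 2) * (k * (σ - Q * c)) := by ring
  rw [h4] at e3
  nlinarith

/-- The complement of the domain cannot have a point which is, locally, farthest away from a
centre lying on the appropriate side. -/
theorem false_of_farthest (D : SlabTranslator c σ w Ω u) {G : Set (ℝ × ℝ)} (hGo : IsOpen G)
    (hGb : Bornology.IsBounded G) {t₀ : ℝ} (hsign : ∀ q ∈ G, 0 ≤ c * (q.2 - t₀)) {z : ℝ × ℝ}
    (hzG : z ∈ G) (hz : z ∉ Ω)
    (hle : ∀ q ∈ closure G, q ∉ Ω → q.1 ^ 2 + (q.2 - t₀) ^ 2 ≤ z.1 ^ 2 + (z.2 - t₀) ^ 2)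
    (hlt : ∀ q ∈ frontier G, q ∉ Ω → q.1 ^ 2 + (q.2 - t₀) ^ 2 < z.1 ^ 2 + (z.2 - t₀) ^ 2) :
    False := by
  set m : ℝ × ℝ → ℝ := fun q => q.1 ^ 2 + (q.2 - t₀) ^ 2 with hm
  have hmc : Continuous m := by fun_prop
  have hGc : IsCompact (closure G) := hGb.isCompact_closure
  have key : ∀ n : ℕ, ∃ q ∈ closure G, q ∈ Ω ∧ (n : ℝ) ≤ |u q| ∧ m z ≤ m q ∧
      (q ∈ frontier G ∨ m z + 1 / 4 ≤ m q) := by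
    intro n
    have hC := D.isCompact_inter_abs_le hGc (n + 1)
    have hopen : G ∩ (closure G ∩ {q | q ∈ Ω ∧ |u q| ≤ n + 1})ᶜ ∈ nhds z :=
      Filter.inter_mem (hGo.mem_nhds hzG) (hC.isClosed.isOpen_compl.mem_nhds fun h => hz h.2.1)
    obtain ⟨p, hpO, hpm⟩ : ∃ p ∈ G ∩ (closure G ∩ {q | q ∈ Ω ∧ |u q| ≤ n + 1})ᶜ, m z < m p := by
      obtain ⟨ε, hε, hball⟩ := Metric.mem_nhds_iff.mp hopen
      rcases le_total 0 z.1 with h0 | h0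
      · refine ⟨(z.1 + ε / 2, z.2), hball ?_, ?_⟩
        · rw [Metric.mem_ball, Prod.dist_eq, max_lt_iff, Real.dist_eq, Real.dist_eq]
          simp only [add_sub_cancel_left, sub_self, abs_zero]
          exact ⟨by rw [abs_of_pos (by positivity)]; linarith, hε⟩
        · simp only [hm]
          nlinarith
      · refine ⟨(z.1 - ε / 2, z.2), hball ?_, ?_⟩
        · rw [Metric.mem_ball, Prod.dist_eq, max_lt_iff, Real.dist_eq, Real.dist_eq]
          simp only [sub_sub_cancel_left, sub_self, abs_zero]
          exact ⟨by rw [abs_neg, abs_of_pos (by positivity)]; linarith, hε⟩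
        · simp only [hm]
          nlinarith
    have hpG : p ∈ closure G := subset_closure hpO.1
    have hpΩ : p ∈ Ω := by
      by_contra h
      exact absurd (hle p hpG h) (not_le.mpr hpm)
    have hpu : (n : ℝ) + 1 < |u p| := by
      by_contra h
      exact hpO.2 ⟨hpG, hpΩ, not_lt.mp h⟩
    set K := closure G ∩ {q | q ∈ Ω ∧ |u q - u p| ≤ 1} with hK
    have hKc : IsCompact K := by
      have hC' := D.isCompact_inter_abs_le hGc (|u p| + 1)
      have hcont : ContinuousOn (fun q => |u q - u p|)
          (closure G ∩ {q | q ∈ Ω ∧ |u q| ≤ |u p| + 1}) :=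
        ((D.cont.mono fun q hq => hq.2.1).sub continuousOn_const).abs
      have := hC'.of_isClosed_subset (hcont.preimage_isClosed_of_isClosed hC'.isClosed
        (isClosed_Iic (a := (1 : ℝ)))) Set.inter_subset_left
      convert this using 1
      ext q
      constructor
      · intro hq
        refine ⟨⟨hq.1, hq.2.1, ?_⟩, hq.2.2⟩
        have := abs_sub_abs_le_abs_sub (u q) (u p)
        have := hq.2.2
        linarith
      · intro hq
        exact ⟨hq.1.1, hq.1.2.1, hq.2⟩
    have hFc : ContinuousOn (fun q : ℝ × ℝ => q.1 ^ 2 + (q.2 - t₀) ^ 2 - (u q - u p) ^ 2 / 4) K :=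
      hmc.continuousOn.sub ((((D.cont.mono fun q hq => hq.2.1).sub continuousOn_const).pow 2).div_const 4)
    obtain ⟨q, hqK, hqmax⟩ := hKc.exists_isMaxOn ⟨p, hpG, hpΩ, by simp⟩ hFc
    have hqp : m p ≤ m q - (u q - u p) ^ 2 / 4 := by
      have h1 := hqmax (show p ∈ K from ⟨hpG, hpΩ, by simp⟩)
      change m p - (u p - u p) ^ 2 / 4 ≤ m q - (u q - u p) ^ 2 / 4 at h1
      simpa using h1
    have hqm : m z ≤ m q := by linarith [sq_nonneg (u q - u p)]
    refine ⟨q, hqK.1, hqK.2.1, ?_, hqm, ?_⟩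
    · have h1 := abs_sub_abs_le_abs_sub (u p) (u q)
      rw [abs_sub_comm] at h1
      have h2 := hqK.2.2
      linarith
    · by_contra hcon
      push Not at hcon
      have hqG : q ∈ G := by
        by_contra h
        exact hcon.1 (by rw [hGo.frontier_eq]; exact ⟨hqK.1, h⟩)
      have hqu : |u q - u p| < 1 := by
        refine lt_of_le_of_ne hqK.2.2 fun h => ?_
        have h1 : (u q - u p) ^ 2 = 1 := by rw [← sq_abs, h, one_pow]
        rw [h1] at hqp
        linarith [hcon.2]
      refine D.not_isLocalMax_hyperboloid hqK.2.1 hqK.2.2 (hsign q hqG) (hqmax.isLocalMax ?_)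
      have hat : ContinuousAt (fun x => |u x - u p|) q :=
        ((D.cont.continuousAt (D.isOpen.mem_nhds hqK.2.1)).sub continuousAt_const).abs
      filter_upwards [hGo.mem_nhds hqG, D.isOpen.mem_nhds hqK.2.1,
        hat.eventually_lt continuousAt_const hqu] with x h1 h2 h3
      exact ⟨subset_closure h1, h2, h3.le⟩
  choose q hqG hqΩ hqu hqm hqor using key
  obtain ⟨a, haG, φ, hφ, hlim⟩ := hGc.tendsto_subseq hqG
  have haΩ : a ∉ Ω := by
    intro h
    have h1 : Filter.Tendsto (fun n => |u (q (φ n))|) Filter.atTop (nhds |u a|) :=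
      ((D.cont.continuousAt (D.isOpen.mem_nhds h)).abs.tendsto).comp hlim
    have h2 : Filter.Tendsto (fun n => ((φ n : ℕ) : ℝ)) Filter.atTop Filter.atTop :=
      tendsto_natCast_atTop_atTop.comp hφ.tendsto_atTop
    exact not_tendsto_nhds_of_tendsto_atTop
      (Filter.tendsto_atTop_mono (fun n => hqu (φ n)) h2) _ h1
  have ham : m z ≤ m a :=
    ge_of_tendsto ((hmc.tendsto a).comp hlim) (Filter.Eventually.of_forall fun n => hqm (φ n))
  have hcl : IsClosed (frontier G ∪ {q | m z + 1 / 4 ≤ m q}) :=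
    isClosed_frontier.union (isClosed_le continuous_const hmc)
  rcases hcl.mem_of_tendsto hlim (Filter.Eventually.of_forall fun n => hqor (φ n)) with h | h
  · exact absurd (hlt a h haΩ) (not_lt.mpr ham)
  · have h1 := hle a haG haΩ
    have h2 : m z + 1 / 4 ≤ m a := h
    change m a ≤ m z at h1
    linarith

theorem noIslands (D : SlabTranslator c σ w Ω u) : NoIslands Ω := by
  intro O hO hZ
  by_contra hne
  have hne' : (Ωᶜ ∩ O).Nonempty := Set.nonempty_iff_ne_empty.mpr hne
  obtain ⟨δ, hδ, hsub⟩ := hZ.exists_cthickening_subset_open hO Set.inter_subset_right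
  have hGb : Bornology.IsBounded (Metric.thickening δ (Ωᶜ ∩ O)) := hZ.isBounded.thickening
  obtain ⟨R, hR⟩ := hGb.exists_norm_le
  obtain ⟨t₀, ht₀⟩ : ∃ t₀ : ℝ, ∀ q ∈ Metric.thickening δ (Ωᶜ ∩ O), 0 ≤ c * (q.2 - t₀) := by
    rcases le_total 0 c with h | h
    · refine ⟨-R, fun q hq => mul_nonneg h ?_⟩
      have := abs_le.mp ((norm_snd_le q).trans (hR q hq))
      linarith
    · refine ⟨R, fun q hq => mul_nonneg_of_nonpos_of_nonpos h ?_⟩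
      have := abs_le.mp ((norm_snd_le q).trans (hR q hq))
      linarith
  obtain ⟨z, hzZ, hzmax⟩ := hZ.exists_isMaxOn hne'
    (f := fun q : ℝ × ℝ => q.1 ^ 2 + (q.2 - t₀) ^ 2) (by fun_prop)
  have hcl : ∀ q ∈ closure (Metric.thickening δ (Ωᶜ ∩ O)), q ∉ Ω → q ∈ Ωᶜ ∩ O := fun q hq hqΩ =>
    ⟨hqΩ, hsub (Metric.closure_thickening_subset_cthickening _ _ hq)⟩
  refine D.false_of_farthest Metric.isOpen_thickening hGb ht₀
    (Metric.self_subset_thickening hδ _ hzZ) hzZ.1 (fun q hq hqΩ => hzmax (hcl q hq hqΩ)) ?_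
  intro q hq hqΩ
  rw [Metric.isOpen_thickening.frontier_eq] at hq
  exact absurd (Metric.self_subset_thickening hδ _ (hcl q hq.1 hqΩ)) hq.2

end SlabTranslator

lemma HasCircleLifts.exists_continuousOn {X : Set (ℝ × ℝ)} (hX : HasCircleLifts X)
    {g : ℝ × ℝ → Circle} (hg : ContinuousOn g X) :
    ∃ k : ℝ × ℝ → ℝ, ContinuousOn k X ∧ ∀ x ∈ X, Circle.exp (k x) = g x := by
  classical
  obtain ⟨h, hc, hh⟩ := hX (fun x : X => g x) (continuousOn_iff_continuous_domRestrict.mp hg)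
  refine ⟨fun x => if hx : x ∈ X then h ⟨x, hx⟩ else 0, ?_, ?_⟩
  · rw [continuousOn_iff_continuous_domRestrict]
    convert hc using 1
    ext x
    simp
  · intro x hx
    simp only [hx, dite_true]
    exact hh ⟨x, hx⟩

namespace SlabTranslator

variable {σ w : ℝ} {Ω : Set (ℝ × ℝ)} {u : ℝ × ℝ → ℝ}

/-- In a vertical strip, the part of the complement of the domain lying above a level has no
compact islands. -/
lemma noIslands_compl_closure (D : SlabTranslator 0 σ w Ω u) (b : ℝ) :
    NoIslands (closure (Ωᶜ ∩ {q : ℝ × ℝ | b < -σ * q.2}))ᶜ := by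
  intro O hO hZ
  rw [compl_compl] at hZ ⊢
  set Z := closure (Ωᶜ ∩ {q : ℝ × ℝ | b < -σ * q.2}) ∩ O with hZdef
  by_contra hne
  obtain ⟨e₁, he₁, he₁O⟩ := Set.nonempty_iff_ne_empty.mpr hne
  obtain ⟨e, heO, heΩ, heb⟩ := mem_closure_iff.mp he₁ O hO he₁O
  change b < -σ * e.2 at heb
  have hσ : σ ^ 2 = 1 := by have := D.unit; linarith
  have heZ : e ∈ Z := ⟨subset_closure ⟨heΩ, heb⟩, heO⟩
  obtain ⟨δ, hδ, hsub⟩ := hZ.exists_cthickening_subset_open hO Set.inter_subset_right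
  obtain ⟨b', hb', heb'⟩ := exists_between heb
  have hGb : Bornology.IsBounded (Metric.thickening δ Z) := hZ.isBounded.thickening
  set G := Metric.thickening δ Z ∩ {q : ℝ × ℝ | b' < -σ * q.2} with hG
  have hGo : IsOpen G := Metric.isOpen_thickening.inter (isOpen_lt (by fun_prop) (by fun_prop))
  have hGcl : closure G ⊆ Metric.cthickening δ Z ∩ {q : ℝ × ℝ | b' ≤ -σ * q.2} :=
    closure_minimal (fun q hq => ⟨Metric.thickening_subset_cthickening _ _ hq.1,
        show b' ≤ -σ * q.2 from le_of_lt hq.2⟩)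
      (Metric.isClosed_cthickening.inter (isClosed_le (by fun_prop) (by fun_prop)))
  have hmemZ : ∀ q ∈ closure G, q ∉ Ω → q ∈ Z := fun q hq hqΩ =>
    ⟨subset_closure ⟨hqΩ, hb'.trans_le (hGcl hq).2⟩, hsub (hGcl hq).1⟩
  have hmemG : ∀ q ∈ closure G, q ∉ Ω → b' < -σ * q.2 → q ∈ G := fun q hq hqΩ h =>
    ⟨Metric.self_subset_thickening hδ _ (hmemZ q hq hqΩ), h⟩
  obtain ⟨R, hR⟩ := hZ.isBounded.exists_norm_le
  set d := -σ * e.2 - b' with hd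
  have hd0 : 0 < d := sub_pos.mpr heb'
  set T := R ^ 2 / d with hT
  have hT0 : 0 ≤ T := by positivity
  have hTd : T * d = R ^ 2 := by rw [hT]; field_simp
  set t₀ := -σ * (b' - T) with ht₀
  have hsq : ∀ q : ℝ × ℝ, (q.2 - t₀) ^ 2 = (-σ * q.2 - b' + T) ^ 2 := by
    intro q
    rw [ht₀]
    linear_combination (-(q.2) ^ 2 + (b' - T) ^ 2) * hσ
  have heG : e ∈ G := ⟨Metric.self_subset_thickening hδ _ heZ, heb'⟩
  have hcpt : IsCompact (closure G ∩ Ωᶜ) :=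
    (hGb.subset Set.inter_subset_left).isCompact_closure.inter_right D.isOpen.isClosed_compl
  obtain ⟨z, hz, hzmax⟩ := hcpt.exists_isMaxOn ⟨e, subset_closure heG, heΩ⟩
    (f := fun q : ℝ × ℝ => q.1 ^ 2 + (q.2 - t₀) ^ 2) (by fun_prop)
  have hzmax' : ∀ q ∈ closure G, q ∉ Ω →
      q.1 ^ 2 + (q.2 - t₀) ^ 2 ≤ z.1 ^ 2 + (z.2 - t₀) ^ 2 := fun q hq hqΩ => hzmax ⟨hq, hqΩ⟩
  have hlow : ∀ q ∈ closure G, q ∉ Ω → q ∉ G →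
      q.1 ^ 2 + (q.2 - t₀) ^ 2 < z.1 ^ 2 + (z.2 - t₀) ^ 2 := by
    intro q hq hqΩ hqG
    refine lt_of_lt_of_le ?_ (hzmax' e (subset_closure heG) heΩ)
    have h1 : -σ * q.2 - b' = 0 := by
      have h2 : b' ≤ -σ * q.2 := (hGcl hq).2
      have h3 : ¬ b' < -σ * q.2 := fun h => hqG (hmemG q hq hqΩ h)
      linarith
    have h2 : q.1 ^ 2 ≤ R ^ 2 := by
      have := abs_le.mp ((norm_fst_le q).trans (hR q (hmemZ q hq hqΩ)))
      exact sq_le_sq' this.1 this.2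
    rw [hsq q, hsq e, h1, ← hd]
    have h3 : 0 ≤ R ^ 2 := sq_nonneg R
    have h4 : 0 < d ^ 2 := by positivity
    linarith [sq_nonneg e.1, show (d + T) ^ 2 = d ^ 2 + 2 * (T * d) + T ^ 2 by ring,
      show (0 + T) ^ 2 = T ^ 2 by ring]
  have hzG : z ∈ G := by
    by_contra h
    exact lt_irrefl _ (hlow z hz.1 hz.2 h)
  refine D.false_of_farthest hGo (hGb.subset Set.inter_subset_left) (t₀ := t₀)
    (fun q _ => by simp) hzG hz.2 hzmax' ?_
  intro q hq hqΩ
  rw [hGo.frontier_eq] at hq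
  exact hlow q hq.1 hqΩ hq.2

theorem isConnected_sublevel_of_zero (D : SlabTranslator 0 σ w Ω u) {a : ℝ} {p₀ : ℝ × ℝ}
    (hp₀ : p₀ ∈ Ω) (hp₀a : ycoord 0 σ u p₀ < a) :
    IsConnected (Ω ∩ {q | ycoord 0 σ u q < a}) := by
  classical
  have hyc : ∀ q : ℝ × ℝ, ycoord 0 σ u q = -σ * q.2 := fun q => by rw [ycoord]; ring
  have hσ : σ ^ 2 = 1 := by have := D.unit; linarith
  refine ⟨⟨p₀, hp₀, hp₀a⟩, ?_⟩
  set O := Ω ∩ {q | ycoord 0 σ u q < a} with hO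
  have hOo : IsOpen O := D.isOpen_sublevel a
  set V := connectedComponentIn O p₀ with hV
  have hVo : IsOpen V := hOo.connectedComponentIn
  suffices hVO : O ⊆ V from
    (hVO.antisymm (connectedComponentIn_subset _ _)) ▸ isPreconnected_connectedComponentIn
  intro p₁ hp₁
  by_contra hp₁V
  set W := connectedComponentIn O p₁ with hW
  have hdisj : ∀ q ∈ W, q ∉ V := by
    intro q hqW hqV
    apply hp₁V
    rw [hV, connectedComponentIn_eq hqV, ← connectedComponentIn_eq hqW]
    exact mem_connectedComponentIn hp₁
  obtain ⟨q₀, hq₀V, hq₀⟩ := D.exists_ycoord_lt (D.isPiece_connectedComponentIn a p₀)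
    ⟨p₀, mem_connectedComponentIn (show p₀ ∈ O from ⟨hp₀, hp₀a⟩)⟩ (a - 3)
  obtain ⟨q₁, hq₁W, hq₁⟩ := D.exists_ycoord_lt (D.isPiece_connectedComponentIn a p₁)
    ⟨p₁, mem_connectedComponentIn hp₁⟩ (a - 3)
  have hq₀O := connectedComponentIn_subset _ _ hq₀V
  have hq₁O := connectedComponentIn_subset _ _ hq₁W
  set b := a - 3 with hb
  set H := {q : ℝ × ℝ | -σ * q.2 < b} with hH
  set X := (closure (Ωᶜ ∩ {q : ℝ × ℝ | b < -σ * q.2}))ᶜ with hX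
  have hXo : IsOpen X := isClosed_closure.isOpen_compl
  have hΩX : Ω ⊆ X := by
    intro q hq hcl
    obtain ⟨x, hx, hx'⟩ := mem_closure_iff.mp hcl Ω D.isOpen hq
    exact hx'.1 hx
  have hHX : H ⊆ X := by
    intro q hq hcl
    obtain ⟨x, hx, hx'⟩ := mem_closure_iff.mp hcl H (isOpen_lt (by fun_prop) (by fun_prop)) hq
    exact lt_asymm (show -σ * x.2 < b from hx) hx'.2
  have hXle : ∀ q ∈ X, q ∉ Ω → -σ * q.2 ≤ b := by
    intro q hq hqΩ
    by_contra h
    exact hq (subset_closure ⟨hqΩ, not_le.mp h⟩)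
  have hHp : IsPreconnected H := by
    refine Convex.isPreconnected ?_
    have : IsLinearMap ℝ (fun q : ℝ × ℝ => -σ * q.2) :=
      ⟨fun x y => by simp; ring, fun r x => by simp; ring⟩
    exact convex_halfSpace_lt this b
  have hq₀H : q₀ ∈ H := by rw [hyc] at hq₀; exact hq₀
  have hq₁H : q₁ ∈ H := by rw [hyc] at hq₁; exact hq₁
  have hXc : IsConnected X := by
    have h1 : IsConnected (Ω ∪ H) :=
      ⟨⟨q₀, Or.inr hq₀H⟩, D.isConnected.isPreconnected.union q₀ hq₀O.1 hq₀H hHp⟩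
    refine h1.subset_closure (Set.union_subset hΩX hHX) ?_
    intro q hq
    by_cases hqΩ : q ∈ Ω
    · exact subset_closure (Or.inl hqΩ)
    · have hqb := hXle q hq hqΩ
      refine closure_mono Set.subset_union_right (Metric.mem_closure_iff.mpr fun ε hε => ?_)
      refine ⟨(q.1, q.2 + σ * (ε / 2)), ?_, ?_⟩
      · change -σ * (q.2 + σ * (ε / 2)) < b
        have : -σ * (q.2 + σ * (ε / 2)) = -σ * q.2 - σ ^ 2 * (ε / 2) := by ring
        rw [this, hσ]
        linarith
      · have hσ1 : |σ| = 1 := by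
          rw [← Real.sqrt_sq_eq_abs, hσ, Real.sqrt_one]
        rw [Prod.dist_eq, max_lt_iff, dist_self]
        refine ⟨hε, ?_⟩
        rw [Real.dist_eq, sub_add_cancel_left, abs_neg, abs_mul, hσ1, one_mul,
          abs_of_pos (by positivity)]
        linarith
  have hlift := hasCircleLifts_of_noIslands hXo hXc (D.noIslands_compl_closure b)
  let χ : ℝ × ℝ → ℝ := fun q => max 0 (min 1 (a - 1 - -σ * q.2))
  have hχc : Continuous χ := by fun_prop
  have hχ0 : ∀ q : ℝ × ℝ, a - 1 ≤ -σ * q.2 → χ q = 0 := fun q hq =>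
    max_eq_left ((min_le_right _ _).trans (by linarith))
  have hχ1 : ∀ q : ℝ × ℝ, -σ * q.2 ≤ a - 2 → χ q = 1 := fun q hq => by
    simp only [χ]
    rw [min_eq_left (by linarith), max_eq_right zero_le_one]
  let h : ℝ × ℝ → ℝ := fun q => if q ∈ V then π * χ q else -(π * χ q)
  have hhc : ContinuousOn h Ω := by
    intro q hq
    refine ContinuousAt.continuousWithinAt ?_
    rcases lt_or_ge (-σ * q.2) a with hqa | hqa
    · have hqO : q ∈ O := ⟨hq, by change ycoord 0 σ u q < a; rwa [hyc]⟩
      by_cases hqV : q ∈ V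
      · refine ContinuousAt.congr (f := fun q => π * χ q) (by fun_prop) ?_
        filter_upwards [hVo.mem_nhds hqV] with x hx
        exact (if_pos hx).symm
      · refine ContinuousAt.congr (f := fun q => -(π * χ q)) (by fun_prop) ?_
        filter_upwards [(hOo.connectedComponentIn (x := q)).mem_nhds
          (mem_connectedComponentIn hqO)] with x hx
        refine (if_neg fun hxV => hqV ?_).symm
        rw [hV, connectedComponentIn_eq hxV, ← connectedComponentIn_eq hx]
        exact mem_connectedComponentIn hqO
    · refine ContinuousAt.congr (f := fun _ => (0 : ℝ)) continuousAt_const ?_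
      have : {x : ℝ × ℝ | a - 1 < -σ * x.2} ∈ nhds q :=
        (isOpen_lt (by fun_prop) (by fun_prop)).mem_nhds (by change a - 1 < -σ * q.2; linarith)
      filter_upwards [this] with x hx
      have : χ x = 0 := hχ0 x (le_of_lt hx)
      simp only [h, this]
      split_ifs <;> simp
  have hh1 : ∀ q : ℝ × ℝ, -σ * q.2 ≤ a - 2 → Circle.exp (h q) = Circle.exp π := by
    intro q hq
    simp only [h, hχ1 q hq, mul_one]
    split_ifs
    · rfl
    · exact circle_exp_pi_eq_neg_pi.symm
  let g : ℝ × ℝ → Circle := fun q => if q ∈ Ω then Circle.exp (h q) else Circle.exp π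
  have hg1 : ∀ q : ℝ × ℝ, -σ * q.2 ≤ a - 2 → g q = Circle.exp π := by
    intro q hq
    simp only [g, hh1 q hq]
    split_ifs <;> rfl
  have hgc : ContinuousOn g X := by
    intro q hq
    refine ContinuousAt.continuousWithinAt ?_
    by_cases hqΩ : q ∈ Ω
    · refine ContinuousAt.congr (f := fun q => Circle.exp (h q))
        (Circle.exp.continuous.continuousAt.comp (hhc.continuousAt (D.isOpen.mem_nhds hqΩ))) ?_
      filter_upwards [D.isOpen.mem_nhds hqΩ] with x hx
      exact (if_pos hx).symm
    · refine ContinuousAt.congr (f := fun _ => Circle.exp π) continuousAt_const ?_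
      have : {x : ℝ × ℝ | -σ * x.2 < a - 2} ∈ nhds q :=
        (isOpen_lt (by fun_prop) (by fun_prop)).mem_nhds
          (by change -σ * q.2 < a - 2; linarith [hXle q hq hqΩ])
      filter_upwards [this] with x hx
      exact (hg1 x (le_of_lt hx)).symm
  obtain ⟨k, hkc, hk⟩ := hlift.exists_continuousOn hgc
  have e1 := sub_eq_of_circle_exp_eq D.isConnected.isPreconnected (hkc.mono hΩX) hhc
    (fun x hx => by rw [hk x (hΩX hx)]; exact if_pos hx) hq₀O.1 hq₁O.1
  have e2 := sub_eq_of_circle_exp_eq (k := fun _ => π) hHp (hkc.mono hHX) continuousOn_const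
    (fun x hx => by
      rw [hk x (hHX hx)]
      exact hg1 x (by change -σ * x.2 < b at hx; linarith)) hq₀H hq₁H
  change -σ * q₀.2 < b at hq₀H
  change -σ * q₁.2 < b at hq₁H
  have e3 : h q₀ = π := by
    simp only [h, hχ1 q₀ (by linarith), mul_one]
    exact if_pos hq₀V
  have e4 : h q₁ = -π := by
    simp only [h, hχ1 q₁ (by linarith), mul_one]
    exact if_neg (hdisj q₁ hq₁W)
  rw [e3, e4] at e1
  linarith [Real.pi_pos]

end SlabTranslator

lemma mk_connectedComponents_eq_of_homeomorph {X Y : Type} [TopologicalSpace X]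
    [TopologicalSpace Y] (φ : X ≃ₜ Y) :
    Cardinal.mk (ConnectedComponents X) = Cardinal.mk (ConnectedComponents Y) := by
  refine Cardinal.mk_congr (Equiv.ofBijective φ.continuous.connectedComponentsMap ⟨?_, ?_⟩)
  · have : Function.LeftInverse φ.symm.continuous.connectedComponentsMap
        φ.continuous.connectedComponentsMap := by
      intro x
      obtain ⟨x, rfl⟩ := ConnectedComponents.surjective_coe x
      rw [Continuous.connectedComponentsMap_mk, Continuous.connectedComponentsMap_mk,
        φ.symm_apply_apply]
    exact this.injective
  · exact φ.continuous.connectedComponentsMap_surjective φ.surjective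

lemma mk_connectedComponents_image {X Y : Type} [TopologicalSpace X] [TopologicalSpace Y]
    {A : Set X} {e : X → Y} {g : Y → X} (he : ContinuousOn e A) (hg : Continuous g)
    (hge : ∀ x ∈ A, g (e x) = x) :
    Cardinal.mk (ConnectedComponents (e '' A)) = Cardinal.mk (ConnectedComponents A) := by
  have h1 : Continuous (fun x : A => (⟨e x, Set.mem_image_of_mem e x.2⟩ : e '' A)) :=
    (continuousOn_iff_continuous_domRestrict.mp he).subtype_mk _
  have h2 : Continuous (fun y : e '' A => (⟨g y, by
      obtain ⟨x, hx, hxy⟩ := y.2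
      rw [← hxy, hge x hx]
      exact hx⟩ : A)) := (hg.comp continuous_subtype_val).subtype_mk _
  let φ : A ≃ₜ e '' A :=
    { toFun := fun x => ⟨e x, Set.mem_image_of_mem e x.2⟩
      invFun := fun y => ⟨g y, by
        obtain ⟨x, hx, hxy⟩ := y.2
        rw [← hxy, hge x hx]
        exact hx⟩
      left_inv := fun x => Subtype.ext (hge x x.2)
      right_inv := fun y => by
        obtain ⟨x, hx, hxy⟩ := y.2
        refine Subtype.ext ?_
        change e (g y) = y
        rw [← hxy, hge x hx]
      continuous_toFun := h1
      continuous_invFun := h2 }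
  exact (mk_connectedComponents_eq_of_homeomorph φ).symm

namespace SlabTranslator

variable {c σ w : ℝ} {Ω : Set (ℝ × ℝ)} {u : ℝ × ℝ → ℝ}

lemma exists_isConnected_sublevel (D : SlabTranslator c σ w Ω u) (hc : 0 ≤ c) :
    ∃ c₁ : ℝ, ∀ t, c₁ < t → IsConnected (Ω ∩ {q | ycoord c σ u q < t}) := by
  rcases hc.lt_or_eq with hc | rfl
  · exact D.exists_isConnected_sublevel_of_pos hc
  · obtain ⟨p, hp⟩ := D.isConnected.nonempty
    exact ⟨ycoord 0 σ u p, fun t ht => D.isConnected_sublevel_of_zero hp ht⟩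

lemma eventually_eq_of_isLocalMin' (D : SlabTranslator c σ w Ω u) (hc : 0 ≤ c) {p : ℝ × ℝ}
    (hp : p ∈ Ω) (hmin : IsLocalMin (ycoord c σ u) p) :
    ∀ᶠ q in nhds p, ycoord c σ u q = ycoord c σ u p := by
  rcases hc.lt_or_eq with hc | rfl
  · exact D.eventually_eq_of_isLocalMin hc hp hmin
  · exfalso
    have hσ : σ ^ 2 = 1 := by have := D.unit; linarith
    obtain ⟨ε, hε, hball⟩ := Metric.mem_nhds_iff.mp hmin
    have hσ1 : |σ| = 1 := by rw [← Real.sqrt_sq_eq_abs, hσ, Real.sqrt_one]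
    have h1 : (p.1, p.2 + σ * (ε / 2)) ∈ Metric.ball p ε := by
      rw [Metric.mem_ball, Prod.dist_eq, max_lt_iff, dist_self, Real.dist_eq, add_sub_cancel_left,
        abs_mul, hσ1, one_mul, abs_of_pos (by positivity)]
      exact ⟨hε, by linarith⟩
    have h2 : ycoord 0 σ u p ≤ ycoord 0 σ u (p.1, p.2 + σ * (ε / 2)) := hball h1
    simp only [ycoord, zero_mul] at h2
    have h3 : σ * (p.2 + σ * (ε / 2)) = σ * p.2 + σ ^ 2 * (ε / 2) := by ring
    rw [h3, hσ] at h2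
    linarith

theorem exists_mk_level_eq_of_nonneg (D : SlabTranslator c σ w Ω u) (hc : 0 ≤ c) :
    ∃ c₁ : ℝ, ∀ t, c₁ < t →
      Cardinal.mk (ConnectedComponents ↥(Ω ∩ {q | ycoord c σ u q = t})) =
        Cardinal.mk (ConnectedComponents ↥(Ω ∩ {q | t ≤ ycoord c σ u q})) := by
  obtain ⟨c₁, hc₁⟩ := D.exists_isConnected_sublevel hc
  refine ⟨c₁, fun t ht => ?_⟩
  have hX := hasCircleLifts_of_noIslands D.isOpen D.isConnected D.noIslands
  have h1 : ConnectedSpace Ω := isConnected_iff_connectedSpace.mp D.isConnected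
  have h2 : LocallyConnectedSpace Ω := D.isOpen.locallyConnectedSpace
  have hf : Continuous fun x : Ω => ycoord c σ u x :=
    continuousOn_iff_continuous_domRestrict.mp D.continuousOn_ycoord
  have hnh : ∀ x : Ω, Filter.map Subtype.val (nhds x) = nhds (x : ℝ × ℝ) :=
    D.isOpen.isOpenEmbedding_subtypeVal.map_nhds_eq
  have hmin : ∀ p : Ω, IsLocalMin (fun x : Ω => ycoord c σ u x) p →
      ∀ᶠ q : Ω in nhds p, ycoord c σ u q = ycoord c σ u p := by
    intro p hp
    have h3 : IsLocalMin (ycoord c σ u) (p : ℝ × ℝ) := by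
      rw [IsLocalMin, IsMinFilter, ← hnh p, Filter.eventually_map]
      exact hp
    have h4 := D.eventually_eq_of_isLocalMin' hc p.2 h3
    rw [← hnh p, Filter.eventually_map] at h4
    exact h4
  have himg : ∀ s : Set (ℝ × ℝ), Subtype.val '' {x : Ω | (x : ℝ × ℝ) ∈ s} = Ω ∩ s := by
    intro s
    exact Subtype.image_preimage_coe Ω s
  have hL : IsConnected {x : Ω | ycoord c σ u x < t} := by
    have h3 := hc₁ t ht
    rw [← himg {q | ycoord c σ u q < t}] at h3
    exact ⟨h3.nonempty.of_image, Topology.IsInducing.subtypeVal.isPreconnected_image.mp h3.2⟩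
  have h3 := mk_connectedComponents_eq (D := {x : Ω | ycoord c σ u x = t})
    (F := {x : Ω | t ≤ ycoord c σ u x}) (fun x hx => le_of_eq (Eq.symm hx))
    (fun p hp => isConnected_component_inter_level hX hf hmin hL hp)
  have h4 : ∀ s : Set (ℝ × ℝ), Cardinal.mk (ConnectedComponents ↥(Ω ∩ s)) =
      Cardinal.mk (ConnectedComponents ↥{x : Ω | (x : ℝ × ℝ) ∈ s}) := by
    intro s
    rw [← himg s]
    exact (mk_connectedComponents_eq_of_homeomorph
      (Topology.IsEmbedding.subtypeVal.homeomorphImage _)).symm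
  rw [h4, h4]
  exact h3

/-- Reversing the orientation of the last two basis vectors. -/
lemma reflect (D : SlabTranslator c σ w Ω u) :
    SlabTranslator (-c) (-σ) w {p | (p.1, -p.2) ∈ Ω} (fun p => -u (p.1, -p.2)) := by
  have hr : Continuous fun p : ℝ × ℝ => (p.1, -p.2) := by fun_prop
  have himg : ∀ s : Set (ℝ × ℝ), {p : ℝ × ℝ | (p.1, -p.2) ∈ s} = (fun p => (p.1, -p.2)) '' s := by
    intro s
    ext p
    constructor
    · intro h
      exact ⟨_, h, by simp⟩
    · rintro ⟨q, hq, rfl⟩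
      simpa using hq
  refine ⟨by linarith [D.unit], D.isOpen.preimage hr, ?_, ?_, ?_, fun p hp => D.slab (p.1, -p.2) hp, ?_⟩
  · rw [himg]
    exact D.isConnected.image _ hr.continuousOn
  · exact (D.cont.comp hr.continuousOn fun p hp => hp).neg
  · intro p hp
    obtain ⟨P, Q, A, B, C, h1, h2⟩ := D.jet _ hp
    refine ⟨-P, Q, -A, B, -C, by linarith, fun d => ?_⟩
    obtain ⟨v, hv, hv0, hv'⟩ := h2 (d.1, -d.2)
    refine ⟨fun r => -v r, ?_, ?_, ?_⟩
    · filter_upwards [hv] with r hr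
      have e : (fun x => -u (p.1 + x * d.1, -(p.2 + x * d.2))) =
          fun x => -u (p.1 + x * d.1, -p.2 + x * -d.2) := by
        funext x
        rw [show -(p.2 + x * d.2) = -p.2 + x * -d.2 by ring]
      rw [e]
      exact hr.neg
    · simp only [hv0]
      ring
    · exact hv'.neg.congr_deriv (by ring)
  · intro M
    have h3 := (D.cpt M).image hr
    rw [← himg] at h3
    convert h3 using 1
    ext p
    have e1 : ycoord (-c) (-σ) (fun p => -u (p.1, -p.2)) p = ycoord c σ u (p.1, -p.2) := by
      simp only [ycoord]; ring
    have e2 : zcoord (-c) (-σ) (fun p => -u (p.1, -p.2)) p = zcoord c σ u (p.1, -p.2) := by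
      simp only [zcoord]; ring
    simp only [Set.mem_ofPred_eq, e1, e2]

/-- Reflection in the plane spanned by the first and last coordinate directions. -/
lemma neg (D : SlabTranslator c σ w Ω u) : SlabTranslator c (-σ) w Ω (fun p => -u p) := by
  refine ⟨by linarith [D.unit], D.isOpen, D.isConnected, D.cont.neg, ?_, D.slab, ?_⟩
  · intro p hp
    obtain ⟨P, Q, A, B, C, h1, h2⟩ := D.jet _ hp
    refine ⟨-P, -Q, -A, -B, -C, by linarith, fun d => ?_⟩
    obtain ⟨v, hv, hv0, hv'⟩ := h2 d
    refine ⟨fun r => -v r, ?_, ?_, ?_⟩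
    · filter_upwards [hv] with r hr
      exact hr.neg
    · simp only [hv0]
      ring
    · exact hv'.neg.congr_deriv (by ring)
  · intro M
    convert D.cpt M using 1
    ext p
    have e1 : ycoord c (-σ) (fun p => -u p) p = -ycoord c σ u p := by
      simp only [ycoord]; ring
    have e2 : zcoord c (-σ) (fun p => -u p) p = zcoord c σ u p := by
      simp only [zcoord]; ring
    simp only [Set.mem_ofPred_eq, e1, e2, abs_neg]

theorem exists_mk_level_eq (D : SlabTranslator c σ w Ω u) :
    ∃ c₁ : ℝ, ∀ t, c₁ < t →
      Cardinal.mk (ConnectedComponents ↥(Ω ∩ {q | ycoord c σ u q = t})) =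
        Cardinal.mk (ConnectedComponents ↥(Ω ∩ {q | t ≤ ycoord c σ u q})) := by
  rcases le_total 0 c with hc | hc
  · exact D.exists_mk_level_eq_of_nonneg hc
  · obtain ⟨c₁, hc₁⟩ := D.reflect.exists_mk_level_eq_of_nonneg (neg_nonneg.mpr hc)
    refine ⟨c₁, fun t ht => ?_⟩
    have hr : Continuous fun p : ℝ × ℝ => (p.1, -p.2) := by fun_prop
    have e1 : ∀ p, ycoord (-c) (-σ) (fun p => -u (p.1, -p.2)) p = ycoord c σ u (p.1, -p.2) := by
      intro p
      simp only [ycoord]; ring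
    have key : ∀ s : Set ℝ, Cardinal.mk (ConnectedComponents ↥({p : ℝ × ℝ | (p.1, -p.2) ∈ Ω} ∩
        {q | ycoord (-c) (-σ) (fun p => -u (p.1, -p.2)) q ∈ s})) =
        Cardinal.mk (ConnectedComponents ↥(Ω ∩ {q | ycoord c σ u q ∈ s})) := by
      intro s
      have hs : {p : ℝ × ℝ | (p.1, -p.2) ∈ Ω} ∩
          {q | ycoord (-c) (-σ) (fun p => -u (p.1, -p.2)) q ∈ s} =
          (fun p : ℝ × ℝ => (p.1, -p.2)) '' (Ω ∩ {q | ycoord c σ u q ∈ s}) := by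
        ext p
        constructor
        · rintro ⟨h1, h2⟩
          refine ⟨(p.1, -p.2), ⟨h1, ?_⟩, by simp⟩
          rw [Set.mem_ofPred_eq, e1] at h2
          exact h2
        · rintro ⟨q, ⟨h1, h2⟩, rfl⟩
          refine ⟨by simpa using h1, ?_⟩
          rw [Set.mem_ofPred_eq, e1]
          simpa using h2
      rw [hs]
      exact mk_connectedComponents_image hr.continuousOn hr (fun x _ => by simp)
    have h1 := hc₁ t ht
    have h2 := key {t}
    have h3 := key (Set.Ici t)
    exact h2.symm.trans (h1.trans h3)

end SlabTranslator

lemma hasLineJet_of_contDiffAt {u : ℝ × ℝ → ℝ} {p : ℝ × ℝ} (hu : ContDiffAt ℝ 2 u p)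
    (d : ℝ × ℝ) :
    HasLineJet u p d (pds u p * d.1 + pdt u p * d.2)
      (pds (fun q => pds u q) p * d.1 ^ 2 + 2 * pdt (fun q => pds u q) p * d.1 * d.2 +
        pdt (fun q => pdt u q) p * d.2 ^ 2) := by
  have hd : d = d.1 • ((1, 0) : ℝ × ℝ) + d.2 • ((0, 1) : ℝ × ℝ) := by ext <;> simp
  have hline : ∀ r : ℝ, HasDerivAt (fun r : ℝ => (p.1 + r * d.1, p.2 + r * d.2)) d r := by
    intro r
    have h1 := ((hasDerivAt_id r).mul_const d.1).const_add p.1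
    have h2 := ((hasDerivAt_id r).mul_const d.2).const_add p.2
    have := h1.prodMk h2
    simpa using this
  have hcont : Continuous fun r : ℝ => (p.1 + r * d.1, p.2 + r * d.2) := by fun_prop
  have h0 : ((p.1 + 0 * d.1, p.2 + 0 * d.2) : ℝ × ℝ) = p := by simp
  have hev : ∀ᶠ q in nhds p, DifferentiableAt ℝ u q := by
    filter_upwards [hu.eventually (by simp)] with q hq
    exact hq.differentiableAt (by simp)
  have hfd : DifferentiableAt ℝ (fderiv ℝ u) p :=
    (hu.fderiv_right (m := 1) (by norm_num)).differentiableAt (by simp)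
  have hsymm : IsSymmSndFDerivAt ℝ u p := hu.isSymmSndFDerivAt (by simp)
  have happ : ∀ a b : ℝ × ℝ, fderiv ℝ (fun q => fderiv ℝ u q a) p b =
      fderiv ℝ (fderiv ℝ u) p b a := by
    intro a b
    rw [fderiv_clm_apply hfd (differentiableAt_const a)]
    simp
  refine ⟨fun r => fderiv ℝ u (p.1 + r * d.1, p.2 + r * d.2) d, ?_, ?_, ?_⟩
  · have ht : Filter.Tendsto (fun r : ℝ => (p.1 + r * d.1, p.2 + r * d.2)) (nhds 0) (nhds p) := by
      have := hcont.tendsto 0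
      rwa [h0] at this
    filter_upwards [ht.eventually hev] with r hr
    exact hr.hasFDerivAt.comp_hasDerivAt r (hline r)
  · simp only [h0, pds, pdt]
    conv_lhs => rw [hd]
    rw [map_add, map_smul, map_smul, smul_eq_mul, smul_eq_mul]
    ring
  · have h1 : HasFDerivAt (fun q => fderiv ℝ u q d) ((fderiv ℝ (fderiv ℝ u) p).flip d) p := by
      simpa using hfd.hasFDerivAt.clm_apply (hasFDerivAt_const d p)
    have h2 := h1.comp_hasDerivAt_of_eq (0 : ℝ) (hline 0) h0.symm
    refine h2.congr_deriv ?_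
    have e : fderiv ℝ (fderiv ℝ u) p d d = pds (fun q => pds u q) p * d.1 ^ 2 +
        2 * pdt (fun q => pds u q) p * d.1 * d.2 + pdt (fun q => pdt u q) p * d.2 ^ 2 := by
      simp only [pds, pdt, happ]
      have e1 := hsymm (0, 1) (1, 0)
      conv_lhs => rw [hd]
      simp only [map_add, map_smul, smul_eq_mul, add_apply,
        smul_apply]
      rw [← e1]
      ring
    rw [← e, ContinuousLinearMap.flip_apply]

section

variable {θ w : ℝ} {Ω : Set (ℝ × ℝ)} {u : ℝ × ℝ → ℝ} {S : Set E3}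

lemma graphPtθ_zero (p : ℝ × ℝ) : graphPtθ θ u p 0 = p.1 := by
  simp [graphPtθ, vθ, bθ, e1, e2, e3]

lemma graphPtθ_one (p : ℝ × ℝ) : graphPtθ θ u p 1 = ycoord (cos θ) (sin θ) u p := by
  simp [graphPtθ, vθ, bθ, e1, e2, e3, ycoord]
  ring

lemma graphPtθ_two (p : ℝ × ℝ) : graphPtθ θ u p 2 = zcoord (cos θ) (sin θ) u p := by
  simp [graphPtθ, vθ, bθ, e1, e2, e3, zcoord]
  ring

/-- The projection of `ℝ³` to the parameter plane. -/
def paramθ (θ : ℝ) (q : E3) : ℝ × ℝ := (q 0, cos θ * q 2 - sin θ * q 1)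

lemma continuous_paramθ : Continuous (paramθ θ) := by
  unfold paramθ
  fun_prop

lemma paramθ_graphPtθ (p : ℝ × ℝ) : paramθ θ (graphPtθ θ u p) = p := by
  refine Prod.ext (graphPtθ_zero p) ?_
  simp only [paramθ, graphPtθ_one, graphPtθ_two, ycoord, zcoord]
  linear_combination p.2 * sin_sq_add_cos_sq θ

lemma isCompact_box (K : ℝ) : IsCompact {q : E3 | ∀ i, |q i| ≤ K} := by
  have h := (EuclideanSpace.equiv (Fin 3) ℝ).toHomeomorph.isCompact_preimage.mpr
    (isCompact_Icc (a := fun _ : Fin 3 => -K) (b := fun _ => K))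
  convert h using 1
  ext q
  simp [Pi.le_def, abs_le, forall_and]

lemma IsTranslatingGraph.image_eq (h : IsTranslatingGraph e1 (bθ θ) (vθ θ) Ω u S) :
    S = graphPtθ θ u '' Ω := by
  rw [h.graph_eq]
  ext q
  constructor
  · rintro ⟨p, hp, rfl⟩
    exact ⟨p, hp, rfl⟩
  · rintro ⟨p, hp, rfl⟩
    exact ⟨p, hp, rfl⟩

lemma IsTranslatingGraph.slabTranslator (h : IsTranslatingGraph e1 (bθ θ) (vθ θ) Ω u S)
    (hS : IsClosed S) (hslab : S ⊆ {q : E3 | |q 0| ≤ w}) :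
    SlabTranslator (cos θ) (sin θ) w Ω u := by
  have himg := h.image_eq
  have hsl : ∀ p ∈ Ω, |p.1| ≤ w := by
    intro p hp
    have h1 : graphPtθ θ u p ∈ S := himg ▸ Set.mem_image_of_mem _ hp
    have h2 : |graphPtθ θ u p 0| ≤ w := hslab h1
    rwa [graphPtθ_zero] at h2
  refine ⟨cos_sq_add_sin_sq θ, h.isOpen_dom, h.isConnected_dom, h.smooth.continuousOn, ?_, hsl, ?_⟩
  · intro p hp
    have hu : ContDiffAt ℝ 2 u p :=
      ((h.smooth.contDiffAt (h.isOpen_dom.mem_nhds hp)).of_le (by norm_cast))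
    refine ⟨pds u p, pdt u p, _, _, _, ?_, fun d => hasLineJet_of_contDiffAt hu d⟩
    have h1 := h.pde p hp
    have i1 : ⟪e3, vθ θ⟫ = sin θ := by
      simp [vθ, e2, e3, inner_add_right, inner_smul_right, EuclideanSpace.inner_single_left]
    have i2 : ⟪e3, e1⟫ = 0 := by simp [e1, e3, EuclideanSpace.inner_single_left]
    have i3 : ⟪e3, bθ θ⟫ = cos θ := by
      simp [bθ, e2, e3, inner_sub_right, inner_smul_right, EuclideanSpace.inner_single_left]
    rw [i1, i2, i3, mul_zero, sub_zero] at h1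
    exact h1
  · intro M
    have h1 : IsCompact ({q : E3 | ∀ i, |q i| ≤ max w M} ∩ (S ∩ {q | |q 1| ≤ M ∧ |q 2| ≤ M})) := by
      refine (isCompact_box _).inter_right (hS.inter ?_)
      have c1 : IsClosed {q : E3 | |q 1| ≤ M} := isClosed_le (by fun_prop) continuous_const
      have c2 : IsClosed {q : E3 | |q 2| ≤ M} := isClosed_le (by fun_prop) continuous_const
      exact c1.inter c2
    convert h1.image (continuous_paramθ (θ := θ)) using 1
    ext p
    constructor
    · rintro ⟨hp, hy, hz⟩
      refine ⟨graphPtθ θ u p, ⟨?_, himg ▸ Set.mem_image_of_mem _ hp, ?_, ?_⟩, paramθ_graphPtθ p⟩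
      · intro i
        fin_cases i
        · change |graphPtθ θ u p 0| ≤ _
          rw [graphPtθ_zero]
          exact (hsl p hp).trans (le_max_left _ _)
        · change |graphPtθ θ u p 1| ≤ _
          rw [graphPtθ_one]
          exact hy.trans (le_max_right _ _)
        · change |graphPtθ θ u p 2| ≤ _
          rw [graphPtθ_two]
          exact hz.trans (le_max_right _ _)
      · rwa [graphPtθ_one]
      · rwa [graphPtθ_two]
    · rintro ⟨q, ⟨-, hqS, hq1, hq2⟩, rfl⟩
      rw [himg] at hqS
      obtain ⟨p, hp, rfl⟩ := hqS
      rw [graphPtθ_one] at hq1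
      rw [graphPtθ_two] at hq2
      rw [paramθ_graphPtθ]
      exact ⟨hp, hq1, hq2⟩

lemma IsTranslatingGraph.numComponents_inter (h : IsTranslatingGraph e1 (bθ θ) (vθ θ) Ω u S)
    (T : Set ℝ) : numComponents (S ∩ {q : E3 | q 1 ∈ T}) =
      Cardinal.mk (ConnectedComponents ↥(Ω ∩ {p | ycoord (cos θ) (sin θ) u p ∈ T})) := by
  have hs : S ∩ {q : E3 | q 1 ∈ T} =
      graphPtθ θ u '' (Ω ∩ {p | ycoord (cos θ) (sin θ) u p ∈ T}) := by
    rw [h.image_eq]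
    ext q
    constructor
    · rintro ⟨⟨p, hp, rfl⟩, hq⟩
      rw [Set.mem_ofPred_eq, graphPtθ_one] at hq
      exact ⟨p, ⟨hp, hq⟩, rfl⟩
    · rintro ⟨p, ⟨hp, hq⟩, rfl⟩
      refine ⟨⟨p, hp, rfl⟩, ?_⟩
      rw [Set.mem_ofPred_eq, graphPtθ_one]
      exact hq
  rw [numComponents, hs]
  have hc : ContinuousOn (graphPtθ θ u) Ω := by
    have hu := h.smooth.continuousOn
    unfold graphPtθ
    fun_prop
  exact mk_connectedComponents_image (hc.mono Set.inter_subset_left) continuous_paramθ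
    (fun p _ => paramθ_graphPtθ p)

end

/-- for `t` large, the slice `Σ ∩ {y = t}` has exactly as many connected
components as `Σ ∩ {y ≥ t}`, and analogously on the left side. -/
theorem stmt9 (θ : ℝ) (hθ : θ ∈ Set.Ico 0 π) (Ω : Set (ℝ × ℝ)) (u : ℝ × ℝ → ℝ) (S : Set E3)
    (hgraph : IsTranslatingGraph e1 (bθ θ) (vθ θ) Ω u S) (hcomplete : IsClosed S)
    (w : ℝ) (hw : 0 < w) (hslab : S ⊆ {q : E3 | |q 0| ≤ w}) :
    ∃ t₁ : ℝ, 0 < t₁ ∧ ∀ t : ℝ, t₁ < t →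
      numComponents (S ∩ {q : E3 | q 1 = t}) = numComponents (S ∩ {q : E3 | t ≤ q 1}) ∧
      numComponents (S ∩ {q : E3 | q 1 = -t}) = numComponents (S ∩ {q : E3 | q 1 ≤ -t}) := by
  have D := hgraph.slabTranslator hcomplete hslab
  obtain ⟨a, ha⟩ := D.exists_mk_level_eq
  obtain ⟨b, hb⟩ := D.neg.exists_mk_level_eq
  refine ⟨max (max a b) 1, by positivity, fun t ht => ?_⟩
  rw [max_lt_iff, max_lt_iff] at ht
  constructor
  · have h1 := hgraph.numComponents_inter {t}
    have h2 := hgraph.numComponents_inter (Set.Ici t)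
    exact h1.trans ((ha t ht.1.1).trans h2.symm)
  · have h1 := hgraph.numComponents_inter {-t}
    have h2 := hgraph.numComponents_inter (Set.Iic (-t))
    have h3 := hb t ht.1.2
    have hy : ∀ p, ycoord (cos θ) (-sin θ) (fun p => -u p) p = -ycoord (cos θ) (sin θ) u p := by
      intro p
      simp only [ycoord]
      ring
    have s1 : {q | ycoord (cos θ) (-sin θ) (fun p => -u p) q = t} =
        {p | ycoord (cos θ) (sin θ) u p ∈ ({-t} : Set ℝ)} := by
      ext p
      rw [Set.mem_ofPred_eq, Set.mem_ofPred_eq, hy, Set.mem_singleton_iff, neg_eq_iff_eq_neg]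
    have s2 : {q | t ≤ ycoord (cos θ) (-sin θ) (fun p => -u p) q} =
        {p | ycoord (cos θ) (sin θ) u p ∈ Set.Iic (-t)} := by
      ext p
      rw [Set.mem_ofPred_eq, Set.mem_ofPred_eq, hy, Set.mem_Iic, le_neg]
    rw [s1, s2] at h3
    exact h1.trans (h3.trans h2.symm)
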